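/- Let K be a positive semidefinite symmetric 2n×2n matrix and assume ∇²h(x,v) ≥ −K for all (x,v). Let N : (0,T) → Sym(2n,ℝ) be a differentiable solution of the matrix Riccati equation N'(t) = N(t)C + Cᵀ N(t) + N(t) D N(t) − K which is invertible for each t, with N(t)⁻¹ → 0 as t → 0⁺, N(t) ≤ 0 and N'(t) ≥ 0 for all t. Then for every t ∈ (0,T) and every (x,v) ∈ ℝⁿ×ℝⁿ, ∇² log ρ(t,x,v) − ½∇²U(x,v) ≥ N(t) as symmetric 2n×2n matrices. -/

import Mathlib

noncomputable section
open Real Set Matrix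

/-- `ℝⁿ` with the Euclidean norm. -/
abbrev E (n : ℕ) := EuclideanSpace ℝ (Fin n)

/-- The standard basis of `ℝⁿ × ℝⁿ`, indexed by `Fin n ⊕ Fin n`: `Sum.inl i` is the `i`-th
`x`-direction and `Sum.inr i` is the `i`-th `v`-direction. -/
def stdBasis (n : ℕ) : Fin n ⊕ Fin n → E n × E n
  | Sum.inl i => (EuclideanSpace.single i 1, 0)
  | Sum.inr i => (0, EuclideanSpace.single i 1)

/-- Partial derivative of `φ : ℝⁿ × ℝⁿ → ℝ` in the `j`-th coordinate direction. -/
def pd {n : ℕ} (φ : E n × E n → ℝ) (j : Fin n ⊕ Fin n) (p : E n × E n) : ℝ :=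
  fderiv ℝ φ p (stdBasis n j)

/-- The full Hessian of `φ` in the variables `(x, v)`, as a `2n × 2n` matrix. -/
def Hess {n : ℕ} (φ : E n × E n → ℝ) (p : E n × E n) :
    Matrix (Fin n ⊕ Fin n) (Fin n ⊕ Fin n) ℝ :=
  Matrix.of fun i j => pd (pd φ j) i p

/-- The Laplacian in the `v`-variables: `Δ_v φ = Σᵢ ∂²φ/∂vᵢ²`. -/
def lapV {n : ℕ} (φ : E n × E n → ℝ) (p : E n × E n) : ℝ :=
  ∑ i : Fin n, pd (pd φ (Sum.inr i)) (Sum.inr i) p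

/-- The squared Euclidean norm of the full gradient `∇φ`. -/
def gradNormSq {n : ℕ} (φ : E n × E n → ℝ) (p : E n × E n) : ℝ :=
  ∑ j : Fin n ⊕ Fin n, (pd φ j p) ^ 2

/-- The function `h = -½⟨v, ∇ₓU⟩ + ½Δ_v U - ¼|∇_v U|²`. -/
def hfun {n : ℕ} (U : E n × E n → ℝ) (p : E n × E n) : ℝ :=
  -(1/2) * (∑ i : Fin n, p.2 i * pd U (Sum.inl i) p) + (1/2) * lapV U p
    - (1/4) * ∑ i : Fin n, (pd U (Sum.inr i) p) ^ 2

/-- The block-diagonal matrix `[[a·I, 0], [0, b·I]]`. -/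
def blockDiag (n : ℕ) (a b : ℝ) : Matrix (Fin n ⊕ Fin n) (Fin n ⊕ Fin n) ℝ :=
  Matrix.fromBlocks (a • 1) 0 0 (b • 1)

/-- The right-hand side `½·[[-(s₁/s₀)I, (s₂/s₀)I], [(s₂/s₀)I, -(s₀'/s₀)I]]` of the
matrix differential Harnack inequality. -/
def harnackMatrix (n : ℕ) (s₀ s₁ s₂ : ℝ → ℝ) (t : ℝ) :
    Matrix (Fin n ⊕ Fin n) (Fin n ⊕ Fin n) ℝ :=
  (1/2 : ℝ) • Matrix.fromBlocks (-(s₁ t / s₀ t) • 1) ((s₂ t / s₀ t) • 1)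
    ((s₂ t / s₀ t) • 1) (-(deriv s₀ t / s₀ t) • 1)

/-- The `2n × 2n` matrix `C = [[0, −I], [0, 0]]` in `n × n` block form. -/
def Cmat (n : ℕ) : Matrix (Fin n ⊕ Fin n) (Fin n ⊕ Fin n) ℝ :=
  Matrix.fromBlocks 0 (-1) 0 0

/-- The `2n × 2n` matrix `D = [[0, 0], [0, 2I]]` in `n × n` block form. -/
def Dmat (n : ℕ) : Matrix (Fin n ⊕ Fin n) (Fin n ⊕ Fin n) ℝ :=
  Matrix.fromBlocks 0 0 0 ((2 : ℝ) • 1)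

/-! ### One-variable calculus -/

/-- Second derivative test: at a local minimum the second derivative is nonnegative. -/
lemma second_deriv_nonneg_of_isLocalMin {f f' : ℝ → ℝ} {f'' a : ℝ}
    (h1 : ∀ s, HasDerivAt f (f' s) s) (h2 : HasDerivAt f' f'' a) (hm : IsLocalMin f a) :
    0 ≤ f'' := by
  by_contra! hneg
  have hd : deriv f = f' := funext fun s => (h1 s).deriv
  have h0 : deriv f a = 0 := hm.deriv_eq_zero
  have hdd : deriv (deriv f) a < 0 := by rw [hd, h2.deriv]; exact hneg
  have hmax := isLocalMax_of_deriv_deriv_neg hdd h0 (h1 a).continuousAt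
  have hconst : f =ᶠ[nhds a] fun _ => f a := by
    filter_upwards [hm, hmax] with s hs1 hs2 using le_antisymm hs2 hs1
  have h3 : deriv f =ᶠ[nhds a] fun _ => 0 := by simpa using hconst.deriv
  have h4 := h3.deriv_eq
  rw [hd, h2.deriv] at h4
  simp at h4
  linarith

/-- If `f` on the left of `0` is at least `f 0`, then the derivative at `0` is nonpositive. -/
lemma deriv_nonpos_of_left_min {f : ℝ → ℝ} {f' : ℝ} (h : HasDerivAt f f' 0)
    (hm : ∀ᶠ s in nhdsWithin 0 (Iio (0 : ℝ)), f 0 ≤ f s) : f' ≤ 0 := by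
  have h1 := h.hasDerivWithinAt (s := Iio (0 : ℝ))
  rw [hasDerivWithinAt_iff_tendsto_slope' (by simp)] at h1
  refine le_of_tendsto h1 ?_
  filter_upwards [hm, self_mem_nhdsWithin] with s hs hs'
  rw [slope_def_field]
  exact div_nonpos_of_nonneg_of_nonpos (by linarith) (by simpa using le_of_lt hs')

/-- Second order Taylor lower bound on `[0, 1]`. -/
lemma taylor_lower_of_second_deriv {f f' f'' : ℝ → ℝ} {k : ℝ}
    (h1 : ∀ s, HasDerivAt f (f' s) s) (h2 : ∀ s, HasDerivAt f' (f'' s) s)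
    (hk : ∀ s ∈ Icc (0 : ℝ) 1, -k ≤ f'' s) : f 0 + f' 0 - k / 2 ≤ f 1 := by
  have hd1 : ∀ s, HasDerivAt (fun s => f' s + k * s) (f'' s + k) s := fun s => by
    simpa using (h2 s).fun_add ((hasDerivAt_id s).const_mul k)
  have m1 : MonotoneOn (fun s => f' s + k * s) (Icc 0 1) := by
    apply monotoneOn_of_deriv_nonneg (convex_Icc 0 1)
    · exact fun s _ => (hd1 s).continuousAt.continuousWithinAt
    · exact fun s _ => (hd1 s).differentiableAt.differentiableWithinAt
    · intro s hs
      rw [(hd1 s).deriv]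
      linarith [hk s (interior_subset hs)]
  have hd2 : ∀ s, HasDerivAt (fun s => f s + k / 2 * s ^ 2 - f' 0 * s)
      (f' s + k * s - f' 0) s := fun s => by
    refine (((h1 s).fun_add ((hasDerivAt_pow 2 s).const_mul (k / 2))).fun_sub
      ((hasDerivAt_id' s).const_mul (f' 0))).congr_deriv ?_
    norm_num
    ring
  have m2 : MonotoneOn (fun s => f s + k / 2 * s ^ 2 - f' 0 * s) (Icc 0 1) := by
    apply monotoneOn_of_deriv_nonneg (convex_Icc 0 1)
    · exact fun s _ => (hd2 s).continuousAt.continuousWithinAt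
    · exact fun s _ => (hd2 s).differentiableAt.differentiableWithinAt
    · intro s hs
      have hs' : s ∈ Icc (0 : ℝ) 1 := interior_subset hs
      rw [(hd2 s).deriv]
      have := m1 (by simp) hs' hs'.1
      simp at this
      linarith
  have := m2 (a := 0) (by simp) (b := 1) (by simp) zero_le_one
  simp at this
  linarith

/-! ### Coordinates on phase space -/

/-- The squared Euclidean norm on `ℝⁿ × ℝⁿ`. -/
def normSq {n : ℕ} (p : E n × E n) : ℝ := ‖p.1‖ ^ 2 + ‖p.2‖ ^ 2

/-- The coordinate vector of a point of `ℝⁿ × ℝⁿ`. -/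
def coords {n : ℕ} (p : E n × E n) : Fin n ⊕ Fin n → ℝ := Sum.elim (fun i => p.1 i) (fun i => p.2 i)

lemma normSq_nonneg {n : ℕ} (p : E n × E n) : 0 ≤ normSq p := by unfold normSq; positivity

@[simp] lemma normSq_zero {n : ℕ} : normSq (0 : E n × E n) = 0 := by simp [normSq]

lemma normSq_eq_zero {n : ℕ} {p : E n × E n} : normSq p = 0 ↔ p = 0 := by
  constructor
  · intro h
    unfold normSq at h
    have h1 : ‖p.1‖ = 0 := by nlinarith [sq_nonneg ‖p.1‖, sq_nonneg ‖p.2‖]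
    have h2 : ‖p.2‖ = 0 := by nlinarith [sq_nonneg ‖p.1‖, sq_nonneg ‖p.2‖]
    exact Prod.ext (norm_eq_zero.1 h1) (norm_eq_zero.1 h2)
  · rintro rfl; simp

lemma normSq_pos {n : ℕ} {p : E n × E n} (hp : p ≠ 0) : 0 < normSq p :=
  lt_of_le_of_ne (normSq_nonneg p) fun h => hp (normSq_eq_zero.1 h.symm)

lemma normSq_smul {n : ℕ} (c : ℝ) (p : E n × E n) : normSq (c • p) = c ^ 2 * normSq p := by
  simp only [normSq, Prod.smul_fst, Prod.smul_snd, norm_smul, mul_pow, Real.norm_eq_abs, sq_abs]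
  ring

@[simp] lemma normSq_neg {n : ℕ} (p : E n × E n) : normSq (-p) = normSq p := by
  simp [normSq]

lemma normSq_add_le {n : ℕ} (p q : E n × E n) : normSq (p + q) ≤ 2 * normSq p + 2 * normSq q := by
  have h1 : ‖p.1 + q.1‖ ^ 2 ≤ (‖p.1‖ + ‖q.1‖) ^ 2 := by gcongr; exact norm_add_le _ _
  have h2 : ‖p.2 + q.2‖ ^ 2 ≤ (‖p.2‖ + ‖q.2‖) ^ 2 := by gcongr; exact norm_add_le _ _
  simp only [normSq, Prod.fst_add, Prod.snd_add]
  nlinarith [sq_nonneg (‖p.1‖ - ‖q.1‖), sq_nonneg (‖p.2‖ - ‖q.2‖)]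

lemma normSq_sub_le {n : ℕ} (p q : E n × E n) : normSq (p - q) ≤ 2 * normSq p + 2 * normSq q := by
  rw [sub_eq_add_neg]; simpa using normSq_add_le p (-q)

lemma contDiff_normSq {n : ℕ} : ContDiff ℝ (⊤ : ℕ∞) (normSq (n := n)) := by
  unfold normSq
  exact (contDiff_fst.norm_sq ℝ).add (contDiff_snd.norm_sq ℝ)

@[fun_prop] lemma continuous_normSq {n : ℕ} : Continuous (normSq (n := n)) :=
  contDiff_normSq.continuous

lemma isCompact_normSq_le {n : ℕ} (R : ℝ) : IsCompact {p : E n × E n | normSq p ≤ R} := by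
  refine Metric.isCompact_of_isClosed_isBounded (isClosed_le continuous_normSq continuous_const) ?_
  refine (Metric.isBounded_closedBall (x := (0 : E n × E n)) (r := 1 + |R|)).subset ?_
  intro p hp
  simp only [mem_ofPred_eq, normSq] at hp
  have h1 : R ≤ |R| := le_abs_self R
  have h0 := abs_nonneg R
  rw [mem_closedBall_zero_iff, Prod.norm_def]
  refine max_le ?_ ?_
  · nlinarith [sq_nonneg ‖p.2‖, norm_nonneg p.1]
  · nlinarith [sq_nonneg ‖p.1‖, norm_nonneg p.2]

lemma norm_sq_eq_sum {n : ℕ} (x : E n) : ‖x‖ ^ 2 = ∑ i, x i ^ 2 := by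
  simp [EuclideanSpace.norm_sq_eq]

lemma coords_dot_self {n : ℕ} (p : E n × E n) : coords p ⬝ᵥ coords p = normSq p := by
  simp only [coords, dotProduct, normSq, norm_sq_eq_sum, Fintype.sum_sum_type, Sum.elim_inl,
    Sum.elim_inr, ← sq]

lemma coords_smul {n : ℕ} (c : ℝ) (p : E n × E n) : coords (c • p) = c • coords p := by
  ext (i | i) <;> simp [coords]

lemma coords_neg {n : ℕ} (p : E n × E n) : coords (-p) = - coords p := by
  ext (i | i) <;> simp [coords]

lemma sum_coords_smul_stdBasis {n : ℕ} (p : E n × E n) :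
    ∑ j, coords p j • stdBasis n j = p := by
  rw [Fintype.sum_sum_type]
  refine Prod.ext ?_ ?_
  · ext k
    simp [coords, _root_.stdBasis, Prod.fst_sum, Pi.single_apply]
  · ext k
    simp [coords, _root_.stdBasis, Prod.snd_sum, Pi.single_apply]

/-- Every vector of coordinates comes from a point. -/
lemma exists_coords_eq {n : ℕ} (y : Fin n ⊕ Fin n → ℝ) : ∃ p : E n × E n, coords p = y :=
  ⟨(WithLp.toLp 2 fun i => y (Sum.inl i), WithLp.toLp 2 fun i => y (Sum.inr i)), by
    ext (i | i) <;> simp [coords]⟩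

lemma clm_eq_sum {n : ℕ} (L : E n × E n →L[ℝ] ℝ) (d : E n × E n) :
    L d = ∑ j, coords d j * L (stdBasis n j) := by
  conv_lhs => rw [← sum_coords_smul_stdBasis d]
  simp

lemma fderiv_eq_sum_pd {n : ℕ} (φ : E n × E n → ℝ) (p d : E n × E n) :
    fderiv ℝ φ p d = ∑ j, coords d j * pd φ j p := clm_eq_sum _ d

/-! ### Derivatives along lines -/

lemma contDiff_pd {n : ℕ} {φ : E n × E n → ℝ} (hφ : ContDiff ℝ (⊤ : ℕ∞) φ) (j : Fin n ⊕ Fin n) :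
    ContDiff ℝ (⊤ : ℕ∞) (pd φ j) := by
  unfold pd
  exact (hφ.fderiv_right (m := (⊤ : ℕ∞)) (by norm_cast)).clm_apply contDiff_const

lemma ContDiff.hasFDerivAt_top {F : Type*} [NormedAddCommGroup F] [NormedSpace ℝ F] {φ : F → ℝ}
    (hφ : ContDiff ℝ (⊤ : ℕ∞) φ) (p : F) : HasFDerivAt φ (fderiv ℝ φ p) p :=
  (hφ.differentiable (by simp) p).hasFDerivAt

lemma hasDerivAt_line {F : Type*} [NormedAddCommGroup F] [NormedSpace ℝ F] (p d : F) (s : ℝ) :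
    HasDerivAt (fun s : ℝ => p + s • d) d s := by
  simpa using ((hasDerivAt_id s).smul_const d).const_add p

lemma hasDerivAt_comp_line {F : Type*} [NormedAddCommGroup F] [NormedSpace ℝ F] {φ : F → ℝ}
    (hφ : ContDiff ℝ (⊤ : ℕ∞) φ) (p d : F) (s : ℝ) :
    HasDerivAt (fun s : ℝ => φ (p + s • d)) (fderiv ℝ φ (p + s • d) d) s :=
  (hφ.hasFDerivAt_top _).comp_hasDerivAt s (hasDerivAt_line p d s)

lemma hasDerivAt_fderiv_line {n : ℕ} {φ : E n × E n → ℝ} (hφ : ContDiff ℝ (⊤ : ℕ∞) φ)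
    (p d : E n × E n) (s : ℝ) :
    HasDerivAt (fun s : ℝ => fderiv ℝ φ (p + s • d) d)
      (coords d ⬝ᵥ Hess φ (p + s • d) *ᵥ coords d) s := by
  have h : ∀ j ∈ Finset.univ, HasDerivAt (fun s : ℝ => coords d j * pd φ j (p + s • d))
      (coords d j * ∑ i, coords d i * pd (pd φ j) i (p + s • d)) s := fun j _ => by
    have := (hasDerivAt_comp_line (contDiff_pd hφ j) p d s).const_mul (coords d j)
    rwa [fderiv_eq_sum_pd (pd φ j)] at this
  have h2 := HasDerivAt.fun_sum h
  rw [show (fun s : ℝ => fderiv ℝ φ (p + s • d) d) =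
    fun s : ℝ => ∑ j, coords d j * pd φ j (p + s • d) from funext fun s => fderiv_eq_sum_pd φ _ _]
  refine h2.congr_deriv ?_
  simp only [dotProduct, mulVec, Hess, of_apply, Finset.mul_sum]
  rw [Finset.sum_comm]
  exact Finset.sum_congr rfl fun j _ => Finset.sum_congr rfl fun i _ => by ring

lemma quad_nonneg {n : ℕ} {M : Matrix (Fin n ⊕ Fin n) (Fin n ⊕ Fin n) ℝ} (hM : M.PosSemidef)
    (y : Fin n ⊕ Fin n → ℝ) : 0 ≤ y ⬝ᵥ M *ᵥ y := by
  simpa using hM.dotProduct_mulVec_nonneg y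

/-- Second order Taylor lower bound from a matrix lower bound of the Hessian. -/
lemma taylor_lower_of_hess {n : ℕ} {φ : E n × E n → ℝ} (hφ : ContDiff ℝ (⊤ : ℕ∞) φ)
    {M : Matrix (Fin n ⊕ Fin n) (Fin n ⊕ Fin n) ℝ} {p d : E n × E n}
    (hM : ∀ s ∈ Icc (0 : ℝ) 1, (Hess φ (p + s • d) + M).PosSemidef) :
    φ p + fderiv ℝ φ p d - (coords d ⬝ᵥ M *ᵥ coords d) / 2 ≤ φ (p + d) := by
  have := taylor_lower_of_second_deriv (hasDerivAt_comp_line hφ p d)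
    (hasDerivAt_fderiv_line hφ p d) (k := coords d ⬝ᵥ M *ᵥ coords d) (fun s hs => by
      have := quad_nonneg (hM s hs) (coords d)
      rw [add_mulVec, dotProduct_add] at this
      linarith)
  simpa using this

lemma quad_smul_one {n : ℕ} (k : ℝ) (d : E n × E n) :
    coords d ⬝ᵥ (k • (1 : Matrix (Fin n ⊕ Fin n) (Fin n ⊕ Fin n) ℝ)) *ᵥ coords d
      = k * normSq d := by
  rw [smul_mulVec, one_mulVec, dotProduct_smul, coords_dot_self, smul_eq_mul]

lemma hess_isSymm {n : ℕ} {φ : E n × E n → ℝ} (hφ : ContDiff ℝ (⊤ : ℕ∞) φ) (p : E n × E n) :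
    (Hess φ p).IsSymm := by
  ext i j
  have hs : IsSymmSndFDerivAt ℝ φ p :=
    hφ.contDiffAt.isSymmSndFDerivAt (by simp only [minSmoothness_of_isRCLikeNormedField]; exact WithTop.coe_le_coe.2 le_top)
  have hd : DifferentiableAt ℝ (fderiv ℝ φ) p :=
    (hφ.fderiv_right (m := (⊤ : ℕ∞)) (by norm_cast)).differentiable (by simp) p
  have key : ∀ i j, pd (pd φ j) i p
      = fderiv ℝ (fderiv ℝ φ) p (stdBasis n i) (stdBasis n j) := fun i j => by
    have : HasFDerivAt (pd φ j) _ p :=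
      hd.hasFDerivAt.clm_apply (hasFDerivAt_const (stdBasis n j) p)
    simp [pd, this.fderiv]
  simp only [transpose_apply, Hess, of_apply, key]
  exact hs _ _

/-- On the unit ball a linear functional attains its maximum. -/
lemma exists_max_direction {n : ℕ} (L : E n × E n →L[ℝ] ℝ) :
    ∃ e : E n × E n, normSq e ≤ 1 ∧
      ∀ r : ℝ, 0 < r → ∀ d, normSq d ≤ r ^ 2 → 0 ≤ L (r • e + d) := by
  obtain ⟨e, he, hmax⟩ := (isCompact_normSq_le (n := n) 1).exists_isMaxOn ⟨0, by simp⟩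
    L.continuous.continuousOn
  refine ⟨e, he, fun r hr d hd => ?_⟩
  have h1 : normSq (-(r⁻¹ • d)) ≤ 1 := by
    rw [normSq_neg, normSq_smul, inv_pow, inv_mul_le_iff₀ (by positivity)]
    simpa using hd
  have h2 := hmax h1
  simp only [mem_ofPred_eq, map_neg, map_smul, smul_eq_mul] at h2
  rw [map_add, map_smul, smul_eq_mul]
  have h3 : r * (-(r⁻¹ * L d)) ≤ r * L e := by gcongr
  rw [mul_neg, mul_inv_cancel_left₀ hr.ne'] at h3
  linarith

/-! ### The Kolmogorov kernel and lower bounds for stationary solutions -/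

/-- The one-dimensional Kolmogorov exponent. -/
def kolm (τ a b : ℝ) : ℝ := -(b ^ 2 / τ - 3 * a * b / τ ^ 2 + 3 * a ^ 2 / τ ^ 3) - 2 * Real.log τ

/-- The logarithm of the Kolmogorov kernel (up to a constant). -/
def kolmExp {n : ℕ} (τ : ℝ) (d : E n × E n) : ℝ := ∑ i, kolm τ (d.1 i) (d.2 i)

lemma hasDerivAt_kolm_transport {τ : ℝ} (hτ : 0 < τ) (a b : ℝ) :
    HasDerivAt (fun s : ℝ => kolm (τ + s) (a + s * b) b)
      ((-(2 * b / τ - 3 * a / τ ^ 2)) ^ 2 - 2 / τ) 0 := by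
  have h1 : HasDerivAt (fun s : ℝ => τ + s) 1 0 := by simpa using (hasDerivAt_id' (0 : ℝ)).const_add τ
  have h2 : HasDerivAt (fun s : ℝ => a + s * b) b 0 := by
    simpa using ((hasDerivAt_id' (0 : ℝ)).mul_const b).const_add a
  have hτ0 : τ + 0 ≠ 0 := by simpa using hτ.ne'
  have e1 := (hasDerivAt_const (0 : ℝ) (b ^ 2)).fun_div h1 hτ0
  have e2 := (((h2.const_mul 3).mul_const b)).fun_div (h1.fun_pow 2) (pow_ne_zero 2 hτ0)
  have e3 := ((h2.fun_pow 2).const_mul 3).fun_div (h1.fun_pow 3) (pow_ne_zero 3 hτ0)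
  have e4 := (h1.log hτ0).const_mul 2
  refine ((((e1.fun_sub e2).fun_add e3).fun_neg).fun_sub e4).congr_deriv ?_
  norm_num
  field_simp
  ring

lemma hasDerivAt_kolm_snd {τ : ℝ} (a b : ℝ) :
    HasDerivAt (fun s : ℝ => kolm τ a s) (-(2 * b / τ - 3 * a / τ ^ 2)) b := by
  have h1 := hasDerivAt_id' b
  refine ((((((h1.fun_pow 2).div_const τ).fun_sub ((h1.const_mul (3 * a)).div_const (τ ^ 2))).add_const
    (3 * a ^ 2 / τ ^ 3)).fun_neg).sub_const (2 * Real.log τ)).congr_deriv ?_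
  norm_num

lemma kolm_le {τ : ℝ} (hτ : 0 < τ) (hτ1 : τ ≤ 1) (a b : ℝ) :
    kolm τ a b ≤ -((a ^ 2 + b ^ 2) / (8 * τ)) - 2 * Real.log τ := by
  unfold kolm
  have h1 : (a ^ 2 + b ^ 2) / (8 * τ) ≤ b ^ 2 / τ - 3 * a * b / τ ^ 2 + 3 * a ^ 2 / τ ^ 3 := by
    have e : b ^ 2 / τ - 3 * a * b / τ ^ 2 + 3 * a ^ 2 / τ ^ 3 - (a ^ 2 + b ^ 2) / (8 * τ)
        = (7 * b ^ 2 * τ ^ 2 - 24 * a * b * τ + 24 * a ^ 2 - a ^ 2 * τ ^ 2) / (8 * τ ^ 3) := by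
      field_simp
      ring
    have h2 : 0 ≤ 7 * b ^ 2 * τ ^ 2 - 24 * a * b * τ + 24 * a ^ 2 - a ^ 2 * τ ^ 2 := by
      have : a ^ 2 * τ ^ 2 ≤ a ^ 2 := by
        have : τ ^ 2 ≤ 1 := by nlinarith
        nlinarith [sq_nonneg a]
      nlinarith [sq_nonneg (7 * (b * τ) - 12 * a), sq_nonneg a]
    have := div_nonneg h2 (by positivity : (0 : ℝ) ≤ 8 * τ ^ 3)
    linarith
  linarith

lemma kolmExp_le {n : ℕ} {τ : ℝ} (hτ : 0 < τ) (hτ1 : τ ≤ 1) (d : E n × E n) :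
    kolmExp τ d ≤ -(normSq d / (8 * τ)) - 2 * n * Real.log τ := by
  unfold kolmExp
  refine (Finset.sum_le_sum fun i _ => kolm_le hτ hτ1 (d.1 i) (d.2 i)).trans (le_of_eq ?_)
  rw [Finset.sum_sub_distrib, Finset.sum_neg_distrib, ← Finset.sum_div, Finset.sum_add_distrib,
    ← norm_sq_eq_sum, ← norm_sq_eq_sum]
  simp [normSq]
  ring

lemma kolmExp_zero {n : ℕ} (τ : ℝ) : kolmExp τ (0 : E n × E n) = -(2 * n * Real.log τ) := by
  simp [kolmExp, kolm]
  ring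

lemma hasDerivAt_kolmExp_transport {n : ℕ} {τ : ℝ} (hτ : 0 < τ) (d : E n × E n) :
    HasDerivAt (fun s : ℝ => kolmExp (τ + s) (d + s • ((d.2, 0) : E n × E n)))
      (∑ i, ((-(2 * d.2 i / τ - 3 * d.1 i / τ ^ 2)) ^ 2 - 2 / τ)) 0 := by
  have := HasDerivAt.fun_sum (u := Finset.univ)
    (fun i _ => hasDerivAt_kolm_transport hτ (d.1 i) (d.2 i))
  simpa [kolmExp] using this

lemma snd_line {n : ℕ} (d : E n × E n) (k i : Fin n) (s : ℝ) :
    (d + s • _root_.stdBasis n (Sum.inr k)).2 i = d.2 i + s * (if i = k then 1 else 0) := by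
  simp [_root_.stdBasis]

lemma fst_line {n : ℕ} (d : E n × E n) (k : Fin n) (s : ℝ) :
    (d + s • _root_.stdBasis n (Sum.inr k)).1 = d.1 := by
  simp [_root_.stdBasis]

lemma hasDerivAt_snd_line {n : ℕ} (d : E n × E n) (k i : Fin n) (s : ℝ) :
    HasDerivAt (fun s : ℝ => (d + s • _root_.stdBasis n (Sum.inr k)).2 i)
      (if i = k then 1 else 0) s := by
  simp only [snd_line]
  simpa using ((hasDerivAt_id' s).mul_const (if i = k then (1 : ℝ) else 0)).const_add (d.2 i)

lemma hasDerivAt_kolmExp_line {n : ℕ} (τ : ℝ) (d : E n × E n) (k : Fin n) (s : ℝ) :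
    HasDerivAt (fun s : ℝ => kolmExp τ (d + s • _root_.stdBasis n (Sum.inr k)))
      (-(2 * (d + s • _root_.stdBasis n (Sum.inr k)).2 k / τ - 3 * d.1 k / τ ^ 2)) s := by
  have := HasDerivAt.fun_sum (u := Finset.univ) (fun i _ =>
    (hasDerivAt_kolm_snd (τ := τ) (d.1 i) _).comp s (hasDerivAt_snd_line d k i s))
  simp only [kolmExp, fst_line]
  refine this.congr_deriv ?_
  simp

lemma hasDerivAt_kolmExp_line_deriv {n : ℕ} (τ : ℝ) (d : E n × E n) (k : Fin n) :
    HasDerivAt (fun s : ℝ => -(2 * (d + s • _root_.stdBasis n (Sum.inr k)).2 k / τ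
      - 3 * d.1 k / τ ^ 2)) (-2 / τ) 0 := by
  refine (((((hasDerivAt_snd_line d k k 0).const_mul 2).div_const τ).sub_const
    (3 * d.1 k / τ ^ 2)).fun_neg).congr_deriv ?_
  simp
  ring

/-- The second derivative of an exponential along a line. -/
lemma hasDerivAt_exp_mul {Y Y' : ℝ → ℝ} {y'' s : ℝ} (h1 : HasDerivAt Y (Y' s) s)
    (h2 : HasDerivAt Y' y'' s) :
    HasDerivAt (fun s => Real.exp (Y s) * Y' s) (Real.exp (Y s) * (y'' + Y' s ^ 2)) s :=
  (h1.exp.fun_mul h2).congr_deriv (by ring)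

/-- A path solving `ẋ = v`, with `v` quadratic in time. -/
def cubicPath {n : ℕ} (p : E n × E n) (a b : E n) (s : ℝ) : E n × E n :=
  (p.1 + s • p.2 + (s ^ 2 / 2) • a + (s ^ 3 / 6) • b, p.2 + s • a + (s ^ 2 / 2) • b)

lemma hasDerivAt_cubicPath {n : ℕ} (p : E n × E n) (a b : E n) (s : ℝ) :
    HasDerivAt (cubicPath p a b) ((cubicPath p a b s).2, a + s • b) s := by
  have h := hasDerivAt_id' s
  have h2 : HasDerivAt (fun s : ℝ => s ^ 2 / 2) s s :=
    ((h.fun_pow 2).div_const 2).congr_deriv (by norm_num)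
  have h3 : HasDerivAt (fun s : ℝ => s ^ 3 / 6) (s ^ 2 / 2) s :=
    ((h.fun_pow 3).div_const 6).congr_deriv (by norm_num; ring)
  refine HasDerivAt.prodMk ?_ ?_
  · exact ((((h.smul_const p.2).const_add p.1).add (h2.smul_const a)).add
      (h3.smul_const b)).congr_deriv (by simp [cubicPath])
  · exact (((h.smul_const a).const_add p.2).add (h2.smul_const b)).congr_deriv (by simp)

lemma continuous_cubicPath {n : ℕ} (p : E n × E n) (a b : E n) : Continuous (cubicPath p a b) := by
  unfold cubicPath
  fun_prop

/-- `w` solves the stationary equation `⟨v, ∇ₓw⟩ = Δ_v w + |∇_v w|² + h`. -/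
def IsStationarySol {n : ℕ} (w h : E n × E n → ℝ) : Prop :=
  ∀ p, fderiv ℝ w p (p.2, 0)
    = ∑ i, (pd (pd w (Sum.inr i)) (Sum.inr i) p + pd w (Sum.inr i) p ^ 2) + h p

lemma fderiv_apply_acc {n : ℕ} (w : E n × E n → ℝ) (q : E n × E n) (v a : E n) :
    fderiv ℝ w q (v, a) = fderiv ℝ w q (v, 0) + ∑ i, a i * pd w (Sum.inr i) q := by
  have h1 : ((v, a) : E n × E n) = (v, 0) + (0, a) := by simp
  have h2 : fderiv ℝ w q (0, a) = ∑ i, a i * pd w (Sum.inr i) q := by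
    rw [fderiv_eq_sum_pd, Fintype.sum_sum_type]
    simp [coords]
  rw [h1, map_add, h2]

lemma continuousOn_kolmExp {n : ℕ} (σ : ℝ) :
    ContinuousOn (fun z : ℝ × (E n × E n) => kolmExp (z.1 + σ) z.2) {z | 0 < z.1 + σ} := by
  unfold kolmExp kolm
  refine continuousOn_finsetSum _ fun i _ => ?_
  have hne : ∀ z ∈ {z : ℝ × (E n × E n) | 0 < z.1 + σ}, z.1 + σ ≠ 0 := fun z hz => ne_of_gt hz
  refine ContinuousOn.sub (ContinuousOn.neg (ContinuousOn.add (ContinuousOn.sub ?_ ?_) ?_)) ?_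
  · exact ContinuousOn.div (by fun_prop) (by fun_prop) hne
  · exact ContinuousOn.div (by fun_prop) (by fun_prop) fun z hz => pow_ne_zero 2 (hne z hz)
  · exact ContinuousOn.div (by fun_prop) (by fun_prop) fun z hz => pow_ne_zero 3 (hne z hz)
  · exact (ContinuousOn.log (by fun_prop) hne).const_mul 2 |>.congr fun z _ => by simp

/-- Comparison of a strict supersolution with the Kolmogorov kernel. -/
lemma kolm_comparison {n : ℕ} (hn : 1 ≤ n) {S σ ϱ : ℝ} (hS : 0 < S) (hσ : 0 < σ)
    (hτ : (S + σ) * (16 * n) ≤ 1)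
    (hbase : -(ϱ ^ 2 / (8 * σ)) - 2 * n * Real.log σ
      ≤ -(1 / (8 * (S + σ))) - 2 * n * Real.log (S + σ))
    {Y DY : ℝ → E n × E n → ℝ} {Y1 Y2 : Fin n → ℝ → E n × E n → ℝ}
    (hYc : Continuous fun z : ℝ × (E n × E n) => Y z.1 z.2)
    (hD : ∀ s d, HasDerivAt (fun r : ℝ => Y (s + r) (d + r • ((d.2, 0) : E n × E n))) (DY s d) 0)
    (h1 : ∀ k s d r, HasDerivAt (fun r : ℝ => Y s (d + r • _root_.stdBasis n (Sum.inr k)))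
      (Y1 k s (d + r • _root_.stdBasis n (Sum.inr k))) r)
    (h2 : ∀ k s d, HasDerivAt (fun r : ℝ => Y1 k s (d + r • _root_.stdBasis n (Sum.inr k)))
      (Y2 k s d) 0)
    (hsup : ∀ s ∈ Icc 0 S, ∀ d, normSq d ≤ 1 → ∑ k, (Y2 k s d + Y1 k s d ^ 2) < DY s d)
    (h0 : ∀ d, normSq d ≤ ϱ ^ 2 → -(2 * n * Real.log σ) ≤ Y 0 d) :
    -Real.log 2 ≤ Y S 0 := by
  have hn' : (1 : ℝ) ≤ n := by exact_mod_cast hn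
  set τe := S + σ with hτe
  have hτe0 : 0 < τe := by positivity
  have hτe1 : τe ≤ 1 / 16 := by nlinarith
  set c := Real.exp (-(1 / (8 * τe)) - 2 * n * Real.log τe) with hc
  have hc0 : 0 < c := Real.exp_pos _
  set J : ℝ × (E n × E n) → ℝ := fun z => Real.exp (Y z.1 z.2) - Real.exp (kolmExp (z.1 + σ) z.2) + c
    with hJ
  have hcomp : IsCompact (Icc (0 : ℝ) S ×ˢ {d : E n × E n | normSq d ≤ 1}) :=
    isCompact_Icc.prod (isCompact_normSq_le 1)
  have hJc : ContinuousOn J (Icc (0 : ℝ) S ×ˢ {d : E n × E n | normSq d ≤ 1}) := by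
    refine ContinuousOn.add (ContinuousOn.sub ?_ ?_) continuousOn_const
    · exact (Real.continuous_exp.comp hYc).continuousOn
    · refine Real.continuous_exp.comp_continuousOn ((continuousOn_kolmExp σ).mono ?_)
      rintro ⟨s, d⟩ ⟨hs, _⟩
      have := hs.1
      simp only [mem_ofPred_eq]
      linarith
  obtain ⟨⟨s, d⟩, ⟨hs, hd⟩, hmin⟩ := hcomp.exists_isMinOn ⟨(0, 0), by simp [hS.le]⟩ hJc
  have hmin' : ∀ s' d', s' ∈ Icc 0 S → normSq d' ≤ 1 → J (s, d) ≤ J (s', d') :=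
    fun s' d' hs' hd' => hmin (show (s', d') ∈ _ from ⟨hs', hd'⟩)
  simp only [mem_ofPred_eq] at hd hs
  have hsσ : 0 < s + σ := by linarith [hs.1]
  have key : 0 ≤ J (s, d) := by
    by_contra! hneg
    have hlt : ¬ (kolmExp (s + σ) d ≤ -(1 / (8 * τe)) - 2 * n * Real.log τe) := by
      intro hle
      have := Real.exp_le_exp.2 hle
      have := Real.exp_pos (Y s d)
      simp only [hJ] at hneg
      linarith
    rcases hs.1.eq_or_lt with hs0 | hs0
    · -- initial time
      rcases le_total (normSq d) (ϱ ^ 2) with hdr | hdr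
      · have h3 := h0 d hdr
        have h4 : kolmExp (s + σ) d ≤ Y s d := by
          rw [← hs0, zero_add]
          refine (kolmExp_le hσ (by linarith) d).trans ?_
          have : 0 ≤ normSq d / (8 * σ) := div_nonneg (normSq_nonneg d) (by positivity)
          linarith
        have := Real.exp_le_exp.2 h4
        simp only [hJ] at hneg
        linarith
      · apply hlt
        rw [← hs0, zero_add]
        refine (kolmExp_le hσ (by linarith) d).trans (le_trans ?_ hbase)
        have : ϱ ^ 2 / (8 * σ) ≤ normSq d / (8 * σ) := by gcongr
        linarith
    rcases hd.eq_or_lt with hd1 | hd1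
    · -- lateral boundary
      apply hlt
      refine (kolmExp_le hsσ (by linarith [hs.2]) d).trans ?_
      rw [hd1]
      have hlog := Real.log_le_sub_one_of_pos (div_pos hτe0 hsσ)
      rw [Real.log_div hτe0.ne' hsσ.ne'] at hlog
      have hx : 0 ≤ τe / (s + σ) - 1 := by
        rw [sub_nonneg, le_div_iff₀ hsσ]
        linarith [hs.2]
      have h5 : 2 * (n : ℝ) ≤ 1 / (8 * τe) := by
        rw [le_div_iff₀ (by positivity)]
        linarith
      have h6 : 1 / (8 * (s + σ)) - 1 / (8 * τe) = 1 / (8 * τe) * (τe / (s + σ) - 1) := by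
        field_simp
      have h7 : 2 * n * (Real.log τe - Real.log (s + σ)) ≤ 2 * n * (τe / (s + σ) - 1) := by gcongr
      have h8 : 2 * n * (τe / (s + σ) - 1) ≤ 1 / (8 * τe) * (τe / (s + σ) - 1) := by gcongr
      linarith
    · -- interior
      have hDK := hasDerivAt_kolmExp_transport hsσ d
      have e1 : (fun r : ℝ => kolmExp (s + σ + r) (d + r • ((d.2, 0) : E n × E n)))
          = fun r => kolmExp (s + r + σ) (d + r • ((d.2, 0) : E n × E n)) := by
        funext r; congr 1; ring
      rw [e1] at hDK
      have hDJ := ((hD s d).exp.fun_sub hDK.exp).add_const c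
      have hDle := deriv_nonpos_of_left_min hDJ (by
        have hc1 : Continuous fun r : ℝ => normSq (d + r • ((d.2, 0) : E n × E n)) := by fun_prop
        have ev1 : ∀ᶠ r in nhds (0 : ℝ), normSq (d + r • ((d.2, 0) : E n × E n)) < 1 :=
          hc1.continuousAt.eventually_lt continuousAt_const (by simpa using hd1)
        have ev2 : ∀ᶠ r in nhds (0 : ℝ), 0 < s + r :=
          continuousAt_const.eventually_lt (by fun_prop) (by simpa using hs0)
        filter_upwards [nhdsWithin_le_nhds ev1, nhdsWithin_le_nhds ev2, self_mem_nhdsWithin]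
          with r hr1 hr2 hr3
        have := hmin' (s + r) (d + r • (d.2, 0)) ⟨hr2.le, by
          have : r < 0 := hr3
          linarith [hs.2]⟩ hr1.le
        simpa [hJ] using this)
      have hkk : ∀ k, 0 ≤ Real.exp (Y s d) * (Y2 k s d + Y1 k s d ^ 2)
          - Real.exp (kolmExp (s + σ) d)
            * (-2 / (s + σ) + (-(2 * d.2 k / (s + σ) - 3 * d.1 k / (s + σ) ^ 2)) ^ 2) := fun k => by
        have := second_deriv_nonneg_of_isLocalMin
          (f := fun r : ℝ => J (s, d + r • _root_.stdBasis n (Sum.inr k))) (a := 0)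
          (fun r => ((h1 k s d r).exp.fun_sub (hasDerivAt_kolmExp_line (s + σ) d k r).exp).add_const c)
          ((hasDerivAt_exp_mul (h1 k s d 0) (h2 k s d)).fun_sub
            (hasDerivAt_exp_mul (hasDerivAt_kolmExp_line (s + σ) d k 0)
              (hasDerivAt_kolmExp_line_deriv (s + σ) d k)))
          (by
            have hc1 : Continuous fun r : ℝ => normSq (d + r • _root_.stdBasis n (Sum.inr k)) := by
              fun_prop
            have ev1 : ∀ᶠ r in nhds (0 : ℝ), normSq (d + r • _root_.stdBasis n (Sum.inr k)) < 1 :=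
              hc1.continuousAt.eventually_lt continuousAt_const (by simpa using hd1)
            filter_upwards [ev1] with r hr
            simpa using hmin' s (d + r • _root_.stdBasis n (Sum.inr k)) hs hr.le)
        simpa using this
      have hsum := Finset.sum_nonneg fun k (_ : k ∈ Finset.univ) => hkk k
      rw [Finset.sum_sub_distrib, ← Finset.mul_sum, ← Finset.mul_sum] at hsum
      have e2 : ∑ k, (-2 / (s + σ) + (-(2 * d.2 k / (s + σ) - 3 * d.1 k / (s + σ) ^ 2)) ^ 2)
          = ∑ i, ((-(2 * d.2 i / (s + σ) - 3 * d.1 i / (s + σ) ^ 2)) ^ 2 - 2 / (s + σ)) :=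
        Finset.sum_congr rfl fun k _ => by ring
      rw [e2] at hsum
      have h9 := mul_lt_mul_of_pos_left (hsup s hs d hd) (Real.exp_pos (Y s d))
      simp only [add_zero, zero_smul] at hDle
      linarith
  have hend := key.trans (hmin' S 0 ⟨hS.le, le_rfl⟩ (by simp))
  simp only [hJ, ← hτe, kolmExp_zero] at hend
  have hlogneg : Real.log τe ≤ 0 := Real.log_nonpos hτe0.le (by linarith)
  have h10 : (1 : ℝ) ≤ Real.exp (-(2 * n * Real.log τe)) :=
    Real.one_le_exp (by nlinarith)
  have h11 : c = Real.exp (-(2 * n * Real.log τe)) * Real.exp (-(1 / (8 * τe))) := by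
    rw [hc, ← Real.exp_add]; congr 1; ring
  have h12 : Real.exp (-(1 / (8 * τe))) ≤ 1 / 2 := by
    have : (2 : ℝ) ≤ 1 / (8 * τe) := by
      rw [le_div_iff₀ (by positivity)]; linarith
    have h13 := Real.add_one_le_exp (1 / (8 * τe))
    rw [Real.exp_neg, ← one_div]
    gcongr
    linarith
  have h14 : 1 / 2 ≤ Real.exp (Y S 0) := by
    rw [h11] at hend
    nlinarith
  have := Real.log_le_log (by norm_num) h14
  rw [Real.log_exp] at this
  simpa using this

lemma norm_smul_le_of_le_one {F : Type*} [NormedAddCommGroup F] [NormedSpace ℝ F] {c : ℝ}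
    (h0 : 0 ≤ c) (h1 : c ≤ 1) (x : F) : ‖c • x‖ ≤ ‖x‖ := by
  rw [norm_smul, Real.norm_of_nonneg h0]
  exact mul_le_of_le_one_left (norm_nonneg x) h1

/-- Any two points are joined by a cubic path in a fixed time, with quantitative bounds. -/
lemma exists_cubicPath (n : ℕ) {k : ℝ} (hk : 1 ≤ k) : ∃ C : ℝ, 0 ≤ C ∧ ∀ p q : E n × E n,
    ∃ a b : E n, cubicPath p a b (1 / k) = q ∧ ‖b‖ ^ 2 ≤ C * (normSq p + normSq q) ∧
      ∀ s ∈ Icc (0 : ℝ) (1 / k), normSq (cubicPath p a b s) ≤ C * (normSq p + normSq q) ∧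
        ‖a + s • b‖ ^ 2 ≤ C * (normSq p + normSq q) := by
  have hk0 : 0 < k := by linarith
  refine ⟨2 * (2 + 96 * k ^ 3) ^ 2, by positivity, fun p q => ?_⟩
  set R := √(normSq p + normSq q) with hR
  have hM : 0 ≤ normSq p + normSq q := add_nonneg (normSq_nonneg p) (normSq_nonneg q)
  have hR2 : R ^ 2 = normSq p + normSq q := Real.sq_sqrt hM
  have hR0 : 0 ≤ R := Real.sqrt_nonneg _
  have hp1 : ‖p.1‖ ≤ R := Real.le_sqrt_of_sq_le (by unfold normSq; nlinarith [sq_nonneg ‖p.2‖, sq_nonneg ‖q.1‖, sq_nonneg ‖q.2‖])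
  have hp2 : ‖p.2‖ ≤ R := Real.le_sqrt_of_sq_le (by unfold normSq; nlinarith [sq_nonneg ‖p.1‖, sq_nonneg ‖q.1‖, sq_nonneg ‖q.2‖])
  have hq1 : ‖q.1‖ ≤ R := Real.le_sqrt_of_sq_le (by unfold normSq; nlinarith [sq_nonneg ‖p.2‖, sq_nonneg ‖p.1‖, sq_nonneg ‖q.2‖])
  have hq2 : ‖q.2‖ ≤ R := Real.le_sqrt_of_sq_le (by unfold normSq; nlinarith [sq_nonneg ‖p.2‖, sq_nonneg ‖q.1‖, sq_nonneg ‖p.1‖])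
  set A := k • (q.2 - p.2) with hA
  set B := k ^ 2 • (q.1 - p.1) - k • p.2 with hB
  have hkk : k ≤ k ^ 2 := by nlinarith
  have hkkk : k ^ 2 ≤ k ^ 3 := by nlinarith [sq_nonneg k]
  have hAn : ‖A‖ ≤ 2 * k * R := by
    rw [hA, norm_smul, Real.norm_of_nonneg hk0.le]
    have := norm_sub_le q.2 p.2
    nlinarith
  have hBn : ‖B‖ ≤ 3 * k ^ 2 * R := by
    have h1 := norm_sub_le (k ^ 2 • (q.1 - p.1)) (k • p.2)
    rw [norm_smul, norm_smul, Real.norm_of_nonneg hk0.le, Real.norm_of_nonneg (by positivity)] at h1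
    have h2 : k ^ 2 * ‖q.1 - p.1‖ ≤ k ^ 2 * (R + R) := by
      gcongr; exact (norm_sub_le _ _).trans (by linarith)
    have h3 : k * ‖p.2‖ ≤ k ^ 2 * R := by gcongr
    linarith
  set b := (12 * k) • ((1 / 2 : ℝ) • A - B) with hb
  set a := (6 : ℝ) • B - (2 : ℝ) • A with ha
  have hbn : ‖b‖ ≤ 48 * k ^ 3 * R := by
    rw [hb, norm_smul, Real.norm_of_nonneg (by positivity)]
    have h1 := norm_sub_le ((1 / 2 : ℝ) • A) B
    rw [norm_smul, Real.norm_of_nonneg (by positivity)] at h1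
    have h2 : k * R ≤ k ^ 2 * R := by gcongr
    calc 12 * k * ‖(1 / 2 : ℝ) • A - B‖ ≤ 12 * k * (4 * k ^ 2 * R) := by gcongr; linarith
      _ = 48 * k ^ 3 * R := by ring
  have han : ‖a‖ ≤ 48 * k ^ 3 * R := by
    have h1 := norm_sub_le ((6 : ℝ) • B) ((2 : ℝ) • A)
    rw [norm_smul, norm_smul, Real.norm_of_nonneg (by positivity), Real.norm_of_nonneg (by positivity)] at h1
    have h2 : k * R ≤ k ^ 3 * R := by gcongr; linarith
    have h3 : k ^ 2 * R ≤ k ^ 3 * R := by gcongr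
    nlinarith
  have hk1 : 1 / k ≤ 1 := by rw [div_le_one hk0]; exact hk
  refine ⟨a, b, ?_, ?_, fun s hs => ?_⟩
  · refine Prod.ext ?_ ?_
    · ext i
      simp only [cubicPath, ha, hb, hA, hB, PiLp.add_apply, PiLp.smul_apply, PiLp.sub_apply, smul_eq_mul]
      field_simp
      ring
    · ext i
      simp only [cubicPath, ha, hb, hA, hB, PiLp.add_apply, PiLp.smul_apply, PiLp.sub_apply, smul_eq_mul]
      field_simp
      ring
  · rw [← hR2]
    calc ‖b‖ ^ 2 ≤ (48 * k ^ 3 * R) ^ 2 := by gcongr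
      _ ≤ _ := by
        rw [mul_pow]
        gcongr
        nlinarith [pow_pos hk0 3]
  · have hs1 : s ≤ 1 := hs.2.trans hk1
    have hs0 : 0 ≤ s := hs.1
    have e1 : ‖s • b‖ ≤ 48 * k ^ 3 * R := (norm_smul_le_of_le_one hs0 hs1 b).trans hbn
    have hs2 : s ^ 2 / 2 ≤ 1 := by linarith [pow_le_one₀ (n := 2) hs0 hs1]
    have hs3 : s ^ 3 / 6 ≤ 1 := by linarith [pow_le_one₀ (n := 3) hs0 hs1]
    have e3 := (norm_smul_le_of_le_one (by positivity) hs2 b).trans hbn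
    have e4 := (norm_smul_le_of_le_one (by positivity) hs2 a).trans han
    have e2 := (norm_smul_le_of_le_one hs0 hs1 a).trans han
    have e5 := (norm_smul_le_of_le_one (by positivity) hs3 b).trans hbn
    have e6 := (norm_smul_le_of_le_one hs0 hs1 p.2).trans hp2
    clear_value R A B a b
    have f1 : ‖(cubicPath p a b s).1‖ ≤ (2 + 96 * k ^ 3) * R := by
      have g1 := norm_add_le (p.1 + s • p.2 + (s ^ 2 / 2) • a) ((s ^ 3 / 6) • b)
      have g2 := norm_add₃_le (a := p.1) (b := s • p.2) (c := (s ^ 2 / 2) • a)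
      show ‖p.1 + s • p.2 + (s ^ 2 / 2) • a + (s ^ 3 / 6) • b‖ ≤ _
      linarith
    have f2 : ‖(cubicPath p a b s).2‖ ≤ (2 + 96 * k ^ 3) * R := by
      refine (norm_add₃_le).trans ?_
      linarith
    have f3 : ‖a + s • b‖ ≤ (2 + 96 * k ^ 3) * R := by
      refine (norm_add_le _ _).trans ?_
      linarith
    rw [← hR2]
    constructor
    · calc normSq (cubicPath p a b s) ≤ ((2 + 96 * k ^ 3) * R) ^ 2 + ((2 + 96 * k ^ 3) * R) ^ 2 := by
            unfold normSq; gcongr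
        _ = _ := by ring
    · calc ‖a + s • b‖ ^ 2 ≤ ((2 + 96 * k ^ 3) * R) ^ 2 := by gcongr
        _ ≤ _ := by
          rw [mul_pow]
          gcongr
          nlinarith [sq_nonneg (2 + 96 * k ^ 3)]

lemma abs_sum_mul_le {n : ℕ} (x y : E n) : |∑ i, x i * y i| ≤ (‖x‖ ^ 2 + ‖y‖ ^ 2) / 2 := by
  rw [norm_sq_eq_sum, norm_sq_eq_sum, ← Finset.sum_add_distrib, Finset.sum_div]
  refine (Finset.abs_sum_le_sum_abs _ _).trans (Finset.sum_le_sum fun i _ => ?_)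
  rw [abs_mul]
  nlinarith [sq_nonneg (|x i| - |y i|), sq_abs (x i), sq_abs (y i)]

lemma snd_normSq_le {n : ℕ} (d : E n × E n) : ‖d.2‖ ^ 2 ≤ normSq d := by
  unfold normSq; linarith [sq_nonneg ‖d.1‖]

/-- Propagation of lower bounds for stationary solutions along a cubic path. -/
lemma IsStationarySol.spread_path {n : ℕ} (hn : 1 ≤ n) {w h : E n × E n → ℝ}
    (hw : ContDiff ℝ (⊤ : ℕ∞) w) (hst : IsStationarySol w h) {C₀ : ℝ} (hC₀ : 0 ≤ C₀)
    (hh : ∀ p, -(C₀ * (1 + normSq p)) ≤ h p) {S σ ϱ m Γ : ℝ} (hS : 0 < S) (hσ : 0 < σ)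
    (hϱ1 : ϱ ^ 2 ≤ 1)
    (hτ : (S + σ) * (16 * n) ≤ 1)
    (hbase : -(ϱ ^ 2 / (8 * σ)) - 2 * n * Real.log σ
      ≤ -(1 / (8 * (S + σ))) - 2 * n * Real.log (S + σ))
    {p : E n × E n} (hm : ∀ d, normSq d ≤ ϱ ^ 2 → m ≤ w (p + d)) {a b : E n} (hb : ‖b‖ ^ 2 ≤ Γ)
    (hγ : ∀ s ∈ Icc (0 : ℝ) S, normSq (cubicPath p a b s) ≤ Γ ∧ ‖a + s • b‖ ^ 2 ≤ Γ) :
    m - ‖a‖ ^ 2 / 4 - 1 / 4 + 2 * n * Real.log σ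
      - (C₀ * (3 + 2 * Γ) + Γ / 2 + 5 / 4) * S - Real.log 2 ≤ w (cubicPath p a b S) := by
  obtain ⟨e, he⟩ : ∃ e : ℝ, e = C₀ * (3 + 2 * Γ) + Γ / 2 + 5 / 4 := ⟨_, rfl⟩
  obtain ⟨m₀, hm₀⟩ : ∃ m₀ : ℝ, m₀ = m - ‖a‖ ^ 2 / 4 - 1 / 4 + 2 * n * Real.log σ := ⟨_, rfl⟩
  have key := kolm_comparison hn hS hσ hτ hbase
    (Y := fun s d => w (cubicPath p a b s + d) - m₀ + e * s + 1 / 2 * ∑ i, (a + s • b) i * d.2 i)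
    (DY := fun s d => fderiv ℝ w (cubicPath p a b s + d) ((cubicPath p a b s + d).2, a + s • b)
      + e + 1 / 2 * ∑ i, b i * d.2 i)
    (Y1 := fun k s d => pd w (Sum.inr k) (cubicPath p a b s + d) + 1 / 2 * (a + s • b) k)
    (Y2 := fun k s d => pd (pd w (Sum.inr k)) (Sum.inr k) (cubicPath p a b s + d))
    ?_ ?_ ?_ ?_ ?_ ?_
  · simp only [add_zero, Prod.snd_zero, PiLp.zero_apply, mul_zero, Finset.sum_const_zero] at key
    rw [← he, ← hm₀]
    linarith
  · have := continuous_cubicPath p a b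
    have := hw.continuous
    fun_prop
  · intro s d
    have hs : HasDerivAt (fun r : ℝ => s + r) 1 0 := by
      simpa using (hasDerivAt_id' (0 : ℝ)).const_add s
    have g1 : HasDerivAt (fun r : ℝ => cubicPath p a b (s + r))
        ((cubicPath p a b s).2, a + s • b) 0 := by
      have := (hasDerivAt_cubicPath p a b (s + 0)).scomp (0 : ℝ) hs
      rw [one_smul, add_zero] at this
      exact this
    have g2 := g1.fun_add (hasDerivAt_line d ((d.2, 0) : E n × E n) 0)
    have g3 := (hw.hasFDerivAt_top _).comp_hasDerivAt (0 : ℝ) g2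
    have g4 : HasDerivAt (fun r : ℝ => ∑ i, (a + (s + r) • b) i * (d + r • ((d.2, 0) : E n × E n)).2 i)
        (∑ i, b i * d.2 i) 0 := by
      refine HasDerivAt.fun_sum fun i _ => ?_
      simp only [Prod.snd_add, Prod.smul_snd, smul_zero, add_zero]
      refine HasDerivAt.mul_const ?_ _
      simpa using ((hs.mul_const (b i)).const_add (a i))
    refine (((g3.sub_const m₀).fun_add (hs.const_mul e)).fun_add
      (g4.const_mul (1 / 2))).congr_deriv ?_
    simp
  · intro k s d r
    have g1 := hasDerivAt_comp_line hw (cubicPath p a b s + d) (_root_.stdBasis n (Sum.inr k)) r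
    have g2 := HasDerivAt.fun_sum (u := Finset.univ) fun i _ =>
      (hasDerivAt_snd_line d k i r).const_mul ((a + s • b) i)
    have := ((g1.sub_const m₀).add_const (e * s)).fun_add (g2.const_mul (1 / 2))
    simp only [add_assoc] at this ⊢
    refine this.congr_deriv ?_
    simp [pd]
  · intro k s d
    have g1 := hasDerivAt_comp_line (contDiff_pd hw (Sum.inr k)) (cubicPath p a b s + d)
      (_root_.stdBasis n (Sum.inr k)) 0
    have := g1.add_const (1 / 2 * (a + s • b) k)
    simp only [add_assoc] at this ⊢
    refine this.congr_deriv ?_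
    simp [pd]
  · intro s hs d hd
    rw [fderiv_apply_acc, hst]
    obtain ⟨hγ1, hγ2⟩ := hγ s hs
    have i1 := hh (cubicPath p a b s + d)
    have i2 := normSq_add_le (cubicPath p a b s) d
    have i3 : C₀ * (1 + normSq (cubicPath p a b s + d)) ≤ C₀ * (3 + 2 * Γ) :=
      mul_le_mul_of_nonneg_left (by linarith) hC₀
    have i4 := (abs_le.1 (abs_sum_mul_le b d.2)).1
    have i5 := snd_normSq_le d
    have i6 : ∑ k, (pd (pd w (Sum.inr k)) (Sum.inr k) (cubicPath p a b s + d)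
        + (pd w (Sum.inr k) (cubicPath p a b s + d) + 1 / 2 * (a + s • b) k) ^ 2)
        = ∑ k, (pd (pd w (Sum.inr k)) (Sum.inr k) (cubicPath p a b s + d)
        + pd w (Sum.inr k) (cubicPath p a b s + d) ^ 2)
        + ∑ k, (a + s • b) k * pd w (Sum.inr k) (cubicPath p a b s + d) + ‖a + s • b‖ ^ 2 / 4 := by
      rw [norm_sq_eq_sum, Finset.sum_div, ← Finset.sum_add_distrib, ← Finset.sum_add_distrib]
      exact Finset.sum_congr rfl fun k _ => by ring
    rw [i6]
    linarith
  · intro d hd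
    have j1 : cubicPath p a b 0 = p := by simp [cubicPath]
    have j2 := hm d hd
    have j3 := (abs_le.1 (abs_sum_mul_le a d.2)).1
    have j4 := snd_normSq_le d
    simp only [j1, zero_smul, add_zero, mul_zero]
    linarith

lemma spread_parameters {N ϱ : ℝ} (hN : 1 ≤ N) (hϱ : 0 < ϱ) (hϱ1 : ϱ ≤ 1) :
    (1 / (32 * N) + (ϱ ^ 2 / (64 * N)) ^ 2) * (16 * N) ≤ 1 ∧
    -(ϱ ^ 2 / (8 * (ϱ ^ 2 / (64 * N)) ^ 2)) - 2 * N * Real.log ((ϱ ^ 2 / (64 * N)) ^ 2)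
      ≤ -(1 / (8 * (1 / (32 * N) + (ϱ ^ 2 / (64 * N)) ^ 2)))
        - 2 * N * Real.log (1 / (32 * N) + (ϱ ^ 2 / (64 * N)) ^ 2) ∧
    2 * N * Real.log ((ϱ ^ 2 / (64 * N)) ^ 2) = 8 * N * Real.log ϱ - 4 * N * Real.log (64 * N) := by
  obtain ⟨S, hS⟩ : ∃ S : ℝ, S = 1 / (32 * N) := ⟨_, rfl⟩
  obtain ⟨y, hy⟩ : ∃ y : ℝ, y = ϱ ^ 2 / (64 * N) := ⟨_, rfl⟩
  have hN0 : 0 < N := by linarith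
  have hS0 : 0 < S := by rw [hS]; positivity
  have hy0 : 0 < y := by rw [hy]; positivity
  have hϱ2 : ϱ ^ 2 ≤ 1 := by nlinarith
  have hyn : y * N ≤ 1 / 64 := by
    have : y * N = ϱ ^ 2 / 64 := by rw [hy]; field_simp
    rw [this]; linarith
  have hy1 : y ≤ 1 / 64 := by nlinarith
  have hlogσ : Real.log (y ^ 2) = 2 * Real.log y := by rw [Real.log_pow]; norm_num
  have hlogy : Real.log y = 2 * Real.log ϱ - Real.log (64 * N) := by
    rw [hy, Real.log_div (by positivity) (by positivity), Real.log_pow]; norm_num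
  have hSn : S * N = 1 / 32 := by rw [hS]; field_simp
  have hSle : S ≤ 1 / 32 := by nlinarith
  have hyy : y ^ 2 ≤ y := by nlinarith
  rw [← hS, ← hy]
  refine ⟨?_, ?_, ?_⟩
  · have : y ^ 2 * N ≤ y * N := by gcongr
    linarith
  · have h1 : Real.log (S + y ^ 2) ≤ 0 :=
      Real.log_nonpos (by positivity) (by linarith)
    have h2 : 1 / (8 * (S + y ^ 2)) ≤ 4 * N := by
      rw [div_le_iff₀ (by positivity)]
      have : 0 ≤ y ^ 2 * N := by positivity
      linarith
    have h3 : ϱ ^ 2 / (8 * y ^ 2) = 8 * (N * y⁻¹) := by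
      have : ϱ ^ 2 = 64 * N * y := by rw [hy]; field_simp
      rw [this]; field_simp; norm_num
    have h4 := Real.log_le_sub_one_of_pos (inv_pos.2 hy0)
    rw [Real.log_inv] at h4
    have h5 : 4 * N * -Real.log y ≤ 4 * N * (y⁻¹ - 1) := by gcongr
    have h7 : 0 ≤ N * y⁻¹ := by positivity
    have h8 : 2 * N * Real.log (S + y ^ 2) ≤ 0 := mul_nonpos_of_nonneg_of_nonpos (by positivity) h1
    rw [h3, hlogσ]
    linarith
  · rw [hlogσ, hlogy]; ring

/-- Propagation of lower bounds for stationary solutions. -/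
lemma IsStationarySol.spread {n : ℕ} (hn : 1 ≤ n) {w h : E n × E n → ℝ}
    (hw : ContDiff ℝ (⊤ : ℕ∞) w) (hst : IsStationarySol w h) {C₀ : ℝ} (hC₀ : 0 ≤ C₀)
    (hh : ∀ p, -(C₀ * (1 + normSq p)) ≤ h p) :
    ∃ C : ℝ, 0 ≤ C ∧ ∀ (p q : E n × E n) (ϱ m : ℝ), 0 < ϱ → ϱ ≤ 1 →
      (∀ d, normSq d ≤ ϱ ^ 2 → m ≤ w (p + d)) →
      m - C * (1 + normSq p + normSq q) + 8 * n * Real.log ϱ ≤ w q := by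
  have hn' : (1 : ℝ) ≤ n := by exact_mod_cast hn
  have hk : (1 : ℝ) ≤ 32 * n := by linarith
  obtain ⟨L, hL, hpath⟩ := exists_cubicPath n hk
  have hlog : 0 ≤ Real.log (64 * n) := Real.log_nonneg (by linarith)
  refine ⟨3 * C₀ + 2 * C₀ * L + L + 4 + 4 * n * Real.log (64 * n), by positivity,
    fun p q ϱ m hϱ hϱ1 hm => ?_⟩
  obtain ⟨a, b, hend, hb, hγ⟩ := hpath p q
  obtain ⟨hτ, hbase, hσ⟩ := spread_parameters hn' hϱ hϱ1
  have key := hst.spread_path hn hw hC₀ hh (by positivity) (by positivity) (by nlinarith) hτ hbase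
    hm hb hγ
  rw [hend, hσ] at key
  have ha : ‖a‖ ^ 2 ≤ L * (normSq p + normSq q) := by simpa using (hγ 0 ⟨le_rfl, by positivity⟩).2
  have hM0 : 0 ≤ normSq p + normSq q := add_nonneg (normSq_nonneg p) (normSq_nonneg q)
  rw [add_assoc 1]
  generalize normSq p + normSq q = M at *
  have hlog2 := Real.log_two_lt_d9
  have hS1 : 1 / (32 * (n : ℝ)) ≤ 1 := by rw [div_le_one (by positivity)]; exact hk
  have heS := mul_le_of_le_one_right (a := C₀ * (3 + 2 * (L * M)) + L * M / 2 + 5 / 4)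
    (by positivity) hS1
  have hnl : 0 ≤ n * Real.log (64 * n) * M := by positivity
  have hC₀M : 0 ≤ C₀ * M := by positivity
  have hLM : 0 ≤ L * M := by positivity
  have hC₀L : 0 ≤ C₀ * L := by positivity
  linarith

/-! ### Bounds on the potential -/

lemma coords_add {n : ℕ} (p q : E n × E n) : coords (p + q) = coords p + coords q := by
  ext (i | i) <;> simp [coords]

lemma normSq_add_smul {n : ℕ} (z d : E n × E n) (s : ℝ) :
    normSq (z + s • d) = normSq z + 2 * s * (coords z ⬝ᵥ coords d) + s ^ 2 * normSq d := by
  simp only [← coords_dot_self, coords_add, coords_smul, add_dotProduct, dotProduct_add,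
    smul_dotProduct, dotProduct_smul, smul_eq_mul, dotProduct_comm (coords d) (coords z)]
  ring

lemma hasDerivAt_normSq_line {n : ℕ} (z d : E n × E n) (s : ℝ) :
    HasDerivAt (fun s : ℝ => normSq (z + s • d))
      (2 * (coords z ⬝ᵥ coords d) + 2 * s * normSq d) s := by
  simp only [normSq_add_smul]
  have h := hasDerivAt_id' s
  refine ((((h.const_mul 2).mul_const (coords z ⬝ᵥ coords d)).const_add (normSq z)).fun_add
    ((h.fun_pow 2).mul_const (normSq d))).congr_deriv ?_
  norm_num

lemma hasDerivAt_normSq_line_deriv {n : ℕ} (z d : E n × E n) (s : ℝ) :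
    HasDerivAt (fun s : ℝ => 2 * (coords z ⬝ᵥ coords d) + 2 * s * normSq d) (2 * normSq d) s := by
  simpa using (((hasDerivAt_id' s).const_mul 2).mul_const (normSq d)).const_add
    (2 * (coords z ⬝ᵥ coords d))

lemma coords_dot_fst {n : ℕ} (z : E n × E n) (v : E n) :
    coords z ⬝ᵥ coords ((v, 0) : E n × E n) = ∑ i, z.1 i * v i := by
  simp [coords, dotProduct, Fintype.sum_sum_type]

lemma norm_sq_le_normSq {n : ℕ} (p : E n × E n) : ‖p‖ ^ 2 ≤ normSq p := by
  unfold normSq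
  rw [Prod.norm_def]
  rcases max_choice ‖p.1‖ ‖p.2‖ with h | h <;> rw [h] <;>
    linarith [sq_nonneg ‖p.1‖, sq_nonneg ‖p.2‖]

lemma abs_clm_le {n : ℕ} (L : E n × E n →L[ℝ] ℝ) (p : E n × E n) :
    |L p| ≤ ‖L‖ * (1 + normSq p) := by
  refine (L.le_opNorm p).trans ?_
  gcongr
  nlinarith [norm_sq_le_normSq p, sq_nonneg (‖p‖ - 1 / 2)]

lemma abs_coords_mul_le {n : ℕ} (p q : E n × E n) (i j : Fin n ⊕ Fin n) :
    |coords p i * coords q j| ≤ (normSq p + normSq q) / 2 := by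
  have h : ∀ (p : E n × E n) i, coords p i ^ 2 ≤ normSq p := fun p i => by
    rw [← coords_dot_self, dotProduct]
    simp only [← sq]
    exact Finset.single_le_sum (f := fun i => coords p i ^ 2) (fun i _ => sq_nonneg _)
      (Finset.mem_univ i)
  rw [abs_mul]
  nlinarith [h p i, h q j, sq_nonneg (|coords p i| - |coords q j|), sq_abs (coords p i),
    sq_abs (coords q j)]

lemma abs_bilin_le {n : ℕ} (M : Matrix (Fin n ⊕ Fin n) (Fin n ⊕ Fin n) ℝ) (p q : E n × E n) :
    |coords p ⬝ᵥ M *ᵥ coords q| ≤ (∑ i, ∑ j, |M i j|) * ((normSq p + normSq q) / 2) := by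
  simp only [dotProduct, mulVec, Finset.mul_sum]
  rw [Finset.sum_mul]
  refine (Finset.abs_sum_le_sum_abs _ _).trans (Finset.sum_le_sum fun i _ => ?_)
  rw [Finset.sum_mul]
  refine (Finset.abs_sum_le_sum_abs _ _).trans (Finset.sum_le_sum fun j _ => ?_)
  rw [show coords p i * (M i j * coords q j) = M i j * (coords p i * coords q j) by ring, abs_mul]
  exact mul_le_mul_of_nonneg_left (abs_coords_mul_le p q i j) (abs_nonneg _)

lemma abs_quad_le {n : ℕ} (M : Matrix (Fin n ⊕ Fin n) (Fin n ⊕ Fin n) ℝ) (p : E n × E n) :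
    |coords p ⬝ᵥ M *ᵥ coords p| ≤ (∑ i, ∑ j, |M i j|) * normSq p := by
  simpa using abs_bilin_le M p p

lemma taylor_lower_of_quad {n : ℕ} {φ : E n × E n → ℝ} (hφ : ContDiff ℝ (⊤ : ℕ∞) φ)
    {p d : E n × E n} {k : ℝ}
    (hk : ∀ s ∈ Icc (0 : ℝ) 1, -k ≤ coords d ⬝ᵥ Hess φ (p + s • d) *ᵥ coords d) :
    φ p + fderiv ℝ φ p d - k / 2 ≤ φ (p + d) := by
  have := taylor_lower_of_second_deriv (hasDerivAt_comp_line hφ p d)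
    (hasDerivAt_fderiv_line hφ p d) hk
  simpa using this

lemma contDiff_hfun {n : ℕ} {U : E n × E n → ℝ} (hU : ContDiff ℝ (⊤ : ℕ∞) U) :
    ContDiff ℝ (⊤ : ℕ∞) (hfun U) := by
  unfold hfun lapV
  have h1 := fun j => contDiff_pd hU j
  have h2 := fun i j => contDiff_pd (h1 j) i
  fun_prop

lemma pd_neg_half {n : ℕ} {U : E n × E n → ℝ} (hU : ContDiff ℝ (⊤ : ℕ∞) U) (j : Fin n ⊕ Fin n) :
    pd (fun p => -(U p) / 2) j = fun p => -(pd U j p) / 2 := by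
  funext p
  have : HasFDerivAt (fun p => -(U p) / 2) ((-(1 / 2) : ℝ) • fderiv ℝ U p) p := by
    refine ((hU.hasFDerivAt_top p).const_mul (-(1 / 2))).congr_of_eventuallyEq ?_
    exact Filter.Eventually.of_forall fun q => by simp only []; ring
  simp only [pd, this.fderiv, _root_.smul_apply, smul_eq_mul]
  ring

lemma hess_neg_half {n : ℕ} {U : E n × E n → ℝ} (hU : ContDiff ℝ (⊤ : ℕ∞) U) (p : E n × E n) :
    Hess (fun p => -(U p) / 2) p = (-(1 / 2) : ℝ) • Hess U p := by
  ext i j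
  simp only [Hess, pd_neg_half hU, pd_neg_half (contDiff_pd hU _), of_apply, Matrix.smul_apply,
    smul_eq_mul]
  ring

lemma fderiv_transport {n : ℕ} (w : E n × E n → ℝ) (q : E n × E n) (v : E n) :
    fderiv ℝ w q (v, 0) = ∑ i, v i * pd w (Sum.inl i) q := by
  rw [fderiv_eq_sum_pd, Fintype.sum_sum_type]
  simp [coords]

lemma isStationarySol_neg_half {n : ℕ} {U : E n × E n → ℝ} (hU : ContDiff ℝ (⊤ : ℕ∞) U) :
    IsStationarySol (fun p => -(U p) / 2) (hfun U) := by
  intro p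
  rw [fderiv_transport]
  simp only [pd_neg_half hU, pd_neg_half (contDiff_pd hU _), hfun, lapV, Finset.mul_sum]
  rw [← Finset.sum_add_distrib, ← Finset.sum_sub_distrib, ← Finset.sum_add_distrib]
  exact Finset.sum_congr rfl fun i _ => by ring

/-- A Hessian lower bound yields a quadratic lower bound. -/
lemma quadratic_lower_of_hess {n : ℕ} {h : E n × E n → ℝ} (hsm : ContDiff ℝ (⊤ : ℕ∞) h)
    {K : Matrix (Fin n ⊕ Fin n) (Fin n ⊕ Fin n) ℝ} (hh : ∀ p, (Hess h p + K).PosSemidef) :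
    ∃ C : ℝ, 0 ≤ C ∧ ∀ p, -(C * (1 + normSq p)) ≤ h p := by
  refine ⟨|h 0| + ‖fderiv ℝ h 0‖ + ∑ i, ∑ j, |K i j|, by positivity, fun p => ?_⟩
  have h1 := taylor_lower_of_hess hsm (p := 0) (d := p) fun s _ => hh _
  have h2 := (abs_le.1 (abs_clm_le (fderiv ℝ h 0) p)).1
  have h3 := (abs_le.1 (abs_quad_le K p)).2
  have h4 := neg_abs_le (h 0)
  rw [zero_add] at h1
  have h5 := normSq_nonneg p
  have h6 : 0 ≤ |h 0| * normSq p := by positivity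
  have h7 : 0 ≤ ∑ i, ∑ j, |K i j| := by positivity
  have h8 : 0 ≤ (∑ i, ∑ j, |K i j|) * normSq p := by positivity
  linarith

/-- Two-sided quadratic bounds for stationary solutions with a Hessian lower bound. -/
lemma IsStationarySol.abs_le {n : ℕ} (hn : 1 ≤ n) {w h : E n × E n → ℝ}
    (hw : ContDiff ℝ (⊤ : ℕ∞) w) (hst : IsStationarySol w h) {C₀ : ℝ} (hC₀ : 0 ≤ C₀)
    (hh : ∀ p, -(C₀ * (1 + normSq p)) ≤ h p) {k₀ a₁ : ℝ} (hk₀ : 0 ≤ k₀) (ha₁ : 0 ≤ a₁)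
    (hH : ∀ q d, -(k₀ * Real.exp (a₁ * normSq q) * normSq d) ≤ coords d ⬝ᵥ Hess w q *ᵥ coords d) :
    ∃ C : ℝ, 0 ≤ C ∧ ∀ p, |w p| ≤ C * (1 + normSq p) := by
  obtain ⟨C, hC, hspread⟩ := hst.spread hn hw hC₀ hh
  -- lower bound
  obtain ⟨z, -, hz⟩ := (isCompact_normSq_le (n := n) 1).exists_isMinOn ⟨0, by simp⟩
    hw.continuous.continuousOn
  have hlow : ∀ q, w z - C * (1 + normSq q) ≤ w q := fun q => by
    have := hspread 0 q 1 (w z) one_pos le_rfl fun d hd => by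
      rw [zero_add]
      exact hz (by simpa using hd)
    simpa using this
  -- upper bound
  have hup : ∀ p, w p ≤ w 0 + 1 + C * (3 + 2 * normSq p)
      + 8 * n * (k₀ + 1 + a₁ * (2 * normSq p + 2)) := fun p => by
    obtain ⟨y, hy⟩ : ∃ y : ℝ, y = k₀ + 1 + a₁ * (2 * normSq p + 2) := ⟨_, rfl⟩
    have hp0 := normSq_nonneg p
    have hm0 : 0 ≤ a₁ * (2 * normSq p + 2) := by positivity
    have hϱ := Real.exp_pos (-y)
    have hϱ1 : Real.exp (-y) ≤ 1 / 2 := by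
      rw [Real.exp_neg, ← one_div]
      gcongr
      linarith [Real.add_one_le_exp y]
    have hϱL : k₀ * Real.exp (a₁ * (2 * normSq p + 2)) * (4 * Real.exp (-y) ^ 2) / 2 ≤ 1 := by
      have e1 : Real.exp (a₁ * (2 * normSq p + 2)) * Real.exp (-y) ^ 2
          = Real.exp (-y) * (Real.exp k₀)⁻¹ * (Real.exp 1)⁻¹ := by
        rw [← Real.exp_neg, ← Real.exp_neg, ← Real.exp_add, ← Real.exp_add, sq, ← Real.exp_add,
          ← Real.exp_add]
        congr 1
        rw [hy]; ring
      have e2 : k₀ * (Real.exp k₀)⁻¹ ≤ 1 := by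
        rw [mul_inv_le_iff₀ (Real.exp_pos _)]
        linarith [Real.add_one_le_exp k₀]
      have e3 : (Real.exp 1)⁻¹ ≤ 1 := inv_le_one_of_one_le₀ (Real.one_le_exp zero_le_one)
      have e4 : 0 ≤ k₀ * (Real.exp k₀)⁻¹ := by positivity
      calc _ = 2 * (k₀ * (Real.exp k₀)⁻¹) * Real.exp (-y) * (Real.exp 1)⁻¹ := by
            rw [show k₀ * Real.exp (a₁ * (2 * normSq p + 2)) * (4 * Real.exp (-y) ^ 2) / 2
              = 2 * k₀ * (Real.exp (a₁ * (2 * normSq p + 2)) * Real.exp (-y) ^ 2) by ring, e1]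
            ring
        _ ≤ 2 * 1 * (1 / 2) * 1 := by gcongr
        _ = 1 := by norm_num
    obtain ⟨e, he, hmax⟩ := exists_max_direction (fderiv ℝ w p)
    have hϱe : normSq (Real.exp (-y) • e) ≤ Real.exp (-y) ^ 2 := by
      rw [normSq_smul]
      exact mul_le_of_le_one_right (by positivity) he
    have hsq : Real.exp (-y) ^ 2 ≤ 1 / 4 := by nlinarith
    have := hspread (p + Real.exp (-y) • e) 0 (Real.exp (-y)) (w p - 1) hϱ (by linarith)
      fun d hd => by
        have g1 := hmax _ hϱ d hd
        have g2 : normSq (Real.exp (-y) • e + d) ≤ 4 * Real.exp (-y) ^ 2 := by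
          have := normSq_add_le (Real.exp (-y) • e) d
          linarith
        have g3 := taylor_lower_of_quad hw (p := p) (d := Real.exp (-y) • e + d)
          (k := k₀ * Real.exp (a₁ * (2 * normSq p + 2)) * (4 * Real.exp (-y) ^ 2)) fun s hs => by
            refine le_trans (neg_le_neg ?_) (hH _ _)
            have g4 := normSq_add_le p (s • (Real.exp (-y) • e + d))
            have g5 : normSq (s • (Real.exp (-y) • e + d)) ≤ 1 := by
              rw [normSq_smul]
              have := normSq_nonneg (Real.exp (-y) • e + d)
              have : s ^ 2 ≤ 1 := pow_le_one₀ hs.1 hs.2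
              nlinarith
            have g6 := normSq_nonneg (Real.exp (-y) • e + d)
            gcongr
            linarith
        rw [add_assoc]
        linarith
    have h1 := normSq_add_le p (Real.exp (-y) • e)
    rw [Real.log_exp, normSq_zero, add_zero] at this
    have h2 : C * (1 + normSq (p + Real.exp (-y) • e)) ≤ C * (3 + 2 * normSq p) :=
      mul_le_mul_of_nonneg_left (by linarith) hC
    rw [← hy]
    linarith
  refine ⟨|w z| + |w 0| + 1 + 3 * C + 8 * n * (k₀ + 1 + 2 * a₁), by positivity, fun p => ?_⟩
  have h1 := hlow p
  have h2 := hup p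
  have h0 := normSq_nonneg p
  have z1 := neg_abs_le (w z)
  have z2 := le_abs_self (w 0)
  have t1 : 0 ≤ |w z| * normSq p := by positivity
  have t2 : 0 ≤ |w 0| * normSq p := by positivity
  have t3 : 0 ≤ C * normSq p := by positivity
  have t4 : 0 ≤ n * k₀ * normSq p := by positivity
  have t5 : 0 ≤ n * a₁ * normSq p := by positivity
  have t6 : 0 ≤ (n : ℝ) * normSq p := by positivity
  have t7 : 0 ≤ n * k₀ := by positivity
  have t8 : 0 ≤ n * a₁ := by positivity
  have t9 := abs_nonneg (w z)
  have t10 := abs_nonneg (w 0)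
  have t11 : (0 : ℝ) ≤ n := by positivity
  rw [_root_.abs_le]
  constructor <;> linarith

/-- A quadratic upper bound on the source term of a quadratically bounded stationary solution. -/
lemma IsStationarySol.source_le {n : ℕ} {w h : E n × E n → ℝ}
    (hw : ContDiff ℝ (⊤ : ℕ∞) w) (hst : IsStationarySol w h) (hsm : ContDiff ℝ (⊤ : ℕ∞) h)
    {K : Matrix (Fin n ⊕ Fin n) (Fin n ⊕ Fin n) ℝ} (hh : ∀ p, (Hess h p + K).PosSemidef)
    {C₁ : ℝ} (hC₁ : 0 ≤ C₁) (hwb : ∀ p, |w p| ≤ C₁ * (1 + normSq p)) :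
    ∃ C : ℝ, 0 ≤ C ∧ ∀ p, h p ≤ C * (1 + normSq p) := by
  obtain ⟨k, hk⟩ : ∃ k : ℝ, k = ∑ i, ∑ j, |K i j| := ⟨_, rfl⟩
  have hk0 : 0 ≤ k := by rw [hk]; positivity
  obtain ⟨B, hB⟩ : ∃ B : ℝ, B = 22 * C₁ + 1 := ⟨_, rfl⟩
  have hB0 : 0 < B := by rw [hB]; positivity
  refine ⟨2 * k + 11 * B + 2 * n * B, by positivity, fun p => ?_⟩
  have hp0 := normSq_nonneg p
  obtain ⟨R, hR⟩ : ∃ R : ℝ, R = √(1 + normSq p) := ⟨_, rfl⟩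
  have hR0 : 0 < R := by rw [hR]; positivity
  have hR2 : R ^ 2 = 1 + normSq p := by rw [hR]; exact Real.sq_sqrt (by positivity)
  obtain ⟨e, he, hmax⟩ := exists_max_direction (fderiv ℝ h p)
  have hRe : normSq (R • e) ≤ R ^ 2 := by
    rw [normSq_smul]; exact mul_le_of_le_one_right (by positivity) he
  have hball : ∀ z, normSq z ≤ R ^ 2 → normSq (p + R • e + z) ≤ 10 * R ^ 2 := fun z hz => by
    have h1 := normSq_add_le (p + R • e) z
    have h2 := normSq_add_le p (R • e)
    linarith
  have hwball : ∀ z, normSq z ≤ R ^ 2 → |w (p + R • e + z)| ≤ 11 * C₁ * R ^ 2 := fun z hz => by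
    refine (hwb _).trans ?_
    have := mul_le_mul_of_nonneg_left (hball z hz) hC₁
    nlinarith
  obtain ⟨z, hz, hmin⟩ := (isCompact_normSq_le (n := n) (R ^ 2)).exists_isMinOn
    ⟨0, by simpa using sq_nonneg R⟩ (f := fun z => w (p + R • e + z) + B * normSq z) (by
      have := hw.continuous
      fun_prop)
  have hz' : normSq z ≤ R ^ 2 := hz
  have hzlt : normSq z < R ^ 2 := by
    refine lt_of_le_of_ne hz' fun heq => ?_
    have h1 : w (p + R • e + z) + B * normSq z ≤ w (p + R • e + 0) + B * normSq (0 : E n × E n) :=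
      hmin (by simpa using sq_nonneg R)
    have h2 := (_root_.abs_le.1 (hwball z hz)).1
    have h3 := (_root_.abs_le.1 (hwball 0 (by simpa using sq_nonneg R))).2
    rw [heq, normSq_zero, hB] at h1
    nlinarith [sq_nonneg R, pow_pos hR0 2]
  have hloc : ∀ d : E n × E n, IsLocalMin
      (fun s : ℝ => w (p + R • e + z + s • d) + B * normSq (z + s • d)) 0 := fun d => by
    have hc1 : Continuous fun s : ℝ => normSq (z + s • d) := by fun_prop
    have ev1 : ∀ᶠ s in nhds (0 : ℝ), normSq (z + s • d) < R ^ 2 :=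
      hc1.continuousAt.eventually_lt continuousAt_const (by simpa using hzlt)
    filter_upwards [ev1] with s hs
    have : w (p + R • e + z) + B * normSq z
      ≤ w (p + R • e + (z + s • d)) + B * normSq (z + s • d) := hmin hs.le
    simpa [add_assoc] using this
  have hderiv : ∀ (d : E n × E n) (s : ℝ), HasDerivAt
      (fun s : ℝ => w (p + R • e + z + s • d) + B * normSq (z + s • d))
      (fderiv ℝ w (p + R • e + z + s • d) d + B * (2 * (coords z ⬝ᵥ coords d) + 2 * s * normSq d)) s :=
    fun d s => (hasDerivAt_comp_line hw _ d s).fun_add ((hasDerivAt_normSq_line z d s).const_mul B)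
  have hgrad : ∀ d : E n × E n,
      fderiv ℝ w (p + R • e + z) d = -(B * (2 * (coords z ⬝ᵥ coords d))) := fun d => by
    have := (hloc d).hasDerivAt_eq_zero (hderiv d 0)
    simp only [zero_smul, add_zero, mul_zero, zero_mul] at this
    linarith
  have hsecond : ∀ i : Fin n,
      -(2 * B) ≤ pd (pd w (Sum.inr i)) (Sum.inr i) (p + R • e + z) := fun i => by
    have e1 : normSq (_root_.stdBasis n (Sum.inr i)) = 1 := by
      simp [normSq, _root_.stdBasis]
    have := second_deriv_nonneg_of_isLocalMin (hderiv (_root_.stdBasis n (Sum.inr i)))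
      (((hasDerivAt_comp_line (contDiff_pd hw (Sum.inr i)) (p + R • e + z) _ 0)).fun_add
        ((hasDerivAt_normSq_line_deriv z (_root_.stdBasis n (Sum.inr i)) 0).const_mul B))
      (hloc _)
    rw [e1, zero_smul, add_zero] at this
    unfold pd at this ⊢
    linarith
  obtain ⟨q, hq⟩ : ∃ q, q = p + R • e + z := ⟨_, rfl⟩
  have heq := hst q
  have hq2 : ‖q.2‖ ^ 2 ≤ 10 * R ^ 2 := (snd_normSq_le q).trans (by rw [hq]; exact hball z hz')
  have hz1 : ‖z.1‖ ^ 2 ≤ R ^ 2 := by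
    unfold normSq at hz'; linarith [sq_nonneg ‖z.2‖]
  rw [← hq] at hgrad hsecond
  rw [hgrad, coords_dot_fst] at heq
  have hsum : -(2 * B * n) ≤ ∑ i, (pd (pd w (Sum.inr i)) (Sum.inr i) q + pd w (Sum.inr i) q ^ 2) := by
    calc -(2 * B * n) = ∑ _i : Fin n, -(2 * B) := by simp; ring
      _ ≤ _ := Finset.sum_le_sum fun i _ => by linarith [hsecond i, sq_nonneg (pd w (Sum.inr i) q)]
  have hdot := (_root_.abs_le.1 (abs_sum_mul_le z.1 q.2)).1
  have hdot' : -(B * (2 * ∑ i, z.1 i * q.2 i)) ≤ 11 * B * R ^ 2 := by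
    have := mul_le_mul_of_nonneg_left (show -(∑ i, z.1 i * q.2 i) ≤ 11 * R ^ 2 / 2 by linarith) hB0.le
    linarith
  have htaylor := taylor_lower_of_hess hsm (p := p) (d := R • e + z) fun s _ => hh _
  have hdir := hmax R hR0 z hz'
  have hquad := (_root_.abs_le.1 (abs_quad_le K (R • e + z))).2
  have hd4 : normSq (R • e + z) ≤ 4 * R ^ 2 := by
    have := normSq_add_le (R • e) z
    linarith
  rw [← hk] at hquad
  have hkd := mul_le_mul_of_nonneg_left hd4 hk0
  rw [← add_assoc, ← hq] at htaylor
  rw [← hR2]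
  have hnB : 0 ≤ n * B := by positivity
  have hnR : 2 * n * B ≤ 2 * n * B * R ^ 2 := le_mul_of_one_le_right (by positivity) (by linarith)
  nlinarith

/-! ### The maximum principle -/

/-- `w` solves `∂ₜw + ⟨v, ∇ₓw⟩ = Δ_v w + |∇_v w|² + h` at times in `I`, where `g` and `g₂` are the
first and pure second `v`-derivatives of `w`. -/
structure IsFlowSol {n : ℕ} (I : Set ℝ) (w : ℝ → E n × E n → ℝ) (g g₂ : Fin n → ℝ → E n × E n → ℝ)
    (h : E n × E n → ℝ) : Prop where
  cont : ContinuousOn (fun z : ℝ × (E n × E n) => w z.1 z.2) (I ×ˢ univ)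
  transport : ∀ t ∈ I, ∀ p, HasDerivAt (fun r : ℝ => w (t + r) (p + r • ((p.2, 0) : E n × E n)))
    (∑ k, (g₂ k t p + g k t p ^ 2) + h p) 0
  deriv_one : ∀ t ∈ I, ∀ k p r, HasDerivAt
    (fun r : ℝ => w t (p + r • _root_.stdBasis n (Sum.inr k)))
    (g k t (p + r • _root_.stdBasis n (Sum.inr k))) r
  deriv_two : ∀ t ∈ I, ∀ k p, HasDerivAt
    (fun r : ℝ => g k t (p + r • _root_.stdBasis n (Sum.inr k))) (g₂ k t p) 0

/-- `Q` is a time-dependent quadratic form evolving by the Riccati equation, with `v`-gradient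
`2 B` and source `k`. -/
structure IsRiccatiForm {n : ℕ} (I : Set ℝ) (Q : ℝ → E n × E n → ℝ)
    (B : Fin n → ℝ → E n × E n → ℝ) (k : E n × E n → ℝ) : Prop where
  cont : ContinuousOn (fun z : ℝ × (E n × E n) => Q z.1 z.2) (I ×ˢ univ)
  transport : ∀ t ∈ I, ∀ ξ, HasDerivAt (fun r : ℝ => Q (t + r) (ξ + r • ((ξ.2, 0) : E n × E n)))
    (2 * ∑ i, B i t ξ ^ 2 - k ξ) 0
  deriv_one : ∀ t ∈ I, ∀ i ξ, HasDerivAt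
    (fun r : ℝ => Q t (ξ + r • _root_.stdBasis n (Sum.inr i))) (2 * B i t ξ) 0
  apply_zero : ∀ t ∈ I, Q t 0 = 0

/-- The symmetric second difference. -/
def secDiff {n : ℕ} (φ : E n × E n → ℝ) (p ξ : E n × E n) : ℝ := φ (p + ξ) + φ (p - ξ) - 2 * φ p

/-- The perturbed second difference. -/
def perturbed {n : ℕ} (w : ℝ → E n × E n → ℝ) (Q : ℝ → E n × E n → ℝ) (A : ℝ → ℝ) (δ : ℝ) (t : ℝ)
    (p ξ : E n × E n) : ℝ :=
  secDiff (w t) p ξ - Q t ξ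
    + δ * Real.exp (A t * (1 + normSq p) - w t p) * (Q t ξ ^ 2 - Q t ξ)

lemma second_order_algebra {n : ℕ} {a b c φ₁ B : Fin n → ℝ} {l κ k : ℝ}
    (hS : ∀ i, a i + b i - 2 * c i = -(l * φ₁ i)) (hd : ∀ i, a i - b i = 2 * κ * B i)
    (hκ : 1 ≤ κ) (hk : 0 ≤ k) :
    -(∑ i, l * φ₁ i * (2 * c i)) + κ * (2 * ∑ i, B i ^ 2 - k)
      ≤ ∑ i, (a i ^ 2 + b i ^ 2 - 2 * c i ^ 2) - k := by
  have h1 : ∀ i, -(l * φ₁ i * (2 * c i)) + κ * (2 * B i ^ 2)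
      ≤ a i ^ 2 + b i ^ 2 - 2 * c i ^ 2 := fun i => by
    have e : a i ^ 2 + b i ^ 2 - 2 * c i ^ 2 = 1 / 2 * (a i + b i - 2 * c i) ^ 2
        + 2 * (a i + b i - 2 * c i) * c i + 1 / 2 * (a i - b i) ^ 2 := by ring
    rw [e, hS, hd]
    nlinarith [sq_nonneg (l * φ₁ i), mul_nonneg (mul_nonneg (by linarith : 0 ≤ κ)
      (by linarith : 0 ≤ κ - 1)) (sq_nonneg (B i))]
  have h2 := Finset.sum_le_sum fun i (_ : i ∈ Finset.univ) => h1 i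
  rw [Finset.sum_add_distrib, Finset.sum_neg_distrib, ← Finset.mul_sum, ← Finset.mul_sum] at h2
  nlinarith

lemma sum_identity {n : ℕ} (a₂ b₂ c₂ a b c v : Fin n → ℝ) (A l φ : ℝ) :
    ∑ i, (a₂ i + b₂ i - 2 * c₂ i + l * φ * (2 * A - c₂ i + (2 * A * v i - c i) ^ 2))
      + ∑ i, (a i ^ 2 + b i ^ 2 - 2 * c i ^ 2) + ∑ i, l * (φ * (2 * A * v i - c i)) * (2 * c i)
    = ∑ i, (a₂ i + a i ^ 2) + ∑ i, (b₂ i + b i ^ 2) - 2 * ∑ i, (c₂ i + c i ^ 2)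
      - l * φ * ∑ i, (c₂ i + c i ^ 2) + l * φ * (2 * n * A + 4 * A ^ 2 * ∑ i, v i ^ 2) := by
  have hn : (2 * n * A : ℝ) = ∑ _i : Fin n, 2 * A := by simp; ring
  rw [hn]
  simp only [Finset.mul_sum, ← Finset.sum_add_distrib, ← Finset.sum_sub_distrib]
  exact Finset.sum_congr rfl fun i _ => by ring

lemma secDiff_ge_of_hess {n : ℕ} {h : E n × E n → ℝ} (hsm : ContDiff ℝ (⊤ : ℕ∞) h)
    {K : Matrix (Fin n ⊕ Fin n) (Fin n ⊕ Fin n) ℝ} (hh : ∀ p, (Hess h p + K).PosSemidef)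
    (p ξ : E n × E n) : -(coords ξ ⬝ᵥ K *ᵥ coords ξ) ≤ secDiff h p ξ := by
  have h1 := taylor_lower_of_hess hsm (p := p) (d := ξ) fun s _ => hh _
  have h2 := taylor_lower_of_hess hsm (p := p) (d := -ξ) fun s _ => hh _
  rw [coords_neg, map_neg, mulVec_neg, neg_dotProduct_neg, ← sub_eq_add_neg p ξ] at h2
  unfold secDiff
  linarith

lemma ContinuousOn.perturbed {n : ℕ} {I : Set ℝ} {w : ℝ → E n × E n → ℝ} {Q : ℝ → E n × E n → ℝ}
    {A : ℝ → ℝ} (hw : ContinuousOn (fun z : ℝ × (E n × E n) => w z.1 z.2) (I ×ˢ univ))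
    (hQ : ContinuousOn (fun z : ℝ × (E n × E n) => Q z.1 z.2) (I ×ˢ univ))
    (hA : ContinuousOn A I) (δ : ℝ) :
    ContinuousOn (fun z : ℝ × (E n × E n) × (E n × E n) => perturbed w Q A δ z.1 z.2.1 z.2.2)
      (I ×ˢ univ) := by
  have hw' : ∀ f : ℝ × (E n × E n) × (E n × E n) → E n × E n, Continuous f →
      ContinuousOn (fun z : ℝ × (E n × E n) × (E n × E n) => w z.1 (f z)) (I ×ˢ univ) :=
    fun f hf => ContinuousOn.comp (s := I ×ˢ univ)
      (f := fun z : ℝ × (E n × E n) × (E n × E n) => (z.1, f z)) hw (by fun_prop)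
      fun z hz => ⟨hz.1, trivial⟩
  have hQ' : ContinuousOn (fun z : ℝ × (E n × E n) × (E n × E n) => Q z.1 z.2.2) (I ×ˢ univ) :=
    ContinuousOn.comp (s := I ×ˢ univ)
      (f := fun z : ℝ × (E n × E n) × (E n × E n) => (z.1, z.2.2)) hQ (by fun_prop)
      fun z hz => ⟨hz.1, trivial⟩
  have hA' : ContinuousOn (fun z : ℝ × (E n × E n) × (E n × E n) => A z.1) (I ×ˢ univ) :=
    hA.comp (by fun_prop) fun z hz => hz.1
  have w1 := hw' (fun z => z.2.1 + z.2.2) (by fun_prop)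
  have w2 := hw' (fun z => z.2.1 - z.2.2) (by fun_prop)
  have w3 := hw' (fun z => z.2.1) (by fun_prop)
  have hn : Continuous fun z : ℝ × (E n × E n) × (E n × E n) => 1 + normSq z.2.1 := by fun_prop
  unfold _root_.perturbed secDiff
  exact (((w1.add w2).sub (w3.const_mul 2 |>.congr fun z _ => by simp)).sub hQ').add
    ((continuousOn_const.mul (Real.continuous_exp.comp_continuousOn
      ((hA'.mul hn.continuousOn).sub w3))).mul ((hQ'.pow 2).sub hQ'))

/-- At large `p` or `ξ` the perturbed second difference is nonnegative. -/
lemma perturbed_nonneg_of_large {n : ℕ} {w : ℝ → E n × E n → ℝ} {Q : ℝ → E n × E n → ℝ}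
    {A : ℝ → ℝ} {δ c C₁ Cw t : ℝ} {p ξ : E n × E n} (hδ : 0 < δ) (hc : 0 < c)
    (hA : Cw + C₁ + 1 ≤ A t) (hwle : w t p ≤ Cw * (1 + normSq p))
    (hZ : -(Real.exp (C₁ * (1 + normSq p)) * normSq ξ) ≤ secDiff (w t) p ξ)
    (hQ : Q t ξ ≤ -(c * normSq ξ))
    (hlarge : 1 / (δ * c) ≤ normSq p ∨ 1 / (δ * c ^ 2) ≤ normSq ξ) :
    0 ≤ perturbed w Q A δ t p ξ := by
  obtain ⟨x, hx⟩ : ∃ x, x = normSq ξ := ⟨_, rfl⟩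
  obtain ⟨s, hs⟩ : ∃ s, s = 1 + normSq p := ⟨_, rfl⟩
  have hs1 : 1 ≤ s := by rw [hs]; linarith [normSq_nonneg p]
  have hx0 : 0 ≤ x := by rw [hx]; exact normSq_nonneg ξ
  have hes : 1 + s ≤ Real.exp s := by linarith [Real.add_one_le_exp s]
  have hφ : Real.exp (C₁ * s) * Real.exp s ≤ Real.exp (A t * (1 + normSq p) - w t p) := by
    rw [← Real.exp_add, Real.exp_le_exp]
    rw [← hs] at hwle ⊢
    nlinarith
  rw [← hx] at hZ hQ hlarge
  rw [← hs] at hZ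
  have hQ2 : c * x + c ^ 2 * x ^ 2 ≤ Q t ξ ^ 2 - Q t ξ := by
    have h0 : 0 ≤ c * x := by positivity
    nlinarith
  have hbig : x ≤ Real.exp s * (δ * (c * x + c ^ 2 * x ^ 2)) := by
    rcases hlarge with hl | hl
    · have h1 : 1 / (δ * c) ≤ Real.exp s := by linarith
      rw [div_le_iff₀ (by positivity)] at h1
      have h2 : 0 ≤ Real.exp s * (δ * (c ^ 2 * x ^ 2)) := by positivity
      nlinarith
    · rw [div_le_iff₀ (by positivity)] at hl
      have h1 : x ≤ δ * (c ^ 2 * x ^ 2) := by nlinarith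
      have h2 : 0 ≤ δ * (c * x) := by positivity
      have h3 : 0 ≤ δ * (c * x + c ^ 2 * x ^ 2) := by positivity
      nlinarith
  have h1 : Real.exp (C₁ * s) * x ≤ Real.exp (C₁ * s) * (Real.exp s * (δ * (c * x + c ^ 2 * x ^ 2))) := by
    gcongr
  have h2 : Real.exp (C₁ * s) * Real.exp s * (δ * (c * x + c ^ 2 * x ^ 2))
      ≤ Real.exp (A t * (1 + normSq p) - w t p) * (δ * (Q t ξ ^ 2 - Q t ξ)) := by gcongr
  unfold perturbed
  have h3 : 0 ≤ c * x := by positivity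
  linarith

/-- No negative minimum of the perturbed second difference can occur at a positive time. -/
lemma no_negative_min {n : ℕ} {I : Set ℝ} {w : ℝ → E n × E n → ℝ}
    {g g₂ : Fin n → ℝ → E n × E n → ℝ} {h : E n × E n → ℝ} (hw : IsFlowSol I w g g₂ h)
    {Q : ℝ → E n × E n → ℝ} {B : Fin n → ℝ → E n × E n → ℝ} {k : E n × E n → ℝ}
    (hQ : IsRiccatiForm I Q B k) {A : ℝ → ℝ} {A' δ t : ℝ} (hδ : 0 < δ) (ht : t ∈ I)
    (hA : HasDerivAt A A' t) {p ξ : E n × E n} (hQneg : Q t ξ < 0) (hk : 0 ≤ k ξ)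
    (hh : -k ξ ≤ secDiff h p ξ)
    (hsup : 0 < A' * (1 + normSq p) + 2 * A t * ∑ i, p.1 i * p.2 i - h p - 2 * n * A t
      - 4 * A t ^ 2 * ‖p.2‖ ^ 2)
    (htime : ∀ᶠ r in nhdsWithin 0 (Iio (0 : ℝ)), perturbed w Q A δ t p ξ
      ≤ perturbed w Q A δ (t + r) (p + r • (p.2, 0)) (ξ + r • (ξ.2, 0)))
    (hspace : ∀ᶠ z in nhds (p, ξ), perturbed w Q A δ t p ξ ≤ perturbed w Q A δ t z.1 z.2) :
    False := by
  obtain ⟨φ, hφ⟩ : ∃ φ, φ = Real.exp (A t * (1 + normSq p) - w t p) := ⟨_, rfl⟩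
  have hφ0 : 0 < φ := hφ ▸ Real.exp_pos _
  obtain ⟨q, hq⟩ : ∃ q, q = Q t ξ := ⟨_, rfl⟩
  rw [← hq] at hQneg
  -- first and second order conditions in the direction `p_v`
  have hloc1 : ∀ i, IsLocalMin
      (fun r : ℝ => perturbed w Q A δ t (p + r • _root_.stdBasis n (Sum.inr i)) ξ) 0 := fun i => by
    have hc : Filter.Tendsto (fun r : ℝ => (p + r • _root_.stdBasis n (Sum.inr i), ξ)) (nhds 0)
        (nhds (p, ξ)) := by
      have : Continuous fun r : ℝ => (p + r • _root_.stdBasis n (Sum.inr i), ξ) := by fun_prop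
      simpa using this.tendsto 0
    have := hc.eventually hspace
    simpa [IsLocalMin, IsMinFilter] using this
  have hstd : ∀ i, coords p ⬝ᵥ coords (_root_.stdBasis n (Sum.inr i)) = p.2 i := fun i => by
    simp [coords, dotProduct, Fintype.sum_sum_type, _root_.stdBasis]
  have hstd1 : ∀ i, normSq (_root_.stdBasis n (Sum.inr i)) = 1 := fun i => by
    simp [normSq, _root_.stdBasis]
  have hφ1 : ∀ i r, HasDerivAt (fun r : ℝ => Real.exp
      (A t * (1 + normSq (p + r • _root_.stdBasis n (Sum.inr i)))
        - w t (p + r • _root_.stdBasis n (Sum.inr i))))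
      (Real.exp (A t * (1 + normSq (p + r • _root_.stdBasis n (Sum.inr i)))
        - w t (p + r • _root_.stdBasis n (Sum.inr i)))
        * (A t * (2 * p.2 i + 2 * r) - g i t (p + r • _root_.stdBasis n (Sum.inr i)))) r :=
    fun i r => by
      have := ((((hasDerivAt_normSq_line p (_root_.stdBasis n (Sum.inr i)) r).const_add 1).const_mul
        (A t)).fun_sub (hw.deriv_one t ht i p r)).exp
      rwa [hstd, hstd1, mul_one] at this
  have hφ2 : ∀ i, HasDerivAt (fun r : ℝ => Real.exp
      (A t * (1 + normSq (p + r • _root_.stdBasis n (Sum.inr i)))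
        - w t (p + r • _root_.stdBasis n (Sum.inr i)))
        * (A t * (2 * p.2 i + 2 * r) - g i t (p + r • _root_.stdBasis n (Sum.inr i))))
      (φ * ((2 * A t - g₂ i t p) + (2 * A t * p.2 i - g i t p) ^ 2)) 0 := fun i => by
    have e1 := ((((hasDerivAt_id' (0 : ℝ)).const_mul 2).const_add (2 * p.2 i)).const_mul
      (A t)).fun_sub (hw.deriv_two t ht i p)
    refine ((hφ1 i 0).fun_mul e1).congr_deriv ?_
    simp only [zero_smul, add_zero, mul_zero, ← hφ]
    ring
  have hZ1 : ∀ i r, HasDerivAt (fun r : ℝ => secDiff (w t)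
      (p + r • _root_.stdBasis n (Sum.inr i)) ξ)
      (g i t (p + ξ + r • _root_.stdBasis n (Sum.inr i))
        + g i t (p - ξ + r • _root_.stdBasis n (Sum.inr i))
        - 2 * g i t (p + r • _root_.stdBasis n (Sum.inr i))) r := fun i r => by
    have := ((hw.deriv_one t ht i (p + ξ) r).fun_add (hw.deriv_one t ht i (p - ξ) r)).fun_sub
      ((hw.deriv_one t ht i p r).const_mul 2)
    simpa only [secDiff, add_right_comm p _ ξ, sub_add_eq_add_sub p ξ] using this
  have hZ2 : ∀ i, HasDerivAt (fun r : ℝ => g i t (p + ξ + r • _root_.stdBasis n (Sum.inr i))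
        + g i t (p - ξ + r • _root_.stdBasis n (Sum.inr i))
        - 2 * g i t (p + r • _root_.stdBasis n (Sum.inr i)))
      (g₂ i t (p + ξ) + g₂ i t (p - ξ) - 2 * g₂ i t p) 0 := fun i =>
    ((hw.deriv_two t ht i (p + ξ)).fun_add (hw.deriv_two t ht i (p - ξ))).fun_sub
      ((hw.deriv_two t ht i p).const_mul 2)
  have hG1 := fun i r => ((hZ1 i r).sub_const (Q t ξ)).fun_add
    (((hφ1 i r).const_mul δ).mul_const (Q t ξ ^ 2 - Q t ξ))
  have hG2 := fun i => (hZ2 i).fun_add (((hφ2 i).const_mul δ).mul_const (Q t ξ ^ 2 - Q t ξ))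
  have hfirst := fun i => (hloc1 i).hasDerivAt_eq_zero (hG1 i 0)
  have hsecond := fun i => second_deriv_nonneg_of_isLocalMin (hG1 i) (hG2 i) (hloc1 i)
  simp only [zero_smul, add_zero, mul_zero, ← hφ, ← hq] at hfirst hsecond
  -- first order condition in the direction `ξ_v`
  have hxi : ∀ i, g i t (p + ξ) - g i t (p - ξ) = 2 * (1 + δ * φ * (1 - 2 * q)) * B i t ξ :=
    fun i => by
      have hloc : IsLocalMin
          (fun r : ℝ => perturbed w Q A δ t p (ξ + r • _root_.stdBasis n (Sum.inr i))) 0 := by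
        have hc : Filter.Tendsto (fun r : ℝ => (p, ξ + r • _root_.stdBasis n (Sum.inr i))) (nhds 0)
            (nhds (p, ξ)) := by
          have : Continuous fun r : ℝ => (p, ξ + r • _root_.stdBasis n (Sum.inr i)) := by fun_prop
          simpa using this.tendsto 0
        have := hc.eventually hspace
        simpa [IsLocalMin, IsMinFilter] using this
      have hm : HasDerivAt (fun r : ℝ => w t (p - (ξ + r • _root_.stdBasis n (Sum.inr i))))
          (-(g i t (p - ξ))) 0 := by
        have h1 := (hw.deriv_one t ht i (p - ξ) (-0)).scomp (0 : ℝ) (hasDerivAt_neg' (0 : ℝ))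
        have h2 : ((fun r : ℝ => w t (p - ξ + r • _root_.stdBasis n (Sum.inr i))) ∘ Neg.neg)
            = fun r : ℝ => w t (p - (ξ + r • _root_.stdBasis n (Sum.inr i))) := by
          funext r
          rw [Function.comp_apply]
          congr 1
          rw [neg_smul]
          abel
        rw [← h2]
        simpa [Function.comp_def] using h1
      have hp' : HasDerivAt (fun r : ℝ => w t (p + (ξ + r • _root_.stdBasis n (Sum.inr i))))
          (g i t (p + ξ)) 0 := by
        simpa [add_assoc] using hw.deriv_one t ht i (p + ξ) 0
      have hq1 := hQ.deriv_one t ht i ξ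
      have hG := ((((hp'.fun_add hm).sub_const (2 * w t p))).fun_sub hq1).fun_add
        (((hq1.fun_pow 2).fun_sub hq1).const_mul
          (δ * Real.exp (A t * (1 + normSq p) - w t p)))
      have := hloc.hasDerivAt_eq_zero hG
      simp only [zero_smul, add_zero, ← hφ, ← hq] at this
      norm_num at this
      linarith
  -- time derivative along the transport direction
  have hwt : ∀ p : E n × E n, HasDerivAt
      (fun r : ℝ => w (t + r) (p + r • ((p.2, 0) : E n × E n)))
      (∑ i, (g₂ i t p + g i t p ^ 2) + h p) 0 := hw.transport t ht
  have hshift : HasDerivAt (fun r : ℝ => A (t + r)) A' 0 := by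
    have h1 : HasDerivAt (fun r : ℝ => t + r) 1 0 := by
      simpa using (hasDerivAt_id' (0 : ℝ)).const_add t
    have h2 : HasDerivAt A A' (t + 0) := by simpa using hA
    simpa [Function.comp_def] using h2.comp (0 : ℝ) h1
  have hplus := hwt (p + ξ)
  have hminus := hwt (p - ξ)
  have e1 : ∀ r : ℝ, p + ξ + r • (((p + ξ).2, 0) : E n × E n)
      = p + r • ((p.2, 0) : E n × E n) + (ξ + r • ((ξ.2, 0) : E n × E n)) := fun r =>
    Prod.ext (by simp; abel) (by simp)
  have e2 : ∀ r : ℝ, p - ξ + r • (((p - ξ).2, 0) : E n × E n)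
      = p + r • ((p.2, 0) : E n × E n) - (ξ + r • ((ξ.2, 0) : E n × E n)) := fun r =>
    Prod.ext (by simp [smul_sub]; abel) (by simp)
  simp only [e1] at hplus
  simp only [e2] at hminus
  have hq1 := hQ.transport t ht ξ
  have hexp := ((hshift.fun_mul ((hasDerivAt_normSq_line p ((p.2, 0) : E n × E n) 0).const_add 1)).fun_sub
    (hwt p)).exp
  have hGt := ((((hplus.fun_add hminus).fun_sub ((hwt p).const_mul 2))).fun_sub hq1).fun_add
    ((hexp.const_mul δ).fun_mul ((hq1.fun_pow 2).fun_sub hq1))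
  have hDle := deriv_nonpos_of_left_min hGt (by
    filter_upwards [htime] with r hr
    simpa [perturbed, secDiff] using hr)
  simp only [zero_smul, add_zero, coords_dot_fst, ← hφ, ← hq, mul_zero, zero_mul] at hDle
  norm_num at hDle
  obtain ⟨l, hl⟩ : ∃ l, l = δ * (q ^ 2 - q) := ⟨_, rfl⟩
  have hl0 : 0 < l := by rw [hl]; have : 0 < q ^ 2 - q := by nlinarith
                         positivity
  obtain ⟨κ, hκ⟩ : ∃ κ, κ = 1 + δ * φ * (1 - 2 * q) := ⟨_, rfl⟩
  have hκ1 : 1 ≤ κ := by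
    rw [hκ]
    have : 0 ≤ δ * φ * (1 - 2 * q) := mul_nonneg (by positivity) (by linarith)
    linarith
  rw [← hκ] at hxi
  have hS : ∀ i, g i t (p + ξ) + g i t (p - ξ) - 2 * g i t p
      = -(l * (φ * (2 * A t * p.2 i - g i t p))) := fun i => by
    rw [hl]
    linear_combination hfirst i
  have halg := second_order_algebra hS hxi hκ1 hk
  have hsum : 0 ≤ ∑ i, (g₂ i t (p + ξ) + g₂ i t (p - ξ) - 2 * g₂ i t p
      + l * φ * (2 * A t - g₂ i t p + (2 * A t * p.2 i - g i t p) ^ 2)) :=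
    Finset.sum_nonneg fun i _ => by
      rw [hl]
      linarith [hsecond i]
  have hv : ‖p.2‖ ^ 2 = ∑ i, p.2 i ^ 2 := norm_sq_eq_sum p.2
  rw [hv] at hsup
  have hgoal := mul_pos (mul_pos hl0 hφ0) hsup
  unfold secDiff at hh
  have hid := sum_identity (fun i => g₂ i t (p + ξ)) (fun i => g₂ i t (p - ξ)) (fun i => g₂ i t p)
    (fun i => g i t (p + ξ)) (fun i => g i t (p - ξ)) (fun i => g i t p) (fun i => p.2 i) (A t) l φ
  simp only [] at hid
  rw [hκ] at halg
  subst hl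
  linarith

lemma perturbed_zero {n : ℕ} {w : ℝ → E n × E n → ℝ} {Q : ℝ → E n × E n → ℝ} {A : ℝ → ℝ} {δ t : ℝ}
    {p : E n × E n} (hQ : Q t 0 = 0) : perturbed w Q A δ t p 0 = 0 := by
  simp [perturbed, secDiff, hQ]
  ring

/-- Nonnegativity of the perturbed second difference propagates forward in time. -/
lemma perturbed_nonneg {n : ℕ} {I : Set ℝ} {w : ℝ → E n × E n → ℝ}
    {g g₂ : Fin n → ℝ → E n × E n → ℝ} {h : E n × E n → ℝ} (hw : IsFlowSol I w g g₂ h)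
    {Q : ℝ → E n × E n → ℝ} {B : Fin n → ℝ → E n × E n → ℝ} {k : E n × E n → ℝ}
    (hQ : IsRiccatiForm I Q B k) {A A' : ℝ → ℝ} {δ c C₁ Cw t₀ t₁ : ℝ} (hδ : 0 < δ) (hc : 0 < c)
    (hI : Icc t₀ t₁ ⊆ I) (hA' : ∀ t ∈ Icc t₀ t₁, HasDerivAt A (A' t) t)
    (hA : ∀ t ∈ Icc t₀ t₁, Cw + C₁ + 1 ≤ A t)
    (hwle : ∀ t ∈ Icc t₀ t₁, ∀ p, w t p ≤ Cw * (1 + normSq p))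
    (hZ : ∀ t ∈ Icc t₀ t₁, ∀ p ξ,
      -(Real.exp (C₁ * (1 + normSq p)) * normSq ξ) ≤ secDiff (w t) p ξ)
    (hQle : ∀ t ∈ Icc t₀ t₁, ∀ ξ, Q t ξ ≤ -(c * normSq ξ)) (hk : ∀ ξ, 0 ≤ k ξ)
    (hh : ∀ p ξ, -k ξ ≤ secDiff h p ξ)
    (hsup : ∀ t ∈ Icc t₀ t₁, ∀ p : E n × E n, 0 < A' t * (1 + normSq p)
      + 2 * A t * ∑ i, p.1 i * p.2 i - h p - 2 * n * A t - 4 * A t ^ 2 * ‖p.2‖ ^ 2)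
    (h₀ : ∀ p ξ, 0 ≤ perturbed w Q A δ t₀ p ξ) :
    ∀ t ∈ Icc t₀ t₁, ∀ p ξ, 0 ≤ perturbed w Q A δ t p ξ := by
  by_contra! hcon
  obtain ⟨t, ht, p, ξ, hneg⟩ := hcon
  have hlarge : ∀ t ∈ Icc t₀ t₁, ∀ p ξ, perturbed w Q A δ t p ξ < 0 →
      normSq p ≤ 1 / (δ * c) ∧ normSq ξ ≤ 1 / (δ * c ^ 2) := fun t ht p ξ hlt => by
    by_contra hno
    refine hlt.not_ge (perturbed_nonneg_of_large hδ hc (hA t ht) (hwle t ht p) (hZ t ht p ξ)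
      (hQle t ht ξ) ?_)
    rw [not_and_or, not_le, not_le] at hno
    exact hno.imp le_of_lt le_of_lt
  have hmono : Icc t₀ t₁ ×ˢ (univ : Set (E n × E n)) ⊆ I ×ˢ univ := prod_mono_left hI
  have hcont := ContinuousOn.perturbed (hw.cont.mono hmono) (hQ.cont.mono hmono)
    (fun t ht => (hA' t ht).continuousAt.continuousWithinAt) δ
  have hcpt : IsCompact (Icc t₀ t₁ ×ˢ ({p : E n × E n | normSq p ≤ 1 / (δ * c)}
      ×ˢ {ξ : E n × E n | normSq ξ ≤ 1 / (δ * c ^ 2)})) :=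
    isCompact_Icc.prod ((isCompact_normSq_le _).prod (isCompact_normSq_le _))
  obtain ⟨⟨s, p', ξ'⟩, ⟨hs, -⟩, hmin⟩ := hcpt.exists_isMinOn
    ⟨(t, p, ξ), ht, hlarge t ht p ξ hneg⟩ (hcont.mono (prod_mono_right (subset_univ _)))
  have hneg' : perturbed w Q A δ s p' ξ' < 0 :=
    (isMinOn_iff.1 hmin (t, p, ξ) ⟨ht, hlarge t ht p ξ hneg⟩).trans_lt hneg
  have hglob : ∀ t ∈ Icc t₀ t₁, ∀ p ξ,
      perturbed w Q A δ s p' ξ' ≤ perturbed w Q A δ t p ξ := fun t ht p ξ => by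
    rcases lt_or_ge (perturbed w Q A δ t p ξ) 0 with hlt | hge
    · exact isMinOn_iff.1 hmin (t, p, ξ) ⟨ht, hlarge t ht p ξ hlt⟩
    · exact hneg'.le.trans hge
  simp only at hs
  have hs₀ : t₀ < s := lt_of_le_of_ne hs.1 fun e => (h₀ p' ξ').not_gt (e ▸ hneg')
  have hξ : 0 < normSq ξ' := normSq_pos fun e => by
    rw [e, perturbed_zero (hQ.apply_zero s (hI hs))] at hneg'
    exact lt_irrefl 0 hneg'
  refine no_negative_min hw hQ hδ (hI hs) (hA' s hs) ?_ (hk ξ') (hh p' ξ') (hsup s hs p') ?_ ?_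
  · exact (hQle s hs ξ').trans_lt (neg_neg_of_pos (mul_pos hc hξ))
  · filter_upwards [self_mem_nhdsWithin, mem_nhdsWithin_of_mem_nhds
      (Ioi_mem_nhds (show t₀ - s < 0 by linarith))] with r hr hr'
    simp only [mem_Iio, mem_Ioi] at hr hr'
    exact hglob (s + r) ⟨by linarith, by linarith [hs.2]⟩ _ _
  · exact Filter.Eventually.of_forall fun z => hglob s hs _ _

lemma supersolution_ineq {n : ℕ} {h : E n × E n → ℝ} {A₀ Ch Λ a : ℝ} (hA₀ : 1 ≤ A₀) (hCh : 0 ≤ Ch)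
    (hle : ∀ p, h p ≤ Ch * (1 + normSq p)) (hΛ : 3 + Ch + 4 * n + 16 * A₀ ≤ Λ) (ha₀ : A₀ ≤ a)
    (ha : a ≤ 2 * A₀) (p : E n × E n) :
    0 < A₀ * Λ * (1 + normSq p) + 2 * a * ∑ i, p.1 i * p.2 i - h p - 2 * n * a
      - 4 * a ^ 2 * ‖p.2‖ ^ 2 := by
  have h1 := abs_sum_mul_le p.1 p.2
  have h2 := snd_normSq_le p
  have h3 : ‖p.1‖ ^ 2 + ‖p.2‖ ^ 2 = normSq p := rfl
  obtain ⟨x, hx⟩ : ∃ x, x = ∑ i, p.1 i * p.2 i := ⟨_, rfl⟩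
  obtain ⟨s, hs⟩ : ∃ s, s = 1 + normSq p := ⟨_, rfl⟩
  obtain ⟨y, hy⟩ : ∃ y, y = ‖p.2‖ ^ 2 := ⟨_, rfl⟩
  have hy0 : 0 ≤ y := hy ▸ sq_nonneg _
  have hh := hle p
  rw [h3] at h1
  rw [← hx, show normSq p = s - 1 by linarith] at h1
  rw [← hy, show normSq p = s - 1 by linarith] at h2
  rw [← hs] at hh
  rw [← hs, ← hx, ← hy]
  have hx' := (_root_.abs_le.1 h1).1
  have hs1 : 1 ≤ s := by linarith
  have e1 : -(2 * A₀ * s) ≤ 2 * a * x := by nlinarith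
  have e2 : 2 * n * a ≤ 4 * n * A₀ * s := by
    have : (0 : ℝ) ≤ n := n.cast_nonneg
    calc 2 * n * a ≤ 2 * n * (2 * A₀) := by gcongr
      _ ≤ 4 * n * A₀ * s := by
        have : 0 ≤ 4 * n * A₀ := by positivity
        nlinarith
  have e3 : 4 * a ^ 2 * y ≤ 16 * A₀ ^ 2 * s := by
    calc 4 * a ^ 2 * y ≤ 4 * (2 * A₀) ^ 2 * s := by
          have : y ≤ s := by linarith
          gcongr
          linarith
      _ = 16 * A₀ ^ 2 * s := by ring
  have e4 : A₀ * (3 + Ch + 4 * n + 16 * A₀) * s ≤ A₀ * Λ * s := by gcongr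
  have e5 : Ch * s ≤ A₀ * Ch * s := by
    have : 0 ≤ Ch * s := by positivity
    nlinarith
  have e6 : 0 < A₀ * s := by positivity
  nlinarith

/-- Bounds under which the second difference of `w` can be compared with `Q` on `(τ, T']`. -/
structure HasWindowBounds {n : ℕ} (τ T' : ℝ) (w : ℝ → E n × E n → ℝ) (Q : ℝ → E n × E n → ℝ)
    (h k : E n × E n → ℝ) (c C₁ Cw Ch : ℝ) : Prop where
  pos_c : 0 < c
  nonneg_C₁ : 0 ≤ C₁
  nonneg_Cw : 0 ≤ Cw
  nonneg_Ch : 0 ≤ Ch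
  sol_le : ∀ t ∈ Ioc τ T', ∀ p, w t p ≤ Cw * (1 + normSq p)
  le_secDiff : ∀ t ∈ Ioc τ T', ∀ p ξ,
    -(Real.exp (C₁ * (1 + normSq p)) * normSq ξ) ≤ secDiff (w t) p ξ
  form_le : ∀ t ∈ Ioc τ T', ∀ ξ, Q t ξ ≤ -(c * normSq ξ)
  blowup : ∀ L, ∀ᶠ t in nhdsWithin τ (Ioi τ), ∀ ξ, Q t ξ ≤ -(L * normSq ξ)
  nonneg_k : ∀ ξ, 0 ≤ k ξ
  source_secDiff : ∀ p ξ, -k ξ ≤ secDiff h p ξ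
  source_le : ∀ p, h p ≤ Ch * (1 + normSq p)

section Window

variable {n : ℕ} {τ T' : ℝ} {w : ℝ → E n × E n → ℝ} {g g₂ : Fin n → ℝ → E n × E n → ℝ}
  {h k : E n × E n → ℝ} {Q : ℝ → E n × E n → ℝ} {B : Fin n → ℝ → E n × E n → ℝ} {c C₁ Cw Ch : ℝ}

lemma HasWindowBounds.perturbation_nonneg (H : HasWindowBounds τ T' w Q h k c C₁ Cw Ch) {t : ℝ}
    (ht : t ∈ Ioc τ T') (a : ℝ) (ξ : E n × E n) : 0 ≤ Real.exp a * (Q t ξ ^ 2 - Q t ξ) := by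
  have h1 := H.form_le t ht ξ
  have h2 := mul_nonneg H.pos_c.le (normSq_nonneg ξ)
  exact mul_nonneg (Real.exp_pos _).le (by nlinarith)

lemma HasWindowBounds.eventually_perturbed_nonneg
    (H : HasWindowBounds τ T' w Q h k c C₁ Cw Ch) {A : ℝ → ℝ} {δ : ℝ} (hδ : 0 < δ) (hτ : τ < T')
    (hA : ∀ t ∈ Ioc τ T', Cw + C₁ + 1 ≤ A t) :
    ∀ᶠ t in nhdsWithin τ (Ioi τ), ∀ p ξ, 0 ≤ perturbed w Q A δ t p ξ := by
  filter_upwards [H.blowup (Real.exp (C₁ * (1 + 1 / (δ * c)))), Ioc_mem_nhdsGT hτ]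
    with t hQ ht p ξ
  rcases le_or_gt (1 / (δ * c)) (normSq p) with hp | hp
  · exact perturbed_nonneg_of_large hδ H.pos_c (hA t ht) (H.sol_le t ht p) (H.le_secDiff t ht p ξ)
      (H.form_le t ht ξ) (Or.inl hp)
  · have h1 := H.perturbation_nonneg ht (A t * (1 + normSq p) - w t p) ξ
    have h2 : Real.exp (C₁ * (1 + normSq p)) * normSq ξ
        ≤ Real.exp (C₁ * (1 + 1 / (δ * c))) * normSq ξ := by
      have := H.nonneg_C₁
      have := normSq_nonneg ξ
      gcongr
    have h3 := mul_nonneg hδ.le h1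
    have h4 := H.le_secDiff t ht p ξ
    have h5 := hQ ξ
    unfold perturbed
    linarith

/-- Comparison on a short time window. -/
lemma HasWindowBounds.step (H : HasWindowBounds τ T' w Q h k c C₁ Cw Ch)
    (hw : IsFlowSol (Ioc τ T') w g g₂ h) (hQ : IsRiccatiForm (Ioc τ T') Q B k) {A₀ Λ b t : ℝ}
    (hA₀ : A₀ = Cw + C₁ + 1) (hΛ : Λ = 3 + Ch + 4 * n + 16 * A₀) (ht : t ∈ Ioc τ T')
    (htb : t ≤ b + 1 / Λ)
    (hstart : ∀ δ > 0, ∃ t₀ ∈ Ioc τ T', b ≤ t₀ ∧ t₀ ≤ t ∧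
      ∀ p ξ, 0 ≤ perturbed w Q (fun t => A₀ * (1 + Λ * (t - b))) δ t₀ p ξ)
    (p ξ : E n × E n) : Q t ξ ≤ secDiff (w t) p ξ := by
  have hA₁ : 1 ≤ A₀ := by linarith [H.nonneg_Cw, H.nonneg_C₁]
  have hΛ0 : 0 < Λ := by
    have : (0 : ℝ) ≤ n := n.cast_nonneg
    linarith [H.nonneg_Ch]
  have key : ∀ δ > 0, 0 ≤ perturbed w Q (fun t => A₀ * (1 + Λ * (t - b))) δ t p ξ := by
    intro δ hδ
    obtain ⟨t₀, ht₀, hbt, htt, h0⟩ := hstart δ hδ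
    have hsub : Icc t₀ t ⊆ Ioc τ T' := fun s hs => ⟨ht₀.1.trans_le hs.1, hs.2.trans ht.2⟩
    have hΛs : ∀ s ∈ Icc t₀ t, 0 ≤ Λ * (s - b) ∧ Λ * (s - b) ≤ 1 := fun s hs => by
      refine ⟨mul_nonneg hΛ0.le (by linarith [hs.1]), ?_⟩
      have : s - b ≤ 1 / Λ := by linarith [hs.2]
      rw [le_div_iff₀ hΛ0] at this
      linarith
    refine perturbed_nonneg hw hQ (A' := fun _ => A₀ * Λ) hδ H.pos_c hsub (fun s _ => ?_)
      (fun s hs => ?_) (fun s hs => H.sol_le s (hsub hs)) (fun s hs => H.le_secDiff s (hsub hs))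
      (fun s hs => H.form_le s (hsub hs)) H.nonneg_k H.source_secDiff
      (fun s hs q => ?_) h0 t ⟨htt, le_rfl⟩ p ξ
    · exact (((((hasDerivAt_id' s).sub_const b).const_mul Λ).const_add 1).const_mul A₀).congr_deriv
        (by ring)
    · nlinarith [hΛs s hs]
    · exact supersolution_ineq hA₁ H.nonneg_Ch H.source_le hΛ.ge (by nlinarith [hΛs s hs])
        (by nlinarith [hΛs s hs]) q
  obtain ⟨X, hX⟩ : ∃ X, X = Real.exp (A₀ * (1 + Λ * (t - b)) * (1 + normSq p) - w t p)
    * (Q t ξ ^ 2 - Q t ξ) := ⟨_, rfl⟩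
  have hX0 : 0 ≤ X := hX ▸ H.perturbation_nonneg ht _ ξ
  by_contra! hlt
  obtain ⟨e, he⟩ : ∃ e, e = Q t ξ - secDiff (w t) p ξ := ⟨_, rfl⟩
  have he0 : 0 < e := by linarith
  have h1 := key (e / (X + 1)) (by positivity)
  unfold perturbed at h1
  rw [mul_assoc, ← hX] at h1
  have h2 : e / (X + 1) * X < e := by
    rw [div_mul_eq_mul_div, div_lt_iff₀ (by positivity)]
    nlinarith
  linarith

theorem HasWindowBounds.form_le_secDiff (H : HasWindowBounds τ T' w Q h k c C₁ Cw Ch)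
    (hw : IsFlowSol (Ioc τ T') w g g₂ h) (hQ : IsRiccatiForm (Ioc τ T') Q B k) :
    ∀ t ∈ Ioc τ T', ∀ p ξ, Q t ξ ≤ secDiff (w t) p ξ := by
  obtain ⟨A₀, hA₀⟩ : ∃ A₀, A₀ = Cw + C₁ + 1 := ⟨_, rfl⟩
  obtain ⟨Λ, hΛ⟩ : ∃ Λ, Λ = 3 + Ch + 4 * n + 16 * A₀ := ⟨_, rfl⟩
  have hA₁ : 1 ≤ A₀ := by linarith [H.nonneg_Cw, H.nonneg_C₁]
  have hΛ0 : 0 < Λ := by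
    have : (0 : ℝ) ≤ n := n.cast_nonneg
    linarith [H.nonneg_Ch]
  have hmain : ∀ m : ℕ, ∀ t ∈ Ioc τ T', t ≤ τ + m / Λ → ∀ p ξ, Q t ξ ≤ secDiff (w t) p ξ := by
    intro m
    induction m with
    | zero =>
      intro t ht hle
      simp only [Nat.cast_zero, zero_div, add_zero] at hle
      exact absurd ht.1 hle.not_gt
    | succ m ih =>
      intro t ht hle p ξ
      rcases le_or_gt t (τ + m / Λ) with hlt | hgt
      · exact ih t ht hlt p ξ
      have hle' : t ≤ τ + m / Λ + 1 / Λ := by rwa [add_assoc, ← add_div, ← Nat.cast_succ]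
      have hb : τ ≤ τ + m / Λ := by linarith [show 0 ≤ (m : ℝ) / Λ by positivity]
      refine H.step hw hQ hA₀ hΛ ht hle' (fun δ hδ => ?_) p ξ
      rcases hb.eq_or_lt with heq | hlt
      · have hA : ∀ s ∈ Ioc τ T', Cw + C₁ + 1 ≤ A₀ * (1 + Λ * (s - τ)) := fun s hs => by
          have : 0 ≤ Λ * (s - τ) := mul_nonneg hΛ0.le (by linarith [hs.1])
          nlinarith
        rw [← heq]
        obtain ⟨t₀, h0, h1, h2⟩ := ((H.eventually_perturbed_nonneg hδ (ht.1.trans_le ht.2) hA).and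
          (Ioc_mem_nhdsGT ht.1)).exists
        exact ⟨t₀, ⟨h1, h2.trans ht.2⟩, h1.le, h2, h0⟩
      · have hmem : τ + m / Λ ∈ Ioc τ T' := ⟨hlt, hgt.le.trans ht.2⟩
        refine ⟨τ + m / Λ, hmem, le_rfl, hgt.le, fun p ξ => ?_⟩
        have h1 := ih _ hmem le_rfl p ξ
        have h2 := mul_nonneg hδ.le (H.perturbation_nonneg hmem
          (A₀ * (1 + Λ * (τ + m / Λ - (τ + m / Λ))) * (1 + normSq p) - w (τ + m / Λ) p) ξ)
        unfold perturbed
        linarith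
  intro t ht
  obtain ⟨m, hm⟩ := exists_nat_ge ((t - τ) * Λ)
  refine hmain m t ht ?_
  rw [← le_div_iff₀ hΛ0] at hm
  linarith

end Window

/-! ### Quadratic forms evolving by the Riccati equation -/

lemma hasDerivAt_quad {n : ℕ} {M : ℝ → Matrix (Fin n ⊕ Fin n) (Fin n ⊕ Fin n) ℝ}
    {M' : Matrix (Fin n ⊕ Fin n) (Fin n ⊕ Fin n) ℝ} {s : ℝ}
    (hM : ∀ i j, HasDerivAt (fun s => M s i j) (M' i j) s) {y : ℝ → Fin n ⊕ Fin n → ℝ}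
    {y' : Fin n ⊕ Fin n → ℝ} (hy : ∀ i, HasDerivAt (fun s => y s i) (y' i) s) :
    HasDerivAt (fun s => y s ⬝ᵥ M s *ᵥ y s)
      (y s ⬝ᵥ M' *ᵥ y s + y' ⬝ᵥ M s *ᵥ y s + y s ⬝ᵥ M s *ᵥ y') s := by
  have h : HasDerivAt (fun s => ∑ i, y s i * ∑ j, M s i j * y s j)
      (∑ i, (y' i * ∑ j, M s i j * y s j
        + y s i * ∑ j, (M' i j * y s j + M s i j * y' j))) s :=
    HasDerivAt.fun_sum fun i _ => (hy i).fun_mul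
      (HasDerivAt.fun_sum fun j _ => (hM i j).fun_mul (hy j))
  refine h.congr_deriv ?_
  simp only [dotProduct, mulVec, ← Finset.sum_add_distrib]
  refine Finset.sum_congr rfl fun i _ => ?_
  rw [Finset.sum_add_distrib]
  ring

lemma dotProduct_mulVec_symm {ι : Type*} [Fintype ι] {M : Matrix ι ι ℝ} (hM : M.IsSymm)
    (x y : ι → ℝ) : x ⬝ᵥ M *ᵥ y = y ⬝ᵥ M *ᵥ x := by
  rw [dotProduct_mulVec, ← mulVec_transpose, hM, dotProduct_comm]

lemma coords_transport {n : ℕ} (ξ : E n × E n) :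
    coords ((ξ.2, 0) : E n × E n) = -(Cmat n *ᵥ coords ξ) := by
  ext (i | i) <;>
    simp [coords, Cmat, mulVec, dotProduct, fromBlocks, Matrix.one_apply]

lemma quad_Dmat {n : ℕ} (y : Fin n ⊕ Fin n → ℝ) :
    y ⬝ᵥ Dmat n *ᵥ y = 2 * ∑ i, y (Sum.inr i) ^ 2 := by
  simp only [dotProduct, mulVec, Dmat, fromBlocks, Fintype.sum_sum_type, Finset.mul_sum]
  simp [Matrix.one_apply]
  exact Finset.sum_congr rfl fun i _ => by ring

lemma quad_riccati {n : ℕ} {N : Matrix (Fin n ⊕ Fin n) (Fin n ⊕ Fin n) ℝ} (hN : N.IsSymm)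
    (K : Matrix (Fin n ⊕ Fin n) (Fin n ⊕ Fin n) ℝ) (y : Fin n ⊕ Fin n → ℝ) :
    y ⬝ᵥ (N * Cmat n + (Cmat n)ᵀ * N + N * Dmat n * N - K) *ᵥ y
      = 2 * (y ⬝ᵥ N *ᵥ Cmat n *ᵥ y) + 2 * ∑ i, (N *ᵥ y) (Sum.inr i) ^ 2 - y ⬝ᵥ K *ᵥ y := by
  rw [sub_mulVec, add_mulVec, add_mulVec, dotProduct_sub, dotProduct_add, dotProduct_add,
    ← quad_Dmat, ← mulVec_mulVec, ← mulVec_mulVec, ← mulVec_mulVec, ← mulVec_mulVec]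
  have h1 : y ⬝ᵥ (Cmat n)ᵀ *ᵥ N *ᵥ y = y ⬝ᵥ N *ᵥ Cmat n *ᵥ y := by
    rw [dotProduct_mulVec, vecMul_transpose, dotProduct_mulVec_symm hN]
  have h2 : y ⬝ᵥ N *ᵥ Dmat n *ᵥ N *ᵥ y = (N *ᵥ y) ⬝ᵥ Dmat n *ᵥ N *ᵥ y := by
    rw [dotProduct_mulVec y, ← mulVec_transpose, hN]
  rw [h1, h2]
  ring

lemma isRiccatiForm_quad {n : ℕ} {T T' τ : ℝ} (hτ : 0 ≤ τ) (hT' : T' < T)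
    {K : Matrix (Fin n ⊕ Fin n) (Fin n ⊕ Fin n) ℝ}
    {N : ℝ → Matrix (Fin n ⊕ Fin n) (Fin n ⊕ Fin n) ℝ}
    (hNsymm : ∀ t ∈ Ioo 0 T, (N t).IsSymm)
    (hNode : ∀ t ∈ Ioo 0 T, ∀ i j, HasDerivAt (fun τ => N τ i j)
      ((N t * Cmat n + (Cmat n)ᵀ * N t + N t * Dmat n * N t - K) i j) t) :
    IsRiccatiForm (Ioc τ T') (fun t ξ => coords ξ ⬝ᵥ N (t - τ) *ᵥ coords ξ)
      (fun i t ξ => (N (t - τ) *ᵥ coords ξ) (Sum.inr i)) (fun ξ => coords ξ ⬝ᵥ K *ᵥ coords ξ) := by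
  have hmem : ∀ t ∈ Ioc τ T', t - τ ∈ Ioo 0 T := fun t ht =>
    ⟨by linarith [ht.1], by linarith [ht.2]⟩
  have hcoord : ∀ i, Continuous fun ξ : E n × E n => coords ξ i := by
    rintro (i | i) <;> simp only [coords, Sum.elim_inl, Sum.elim_inr] <;> fun_prop
  have hline : ∀ ξ η : E n × E n, ∀ i, HasDerivAt (fun r : ℝ => coords (ξ + r • η) i)
      (coords η i) 0 := fun ξ η i => by
    have := ((hasDerivAt_id' (0 : ℝ)).mul_const (coords η i)).const_add (coords ξ i)
    simpa [coords_add, coords_smul] using this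
  constructor
  · simp only [dotProduct, mulVec]
    refine continuousOn_finsetSum _ fun i _ => ((hcoord i).comp continuous_snd).continuousOn.mul
      (continuousOn_finsetSum _ fun j _ => ContinuousOn.mul ?_
        ((hcoord j).comp continuous_snd).continuousOn)
    exact ContinuousOn.comp (t := Ioo 0 T) (f := fun z : ℝ × (E n × E n) => z.1 - τ)
      (g := fun s => N s i j) (fun s hs => (hNode s hs i j).continuousAt.continuousWithinAt)
      (by fun_prop) fun z hz => hmem _ hz.1
  · intro t ht ξ
    have hN : ∀ i j, HasDerivAt (fun r => N (t + r - τ) i j) ((N (t - τ) * Cmat n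
        + (Cmat n)ᵀ * N (t - τ) + N (t - τ) * Dmat n * N (t - τ) - K) i j) 0 := fun i j => by
      have h1 : HasDerivAt (fun r : ℝ => t + r - τ) 1 0 := by
        simpa using ((hasDerivAt_id' (0 : ℝ)).const_add t).sub_const τ
      have h2 := hNode (t - τ) (hmem t ht) i j
      rw [show t - τ = t + 0 - τ by ring] at h2
      have h3 := h2.comp (0 : ℝ) h1
      rw [mul_one, add_zero] at h3
      exact h3
    refine (hasDerivAt_quad hN (hline ξ (ξ.2, 0))).congr_deriv ?_
    simp only [zero_smul, add_zero]
    rw [dotProduct_mulVec_symm (hNsymm _ (hmem t ht)) (coords ((ξ.2, 0) : E n × E n)),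
      quad_riccati (hNsymm _ (hmem t ht)), coords_transport, mulVec_neg, dotProduct_neg]
    ring
  · intro t ht i ξ
    have hN : ∀ j k, HasDerivAt (fun _ : ℝ => N (t - τ) j k)
        ((0 : Matrix (Fin n ⊕ Fin n) (Fin n ⊕ Fin n) ℝ) j k) 0 := fun j k => hasDerivAt_const _ _
    refine (hasDerivAt_quad hN (hline ξ _)).congr_deriv ?_
    simp only [zero_smul, add_zero]
    rw [dotProduct_mulVec_symm (hNsymm _ (hmem t ht)) (coords ξ) (coords _)]
    have : ∀ y : Fin n ⊕ Fin n → ℝ, coords (_root_.stdBasis n (Sum.inr i)) ⬝ᵥ y = y (Sum.inr i) :=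
      fun y => by simp [coords, dotProduct, Fintype.sum_sum_type, _root_.stdBasis]
    rw [this]
    simp
    ring
  · intro t _
    have : coords (0 : E n × E n) = 0 := by ext (i | i) <;> simp [coords]
    simp [this]

lemma quad_le_of_inv_small {n : ℕ} {M : Matrix (Fin n ⊕ Fin n) (Fin n ⊕ Fin n) ℝ}
    (hM : (-M).PosSemidef) (hsymm : M.IsSymm) (hunit : IsUnit M) {L : ℝ} (hL : 0 ≤ L)
    (hsmall : L * ∑ i, ∑ j, |M⁻¹ i j| ≤ 1) (ξ : E n × E n) :
    coords ξ ⬝ᵥ M *ᵥ coords ξ ≤ -(L * normSq ξ) := by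
  have hdet : IsUnit M.det := (Matrix.isUnit_iff_isUnit_det M).1 hunit
  have h1 := quad_nonneg hM (coords ξ + L • M⁻¹ *ᵥ coords ξ)
  have h2 : M *ᵥ M⁻¹ *ᵥ coords ξ = coords ξ := by
    rw [mulVec_mulVec, Matrix.mul_nonsing_inv _ hdet, one_mulVec]
  have h3 : (M⁻¹ *ᵥ coords ξ) ⬝ᵥ M *ᵥ coords ξ = normSq ξ := by
    rw [dotProduct_mulVec_symm hsymm, h2, coords_dot_self]
  rw [neg_mulVec, dotProduct_neg, mulVec_add, mulVec_smul, h2, add_dotProduct, dotProduct_add,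
    dotProduct_add, dotProduct_smul, smul_dotProduct, smul_dotProduct, dotProduct_smul, h3,
    coords_dot_self, dotProduct_comm (M⁻¹ *ᵥ coords ξ)] at h1
  simp only [smul_eq_mul] at h1
  have h4 := (abs_le.1 (abs_quad_le M⁻¹ ξ)).1
  obtain ⟨a, ha⟩ : ∃ a, a = ∑ i, ∑ j, |M⁻¹ i j| := ⟨_, rfl⟩
  rw [← ha] at h4 hsmall
  have h5 : L * (L * a * normSq ξ) ≤ L * (1 * normSq ξ) := by
    have := normSq_nonneg ξ
    gcongr
  have h6 := mul_le_mul_of_nonneg_left h4 (mul_nonneg hL hL)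
  linarith

lemma exists_quad_le {n : ℕ} {M : Matrix (Fin n ⊕ Fin n) (Fin n ⊕ Fin n) ℝ}
    (hM : (-M).PosSemidef) (hsymm : M.IsSymm) (hunit : IsUnit M) :
    ∃ c : ℝ, 0 < c ∧ ∀ ξ : E n × E n, coords ξ ⬝ᵥ M *ᵥ coords ξ ≤ -(c * normSq ξ) := by
  have ha : 0 ≤ ∑ i, ∑ j, |M⁻¹ i j| := by positivity
  refine ⟨1 / (1 + ∑ i, ∑ j, |M⁻¹ i j|), by positivity,
    quad_le_of_inv_small hM hsymm hunit (by positivity) ?_⟩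
  rw [div_mul_eq_mul_div, one_mul, div_le_one (by positivity)]
  linarith

lemma eventually_quad_le {n : ℕ} {T : ℝ} (hT : 0 < T)
    {N : ℝ → Matrix (Fin n ⊕ Fin n) (Fin n ⊕ Fin n) ℝ}
    (hNsymm : ∀ t ∈ Ioo 0 T, (N t).IsSymm) (hNinv : ∀ t ∈ Ioo 0 T, IsUnit (N t))
    (hNlim : ∀ i j, Filter.Tendsto (fun t => (N t)⁻¹ i j) (nhdsWithin 0 (Ioi 0)) (nhds 0))
    (hNneg : ∀ t ∈ Ioo 0 T, (-(N t)).PosSemidef) (L : ℝ) :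
    ∀ᶠ t in nhdsWithin 0 (Ioi 0), ∀ ξ : E n × E n,
      coords ξ ⬝ᵥ N t *ᵥ coords ξ ≤ -(L * normSq ξ) := by
  have hlim : Filter.Tendsto (fun t => max L 0 * ∑ i, ∑ j, |(N t)⁻¹ i j|)
      (nhdsWithin 0 (Ioi 0)) (nhds 0) := by
    have : Filter.Tendsto (fun t => max L 0 * ∑ i, ∑ j, |(N t)⁻¹ i j|)
        (nhdsWithin 0 (Ioi 0)) (nhds (max L 0 * ∑ _i : Fin n ⊕ Fin n, ∑ _j : Fin n ⊕ Fin n, |0|)) :=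
      (tendsto_finsetSum _ fun i _ => tendsto_finsetSum _ fun j _ => (hNlim i j).abs).const_mul _
    simpa using this
  filter_upwards [hlim.eventually (eventually_le_nhds zero_lt_one), Ioo_mem_nhdsGT hT]
    with t ht hmem ξ
  refine (quad_le_of_inv_small (hNneg t hmem) (hNsymm t hmem) (hNinv t hmem) (le_max_right _ _)
    ht ξ).trans ?_
  have := mul_le_mul_of_nonneg_right (le_max_left L 0) (normSq_nonneg ξ)
  linarith

lemma quad_mono {n : ℕ} {T : ℝ} {N N' : ℝ → Matrix (Fin n ⊕ Fin n) (Fin n ⊕ Fin n) ℝ}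
    (hNode : ∀ t ∈ Ioo 0 T, ∀ i j, HasDerivAt (fun τ => N τ i j) (N' t i j) t)
    (hNmono : ∀ t ∈ Ioo 0 T, (N' t).PosSemidef) (y : Fin n ⊕ Fin n → ℝ) :
    MonotoneOn (fun t => y ⬝ᵥ N t *ᵥ y) (Ioo 0 T) := by
  have hd : ∀ t ∈ Ioo 0 T, HasDerivAt (fun t => y ⬝ᵥ N t *ᵥ y) (y ⬝ᵥ N' t *ᵥ y) t := fun t ht =>
    (hasDerivAt_quad (hNode t ht) (y := fun _ => y) (y' := 0)
      fun i => hasDerivAt_const _ _).congr_deriv (by simp)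
  refine monotoneOn_of_deriv_nonneg (convex_Ioo 0 T)
    (fun t ht => (hd t ht).continuousAt.continuousWithinAt) ?_ ?_ <;> rw [interior_Ioo]
  · exact fun t ht => (hd t ht).differentiableAt.differentiableWithinAt
  · exact fun t ht => (hd t ht).deriv ▸ quad_nonneg (hNmono t ht) y

/-! ### The regularised logarithm -/

/-- The regularised logarithm `log (ρ + ε) - U / 2`. -/
def logSol {n : ℕ} (U : E n × E n → ℝ) (ρ : ℝ → E n × E n → ℝ) (ε t : ℝ) (p : E n × E n) : ℝ :=
  Real.log (ρ t p + ε) - U p / 2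

lemma contDiff_slice {n : ℕ} {T : ℝ} {ρ : ℝ → E n × E n → ℝ}
    (hρ : ContDiffOn ℝ (⊤ : ℕ∞) (fun q : ℝ × (E n × E n) => ρ q.1 q.2) (Ioo 0 T ×ˢ univ))
    {t : ℝ} (ht : t ∈ Ioo 0 T) : ContDiff ℝ (⊤ : ℕ∞) (ρ t) :=
  contDiffOn_univ.1 (hρ.comp (s := univ) (f := fun p : E n × E n => (t, p))
    (contDiff_const.prodMk contDiff_id).contDiffOn fun _ _ => ⟨ht, trivial⟩)

lemma hasDerivAt_transport {n : ℕ} {T : ℝ} {ρ : ℝ → E n × E n → ℝ}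
    (hρ : ContDiffOn ℝ (⊤ : ℕ∞) (fun q : ℝ × (E n × E n) => ρ q.1 q.2) (Ioo 0 T ×ˢ univ))
    {t : ℝ} (ht : t ∈ Ioo 0 T) (p d : E n × E n) :
    HasDerivAt (fun r : ℝ => ρ (t + r) (p + r • d))
      (deriv (fun τ => ρ τ p) t + fderiv ℝ (ρ t) p d) 0 := by
  have hnhds : Ioo 0 T ×ˢ (univ : Set (E n × E n)) ∈ nhds (t, p) :=
    (isOpen_Ioo.prod isOpen_univ).mem_nhds ⟨ht, trivial⟩
  obtain ⟨F, hF⟩ : ∃ F, F = fderiv ℝ (fun q : ℝ × (E n × E n) => ρ q.1 q.2) (t, p) := ⟨_, rfl⟩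
  have hdiff : HasFDerivAt (fun q : ℝ × (E n × E n) => ρ q.1 q.2) F (t, p) :=
    hF ▸ ((hρ.contDiffAt hnhds).differentiableAt (by simp)).hasFDerivAt
  have h1 : HasDerivAt (fun τ => ρ τ p) (F (1, 0)) t :=
    hdiff.comp_hasDerivAt (f := fun τ : ℝ => (τ, p)) t
      ((hasDerivAt_id' t).prodMk (hasDerivAt_const t p))
  have h2 : HasDerivAt (fun r : ℝ => ρ t (p + r • d)) (F (0, d)) 0 := by
    have h := hasDerivAt_line p d 0
    have h' : HasFDerivAt (fun q : ℝ × (E n × E n) => ρ q.1 q.2) F (t, p + (0 : ℝ) • d) := by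
      simpa using hdiff
    exact h'.comp_hasDerivAt (f := fun r : ℝ => (t, p + r • d)) 0
      ((hasDerivAt_const (0 : ℝ) t).prodMk h)
  have h3 : F (0, d) = fderiv ℝ (ρ t) p d := by
    have := h2.unique (hasDerivAt_comp_line (contDiff_slice hρ ht) p d 0)
    simpa using this
  have h4 : HasDerivAt (fun r : ℝ => ρ (t + r) (p + r • d)) (F (1, d)) 0 := by
    have h' : HasFDerivAt (fun q : ℝ × (E n × E n) => ρ q.1 q.2) F (t + 0, p + (0 : ℝ) • d) := by
      simpa using hdiff
    exact h'.comp_hasDerivAt (f := fun r : ℝ => (t + r, p + r • d)) 0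
      (((hasDerivAt_id' (0 : ℝ)).const_add t).prodMk (hasDerivAt_line p d 0))
  rw [h1.deriv, ← h3, ← map_add]
  simpa using h4

lemma isFlowSol_logSol {n : ℕ} {T T' τ ε : ℝ} (hτ : 0 ≤ τ) (hT' : T' < T) (hε : 0 ≤ ε)
    {U : E n × E n → ℝ} (hU : ContDiff ℝ (⊤ : ℕ∞) U) {ρ : ℝ → E n × E n → ℝ}
    (hρ : ContDiffOn ℝ (⊤ : ℕ∞) (fun q : ℝ × (E n × E n) => ρ q.1 q.2) (Ioo 0 T ×ˢ univ))
    (hpos : ∀ t ∈ Ioo 0 T, ∀ p : E n × E n, 0 < ρ t p)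
    (hpde : ∀ t ∈ Ioo 0 T, ∀ p : E n × E n,
      deriv (fun τ => ρ τ p) t =
        lapV (ρ t) p - (∑ i : Fin n, pd U (Sum.inr i) p * pd (ρ t) (Sum.inr i) p)
          - ∑ i : Fin n, p.2 i * pd (ρ t) (Sum.inl i) p) :
    IsFlowSol (Ioc τ T') (logSol U ρ ε)
      (fun k t p => pd (ρ t) (Sum.inr k) p / (ρ t p + ε) - pd U (Sum.inr k) p / 2)
      (fun k t p => (pd (pd (ρ t) (Sum.inr k)) (Sum.inr k) p * (ρ t p + ε)
        - pd (ρ t) (Sum.inr k) p * pd (ρ t) (Sum.inr k) p) / (ρ t p + ε) ^ 2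
        - pd (pd U (Sum.inr k)) (Sum.inr k) p / 2) (hfun U) := by
  have hmem : ∀ t ∈ Ioc τ T', t ∈ Ioo 0 T := fun t ht => ⟨hτ.trans_lt ht.1, ht.2.trans_lt hT'⟩
  have hne : ∀ t ∈ Ioc τ T', ∀ p, ρ t p + ε ≠ 0 := fun t ht p =>
    (add_pos_of_pos_of_nonneg (hpos t (hmem t ht) p) hε).ne'
  constructor
  · unfold logSol
    refine ContinuousOn.sub (ContinuousOn.log ((hρ.continuousOn.mono ?_).add continuousOn_const)
      fun z hz => hne _ hz.1 _) ?_
    · exact prod_mono_left hmem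
    · exact ((hU.continuous.comp continuous_snd).div_const 2).continuousOn
  · intro t ht p
    have h1 := hasDerivAt_transport hρ (hmem t ht) p (p.2, 0)
    have h2 := hasDerivAt_comp_line hU p ((p.2, 0) : E n × E n) 0
    have h3 := ((h1.add_const ε).log (by simpa using hne t ht p)).fun_sub (h2.div_const 2)
    refine h3.congr_deriv ?_
    simp only [zero_smul, add_zero]
    rw [hpde t (hmem t ht), fderiv_transport, fderiv_transport]
    unfold hfun lapV
    have hL := hne t ht p
    obtain ⟨L, hLe⟩ : ∃ L, L = ρ t p + ε := ⟨_, rfl⟩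
    rw [← hLe] at hL ⊢
    have hsum : ∀ k, (pd (pd (ρ t) (Sum.inr k)) (Sum.inr k) p * L
        - pd (ρ t) (Sum.inr k) p * pd (ρ t) (Sum.inr k) p) / L ^ 2
        - pd (pd U (Sum.inr k)) (Sum.inr k) p / 2
        + (pd (ρ t) (Sum.inr k) p / L - pd U (Sum.inr k) p / 2) ^ 2
        = pd (pd (ρ t) (Sum.inr k)) (Sum.inr k) p / L
          - pd U (Sum.inr k) p * pd (ρ t) (Sum.inr k) p / L
          - 1 / 2 * pd (pd U (Sum.inr k)) (Sum.inr k) p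
          + 1 / 4 * pd U (Sum.inr k) p ^ 2 := fun k => by
      field_simp
      ring
    simp only [hsum, Finset.sum_add_distrib, Finset.sum_sub_distrib, ← Finset.sum_div,
      ← Finset.mul_sum]
    field_simp
    ring
  · intro t ht k p r
    have h1 := hasDerivAt_comp_line (contDiff_slice hρ (hmem t ht)) p
      (_root_.stdBasis n (Sum.inr k)) r
    have h2 := hasDerivAt_comp_line hU p (_root_.stdBasis n (Sum.inr k)) r
    exact ((h1.add_const ε).log (hne t ht _)).fun_sub (h2.div_const 2)
  · intro t ht k p
    have hs := contDiff_slice hρ (hmem t ht)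
    have h1 := hasDerivAt_comp_line hs p (_root_.stdBasis n (Sum.inr k)) 0
    have h2 := hasDerivAt_comp_line (contDiff_pd hs (Sum.inr k)) p
      (_root_.stdBasis n (Sum.inr k)) 0
    have h3 := hasDerivAt_comp_line (contDiff_pd hU (Sum.inr k)) p
      (_root_.stdBasis n (Sum.inr k)) 0
    refine ((h2.fun_div (h1.add_const ε) (hne t ht _)).fun_sub (h3.div_const 2)).congr_deriv ?_
    simp only [zero_smul, add_zero]
    rfl

/-! ### Gaussian bounds for the regularised logarithm -/

/-- `f` is bounded above by `exp (C (1 + |p|²))`. -/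
def HasExpBound {n : ℕ} (f : E n × E n → ℝ) : Prop :=
  ∃ C : ℝ, 0 ≤ C ∧ ∀ p, f p ≤ Real.exp (C * (1 + normSq p))

lemma hasExpBound_exp {n : ℕ} (a b c : ℝ) :
    HasExpBound fun p : E n × E n => Real.exp (a + b * (c + normSq p)) := by
  refine ⟨|a| + |b| * (|c| + 1), by positivity, fun p => Real.exp_le_exp.2 ?_⟩
  have h0 := normSq_nonneg p
  have h1 : b * (c + normSq p) ≤ |b| * (|c| + normSq p) := by
    calc b * (c + normSq p) ≤ |b| * |c + normSq p| := by rw [← abs_mul]; exact le_abs_self _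
      _ ≤ |b| * (|c| + normSq p) := by
        gcongr
        exact (abs_add_le _ _).trans (by rw [abs_of_nonneg h0])
  have h2 : 0 ≤ |a| * normSq p := by positivity
  have h3 : 0 ≤ |b| * |c| * normSq p := by positivity
  nlinarith [le_abs_self a, abs_nonneg b]

lemma hasExpBound_const {n : ℕ} (a : ℝ) : HasExpBound fun _ : E n × E n => a := by
  obtain ⟨C, hC, h⟩ := hasExpBound_exp (n := n) a 0 0
  exact ⟨C, hC, fun p => le_trans (by simpa using by linarith [Real.add_one_le_exp a]) (h p)⟩

lemma HasExpBound.mul {n : ℕ} {f g : E n × E n → ℝ} (hf : HasExpBound f) (hg : HasExpBound g)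
    (hg0 : ∀ p, 0 ≤ g p) : HasExpBound fun p => f p * g p := by
  obtain ⟨C, hC, h⟩ := hf
  obtain ⟨C', hC', h'⟩ := hg
  refine ⟨C + C', by positivity, fun p => ?_⟩
  rw [add_mul, Real.exp_add]
  exact mul_le_mul (h p) (h' p) (hg0 p) (Real.exp_pos _).le

lemma HasExpBound.add {n : ℕ} {f g : E n × E n → ℝ} (hf : HasExpBound f) (hg : HasExpBound g) :
    HasExpBound fun p => f p + g p := by
  obtain ⟨C, hC, h⟩ := hf
  obtain ⟨C', hC', h'⟩ := hg
  refine ⟨C + C' + 1, by positivity, fun p => ?_⟩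
  have h0 := normSq_nonneg p
  have h1 : (2 : ℝ) ≤ Real.exp (1 + normSq p) := by
    linarith [Real.add_one_le_exp (1 + normSq p)]
  have h2 : Real.exp (C * (1 + normSq p)) ≤ Real.exp ((C + C') * (1 + normSq p)) := by
    gcongr
    linarith
  have h3 : Real.exp (C' * (1 + normSq p)) ≤ Real.exp ((C + C') * (1 + normSq p)) := by
    gcongr
    linarith
  have h4 := mul_le_mul_of_nonneg_left h1 (Real.exp_pos ((C + C') * (1 + normSq p))).le
  rw [← Real.exp_add, show (C + C') * (1 + normSq p) + (1 + normSq p)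
    = (C + C' + 1) * (1 + normSq p) by ring] at h4
  linarith [h p, h' p]

lemma HasExpBound.mono {n : ℕ} {f g : E n × E n → ℝ} (hg : HasExpBound g) (h : ∀ p, f p ≤ g p) :
    HasExpBound f := by
  obtain ⟨C, hC, h'⟩ := hg
  exact ⟨C, hC, fun p => (h p).trans (h' p)⟩

lemma hasExpBound_normSq {n : ℕ} (a b : ℝ) :
    HasExpBound fun p : E n × E n => a + b * normSq p := by
  refine (hasExpBound_exp a b 0).mono fun p => ?_
  linarith [Real.add_one_le_exp (a + b * (0 + normSq p))]

lemma log_secDiff_ge {a b c ε k L x : ℝ} (hε : 0 < ε) (ha : ε ≤ a) (hb : ε ≤ b) (hc : 0 < c)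
    (hk : 0 ≤ k) (hx : 0 ≤ x) (hL : 0 ≤ L) (h1 : -(k * x) ≤ a + b - 2 * c)
    (h2 : (a - b) ^ 2 ≤ 4 * (L * x)) :
    -((k * c + L) / ε ^ 2 * x) ≤ Real.log a + Real.log b - 2 * Real.log c := by
  have ha0 : 0 < a := hε.trans_le ha
  have hb0 : 0 < b := hε.trans_le hb
  have hab : ε ^ 2 ≤ a * b := by nlinarith
  have hnum : -((k * c + L) * x) ≤ a * b - c ^ 2 := by
    have h3 : -(k * x * c) ≤ ((a + b) / 2) ^ 2 - c ^ 2 := by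
      rcases le_or_gt c ((a + b) / 2) with h | h
      · have : 0 ≤ k * x * c := by positivity
        nlinarith
      · have e1 : ((a + b) / 2 - c) * (2 * c) ≤ ((a + b) / 2 - c) * ((a + b) / 2 + c) := by
          nlinarith
        nlinarith
    nlinarith
  have hlog : Real.log a + Real.log b - 2 * Real.log c = -Real.log (c ^ 2 / (a * b)) := by
    rw [Real.log_div (by positivity) (by positivity), Real.log_mul ha0.ne' hb0.ne', Real.log_pow]
    push_cast
    ring
  have h3 := Real.log_le_sub_one_of_pos (show 0 < c ^ 2 / (a * b) by positivity)
  have h4 : c ^ 2 / (a * b) - 1 ≤ (k * c + L) / ε ^ 2 * x := by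
    rw [div_mul_eq_mul_div, div_sub_one (by positivity)]
    calc (c ^ 2 - a * b) / (a * b) ≤ ((k * c + L) * x) / (a * b) := by
          gcongr
          linarith
      _ ≤ (k * c + L) * x / ε ^ 2 := by gcongr
  linarith

lemma normSq_line_le {n : ℕ} (p d : E n × E n) {s : ℝ} (hs : s ∈ Icc (0 : ℝ) 1) :
    normSq (p + s • d) ≤ 2 * normSq p + 2 * normSq d := by
  have h1 := normSq_add_le p (s • d)
  rw [normSq_smul] at h1
  have h2 : s ^ 2 * normSq d ≤ 1 * normSq d :=
    mul_le_mul_of_nonneg_right (by nlinarith [hs.1, hs.2]) (normSq_nonneg d)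
  linarith

lemma secDiff_ge_of_quad_exp {n : ℕ} {φ : E n × E n → ℝ} (hφ : ContDiff ℝ (⊤ : ℕ∞) φ) {k₀ a₁ : ℝ}
    (hk₀ : 0 ≤ k₀) (ha₁ : 0 ≤ a₁)
    (hH : ∀ q d, -(k₀ * Real.exp (a₁ * normSq q) * normSq d) ≤ coords d ⬝ᵥ Hess φ q *ᵥ coords d)
    {p ξ : E n × E n} (hξ : normSq ξ ≤ 1) :
    -(k₀ * Real.exp (2 * a₁ * (1 + normSq p)) * normSq ξ) ≤ secDiff φ p ξ := by
  have key : ∀ d : E n × E n, normSq d = normSq ξ → φ p + fderiv ℝ φ p d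
      - (k₀ * Real.exp (2 * a₁ * (1 + normSq p)) * normSq ξ) / 2 ≤ φ (p + d) := fun d hd =>
    taylor_lower_of_quad hφ fun s hs => by
      refine le_trans (neg_le_neg ?_) (hH (p + s • d) d)
      rw [hd]
      have h1 := normSq_line_le p d hs
      have h2 := normSq_nonneg ξ
      have h3 : a₁ * normSq (p + s • d) ≤ 2 * a₁ * (1 + normSq p) := by
        have := mul_le_mul_of_nonneg_left (show normSq (p + s • d) ≤ 2 * (1 + normSq p) by linarith)
          ha₁
        linarith
      gcongr
  have h1 := key ξ rfl
  have h2 := key (-ξ) (normSq_neg ξ)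
  rw [map_neg, ← sub_eq_add_neg p ξ] at h2
  unfold secDiff
  linarith

lemma abs_sub_le_of_fderiv {n : ℕ} {φ : E n × E n → ℝ} (hφ : ContDiff ℝ (⊤ : ℕ∞) φ) {C : ℝ}
    (hC : 0 ≤ C)
    (hg : ∀ p d, |fderiv ℝ φ p d| ≤ Real.exp (C * (1 + normSq p)) * Real.sqrt (normSq d))
    (p d : E n × E n) : |φ (p + d) - φ p|
      ≤ Real.exp (C * (1 + (2 * normSq p + 2 * normSq d))) * Real.sqrt (normSq d) := by
  obtain ⟨s, hs, he⟩ := exists_hasDerivAt_eq_slope (fun s : ℝ => φ (p + s • d)) _ zero_lt_one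
    (fun s _ => (hasDerivAt_comp_line hφ p d s).continuousAt.continuousWithinAt)
    (fun s _ => hasDerivAt_comp_line hφ p d s)
  simp only [one_smul, zero_smul, add_zero, sub_zero, div_one] at he
  rw [← he]
  refine (hg _ _).trans ?_
  have := normSq_line_le p d ⟨hs.1.le, hs.2.le⟩
  gcongr

lemma abs_fderiv_le_sqrt {n : ℕ} (φ : E n × E n → ℝ) (p d : E n × E n) :
    |fderiv ℝ φ p d| ≤ Real.sqrt (gradNormSq φ p) * Real.sqrt (normSq d) := by
  have h0 : 0 ≤ gradNormSq φ p := Finset.sum_nonneg fun _ _ => sq_nonneg _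
  rw [← Real.sqrt_mul h0]
  refine Real.abs_le_sqrt ?_
  rw [fderiv_eq_sum_pd, ← coords_dot_self, mul_comm]
  refine (Finset.sum_mul_sq_le_sq_mul_sq _ _ _).trans (le_of_eq ?_)
  simp [gradNormSq, dotProduct, sq]

section Bounds

variable {n : ℕ} {T τ T' : ℝ} {U : E n × E n → ℝ} {ρ : ℝ → E n × E n → ℝ}

lemma exists_fderiv_le {a₀ C_U : ℝ} (ha₀ : 0 < a₀)
    (hUb : ∀ p, |-(U p) / 2| ≤ C_U * (1 + normSq p))
    (hgrow1 : ∀ t ∈ Ioo 0 T, ∀ p : E n × E n,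
      Real.sqrt (gradNormSq (ρ t) p) ≤ a₀ * Real.exp (-U p / 2) * (‖p.1‖ + ‖p.2‖)) :
    ∃ C : ℝ, 0 ≤ C ∧ ∀ t ∈ Ioo 0 T, ∀ p d : E n × E n,
      |fderiv ℝ (ρ t) p d| ≤ Real.exp (C * (1 + normSq p)) * Real.sqrt (normSq d) := by
  obtain ⟨C, hC, h⟩ := ((hasExpBound_const (n := n) a₀).mul (hasExpBound_exp 0 C_U 1)
    fun p => (Real.exp_pos _).le).mul (hasExpBound_normSq 1 1) fun p => by
      linarith [normSq_nonneg p]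
  refine ⟨C, hC, fun t ht p d => (abs_fderiv_le_sqrt _ _ _).trans
    (mul_le_mul_of_nonneg_right (((hgrow1 t ht p).trans ?_).trans (h p)) (Real.sqrt_nonneg _))⟩
  have h1 : ‖p.1‖ + ‖p.2‖ ≤ 1 + 1 * normSq p := by
    unfold normSq
    nlinarith [sq_nonneg (‖p.1‖ - 1 / 2), sq_nonneg (‖p.2‖ - 1 / 2)]
  have h2 := (_root_.abs_le.1 (hUb p)).2
  simp only [zero_add]
  gcongr

lemma exists_sol_le (hτ : 0 < τ) (hT' : T' < T)
    (hρ : ContDiffOn ℝ (⊤ : ℕ∞) (fun q : ℝ × (E n × E n) => ρ q.1 q.2) (Ioo 0 T ×ˢ univ))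
    {Cg : ℝ} (hCg : 0 ≤ Cg) (hg : ∀ t ∈ Ioo 0 T, ∀ p d : E n × E n,
      |fderiv ℝ (ρ t) p d| ≤ Real.exp (Cg * (1 + normSq p)) * Real.sqrt (normSq d)) :
    ∃ C : ℝ, 0 ≤ C ∧ ∀ t ∈ Icc τ T', ∀ p, ρ t p ≤ Real.exp (C * (1 + normSq p)) := by
  have hmem : ∀ t ∈ Icc τ T', t ∈ Ioo 0 T := fun t ht => ⟨hτ.trans_le ht.1, ht.2.trans_lt hT'⟩
  have hcont : ContinuousOn (fun t => ρ t 0) (Icc τ T') :=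
    hρ.continuousOn.comp (f := fun t : ℝ => (t, (0 : E n × E n))) (by fun_prop)
      fun t ht => ⟨hmem t ht, trivial⟩
  obtain ⟨M, hM⟩ := isCompact_Icc.bddAbove_image hcont
  obtain ⟨C, hC, h⟩ := (hasExpBound_const (n := n) M).add
    ((hasExpBound_exp (n := n) 0 (2 * Cg) 1).mul (hasExpBound_normSq 1 1) fun p => by
      linarith [normSq_nonneg p])
  refine ⟨C, hC, fun t ht p => le_trans ?_ (h p)⟩
  have h1 := (_root_.abs_le.1 (abs_sub_le_of_fderiv (contDiff_slice hρ (hmem t ht)) hCg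
    (hg t (hmem t ht)) 0 p)).2
  have h2 : ρ t 0 ≤ M := hM ⟨t, ht, rfl⟩
  rw [zero_add, normSq_zero] at h1
  have h3 : Real.sqrt (normSq p) ≤ 1 + 1 * normSq p := by
    rw [Real.sqrt_le_left (by linarith [normSq_nonneg p])]
    nlinarith [normSq_nonneg p]
  have h4 : Real.exp (Cg * (1 + (2 * 0 + 2 * normSq p))) * Real.sqrt (normSq p)
      ≤ Real.exp (0 + 2 * Cg * (1 + normSq p)) * (1 + 1 * normSq p) := by
    gcongr
    nlinarith
  linarith

lemma exists_logSol_le {C_U Cρ ε : ℝ} (hε : 0 < ε) (hC_U : 0 ≤ C_U)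
    (hUb : ∀ p, |-(U p) / 2| ≤ C_U * (1 + normSq p)) (hpos : ∀ t ∈ Icc τ T', ∀ p, 0 < ρ t p)
    (hle : ∀ t ∈ Icc τ T', ∀ p, ρ t p ≤ Real.exp (Cρ * (1 + normSq p))) :
    ∃ C : ℝ, 0 ≤ C ∧ ∀ t ∈ Icc τ T', ∀ p, logSol U ρ ε t p ≤ C * (1 + normSq p) := by
  obtain ⟨C, hC, h⟩ := (hasExpBound_exp (n := n) 0 Cρ 1).add (hasExpBound_const ε)
  refine ⟨C + C_U, by positivity, fun t ht p => ?_⟩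
  have h1 : Real.log (ρ t p + ε) ≤ C * (1 + normSq p) := by
    rw [Real.log_le_iff_le_exp (by linarith [hpos t ht p])]
    have := h p
    have := hle t ht p
    simp only [zero_add] at *
    linarith
  have h2 := (_root_.abs_le.1 (hUb p)).2
  unfold logSol
  linarith

lemma logSol_ge {C_U ε : ℝ} (hε : 0 < ε) (hUb : ∀ p, |-(U p) / 2| ≤ C_U * (1 + normSq p)) {t : ℝ}
    (hpos : ∀ p, 0 < ρ t p) (p : E n × E n) :
    Real.log ε - C_U * (1 + normSq p) ≤ logSol U ρ ε t p := by
  have h1 := Real.log_le_log hε (show ε ≤ ρ t p + ε by linarith [hpos p])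
  have h2 := (_root_.abs_le.1 (hUb p)).1
  unfold logSol
  linarith

lemma secDiff_logSol (ε t : ℝ) (p ξ : E n × E n) : secDiff (logSol U ρ ε t) p ξ
    = Real.log (ρ t (p + ξ) + ε) + Real.log (ρ t (p - ξ) + ε) - 2 * Real.log (ρ t p + ε)
      + secDiff (fun p => -(U p) / 2) p ξ := by
  simp only [secDiff, logSol]
  ring

/-- Lower bound of the second difference for large increments. -/
lemma exists_secDiff_ge_of_large {C_U Cw ε : ℝ} (hε : 0 < ε) (hC_U : 0 ≤ C_U) (hCw : 0 ≤ Cw)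
    (hUb : ∀ p, |-(U p) / 2| ≤ C_U * (1 + normSq p)) (hpos : ∀ t ∈ Icc τ T', ∀ p, 0 < ρ t p)
    (hle : ∀ t ∈ Icc τ T', ∀ p, logSol U ρ ε t p ≤ Cw * (1 + normSq p)) :
    ∃ C : ℝ, 0 ≤ C ∧ ∀ t ∈ Icc τ T', ∀ p ξ, 1 ≤ normSq ξ →
      -(Real.exp (C * (1 + normSq p)) * normSq ξ) ≤ secDiff (logSol U ρ ε t) p ξ := by
  refine ⟨2 * |Real.log ε| + 6 * C_U + 2 * Cw, by positivity, fun t ht p ξ hξ => ?_⟩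
  have h1 := logSol_ge hε hUb (hpos t ht) (p + ξ)
  have h2 := logSol_ge hε hUb (hpos t ht) (p - ξ)
  have h3 := hle t ht p
  have h4 := mul_le_mul_of_nonneg_left (normSq_add_le p ξ) hC_U
  have h5 := mul_le_mul_of_nonneg_left (normSq_sub_le p ξ) hC_U
  have h6 := neg_abs_le (Real.log ε)
  obtain ⟨C, hC⟩ : ∃ C, C = 2 * |Real.log ε| + 6 * C_U + 2 * Cw := ⟨_, rfl⟩
  obtain ⟨s, hs⟩ : ∃ s, s = 1 + normSq p := ⟨_, rfl⟩
  obtain ⟨x, hx⟩ : ∃ x, x = normSq ξ := ⟨_, rfl⟩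
  have hs1 : 1 ≤ s := by linarith [normSq_nonneg p]
  rw [← hC]
  rw [← hx] at hξ
  rw [show normSq p = s - 1 by linarith, ← hx] at h4 h5
  rw [← hs, ← hx]
  have h7 : C * s * x ≤ Real.exp (C * s) * x := by
    have := Real.add_one_le_exp (C * s)
    gcongr
    linarith
  have h8 : s + x ≤ 2 * (s * x) := by nlinarith
  have h9 : -(C * s * x) ≤ -(2 * |Real.log ε|) - C_U * (2 + 4 * s + 4 * x - 4) - 2 * Cw * s := by
    have e1 : |Real.log ε| ≤ |Real.log ε| * (s * x) :=
      le_mul_of_one_le_right (abs_nonneg _) (by nlinarith)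
    have e2 : C_U * (2 + 4 * s + 4 * x - 4) ≤ C_U * (6 * (s * x)) :=
      mul_le_mul_of_nonneg_left (by nlinarith) hC_U
    have e3 : Cw * s ≤ Cw * (s * x) := mul_le_mul_of_nonneg_left (by nlinarith) hCw
    rw [hC]
    linarith
  unfold secDiff
  rw [← hs] at h3
  linarith

/-- Lower bound of the second difference for small increments. -/
lemma exists_secDiff_ge_of_small {Cg Cρ k₀ a₁ ε : ℝ} (hτ : 0 < τ) (hT' : T' < T) (hε : 0 < ε)
    (hU : ContDiff ℝ (⊤ : ℕ∞) U)
    (hρ : ContDiffOn ℝ (⊤ : ℕ∞) (fun q : ℝ × (E n × E n) => ρ q.1 q.2) (Ioo 0 T ×ˢ univ))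
    (hpos : ∀ t ∈ Ioo 0 T, ∀ p : E n × E n, 0 < ρ t p) (hk₀ : 0 ≤ k₀) (ha₁ : 0 ≤ a₁) (hCg : 0 ≤ Cg)
    (hg : ∀ t ∈ Ioo 0 T, ∀ p d : E n × E n,
      |fderiv ℝ (ρ t) p d| ≤ Real.exp (Cg * (1 + normSq p)) * Real.sqrt (normSq d))
    (hle : ∀ t ∈ Icc τ T', ∀ p, ρ t p ≤ Real.exp (Cρ * (1 + normSq p)))
    (hHU : ∀ q d : E n × E n, -(k₀ * Real.exp (a₁ * normSq q) * normSq d)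
      ≤ coords d ⬝ᵥ Hess (fun p => -(U p) / 2) q *ᵥ coords d)
    (hHρ : ∀ t ∈ Ioo 0 T, ∀ q d : E n × E n, -(k₀ * Real.exp (a₁ * normSq q) * normSq d)
      ≤ coords d ⬝ᵥ Hess (ρ t) q *ᵥ coords d) :
    ∃ C : ℝ, 0 ≤ C ∧ ∀ t ∈ Icc τ T', ∀ p ξ, normSq ξ ≤ 1 →
      -(Real.exp (C * (1 + normSq p)) * normSq ξ) ≤ secDiff (logSol U ρ ε t) p ξ := by
  have hkE : HasExpBound fun p : E n × E n => k₀ * Real.exp (2 * a₁ * (1 + normSq p)) :=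
    (hasExpBound_const k₀).mul (by simpa using hasExpBound_exp (n := n) 0 (2 * a₁) 1)
      fun p => (Real.exp_pos _).le
  have hcE : HasExpBound fun p : E n × E n => Real.exp (Cρ * (1 + normSq p)) + ε :=
    (by simpa using hasExpBound_exp (n := n) 0 Cρ 1 : HasExpBound fun p : E n × E n =>
      Real.exp (Cρ * (1 + normSq p))).add (hasExpBound_const ε)
  have hLE : HasExpBound fun p : E n × E n => Real.exp (2 * Cg * (3 + 2 * normSq p)) := by
    refine (hasExpBound_exp (n := n) 0 (4 * Cg) (3 / 2)).mono fun p => le_of_eq ?_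
    congr 1
    ring
  obtain ⟨C, hC, h⟩ := (((hkE.mul hcE fun p => by positivity).add hLE).mul
    (hasExpBound_const (1 / ε ^ 2)) fun _ => by positivity).add hkE
  refine ⟨C, hC, fun t ht p ξ hξ => ?_⟩
  have htm : t ∈ Ioo 0 T := ⟨hτ.trans_le ht.1, ht.2.trans_lt hT'⟩
  have hx := normSq_nonneg ξ
  have hs := contDiff_slice hρ htm
  have h1 := secDiff_ge_of_quad_exp (hU.neg.div_const 2) hk₀ ha₁ hHU (p := p) hξ
  have h2 := secDiff_ge_of_quad_exp hs hk₀ ha₁ (hHρ t htm) (p := p) hξ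
  obtain ⟨m, hm⟩ : ∃ m, m = Real.exp (Cg * (3 + 2 * normSq p)) * Real.sqrt (normSq ξ) := ⟨_, rfl⟩
  have hinc : ∀ d : E n × E n, normSq d = normSq ξ → |ρ t (p + d) - ρ t p| ≤ m := fun d hd => by
    refine (abs_sub_le_of_fderiv hs hCg (hg t htm) p d).trans ?_
    rw [hd, hm]
    exact mul_le_mul_of_nonneg_right (Real.exp_le_exp.2 (mul_le_mul_of_nonneg_left (by linarith)
      hCg)) (Real.sqrt_nonneg _)
  have h3 := _root_.abs_le.1 (hinc ξ rfl)
  have h4 := _root_.abs_le.1 (hinc (-ξ) (normSq_neg ξ))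
  rw [← sub_eq_add_neg] at h4
  have hm2 : m ^ 2 = Real.exp (2 * Cg * (3 + 2 * normSq p)) * normSq ξ := by
    rw [hm, mul_pow, Real.sq_sqrt hx, ← Real.exp_nat_mul]
    congr 2
    push_cast
    ring
  have h5 := log_secDiff_ge (a := ρ t (p + ξ) + ε) (b := ρ t (p - ξ) + ε) (c := ρ t p + ε)
    (k := k₀ * Real.exp (2 * a₁ * (1 + normSq p))) (L := Real.exp (2 * Cg * (3 + 2 * normSq p)))
    (x := normSq ξ) hε (by linarith [hpos t htm (p + ξ)]) (by linarith [hpos t htm (p - ξ)])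
    (by linarith [hpos t htm p]) (by positivity) hx (Real.exp_pos _).le
    (by unfold secDiff at h2; linarith) (by
      rw [← hm2]
      have : |ρ t (p + ξ) - ρ t (p - ξ)| ≤ 2 * m := _root_.abs_le.2 ⟨by linarith, by linarith⟩
      have := sq_le_sq' (_root_.abs_le.1 this).1 (_root_.abs_le.1 this).2
      linarith)
  rw [secDiff_logSol]
  have h6 := mul_le_mul_of_nonneg_right (h p) hx
  have h7 : (k₀ * Real.exp (2 * a₁ * (1 + normSq p)) * (ρ t p + ε)
      + Real.exp (2 * Cg * (3 + 2 * normSq p))) / ε ^ 2 * normSq ξ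
      ≤ (k₀ * Real.exp (2 * a₁ * (1 + normSq p)) * (Real.exp (Cρ * (1 + normSq p)) + ε)
      + Real.exp (2 * Cg * (3 + 2 * normSq p))) * (1 / ε ^ 2) * normSq ξ := by
    rw [mul_one_div]
    have := hle t ht p
    gcongr
  linarith

end Bounds

/-! ### Removing the regularisation -/

section Limits

variable {n : ℕ} {T : ℝ} {U : E n × E n → ℝ} {ρ : ℝ → E n × E n → ℝ}

lemma tendsto_secDiff_logSol {t : ℝ} (hpos : ∀ p, 0 < ρ t p) (p ξ : E n × E n) :
    Filter.Tendsto (fun ε => secDiff (logSol U ρ ε t) p ξ) (nhdsWithin 0 (Ioi 0))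
      (nhds (secDiff (logSol U ρ 0 t) p ξ)) := by
  have h : ContinuousAt (fun ε => secDiff (logSol U ρ ε t) p ξ) 0 := by
    have hl : ∀ q, ContinuousAt (fun ε => Real.log (ρ t q + ε)) 0 := fun q =>
      ContinuousAt.log (by fun_prop) (by simpa using (hpos q).ne')
    simp only [secDiff, logSol]
    exact (((hl _).sub continuousAt_const).add ((hl _).sub continuousAt_const)).sub
      (continuousAt_const.mul ((hl _).sub continuousAt_const))
  exact h.tendsto.mono_left nhdsWithin_le_nhds

lemma quad_hess_ge {φ : E n × E n → ℝ} {p : E n × E n} {k : ℝ}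
    (h : (Hess φ p + k • (1 : Matrix (Fin n ⊕ Fin n) (Fin n ⊕ Fin n) ℝ)).PosSemidef)
    (d : E n × E n) : -(k * normSq d) ≤ coords d ⬝ᵥ Hess φ p *ᵥ coords d := by
  have := quad_nonneg h (coords d)
  rw [add_mulVec, dotProduct_add, quad_smul_one] at this
  linarith

lemma quad_hess_le {φ : E n × E n → ℝ} {p : E n × E n} {k : ℝ}
    (h : (k • (1 : Matrix (Fin n ⊕ Fin n) (Fin n ⊕ Fin n) ℝ) - Hess φ p).PosSemidef)
    (d : E n × E n) : coords d ⬝ᵥ Hess φ p *ᵥ coords d ≤ k * normSq d := by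
  have := quad_nonneg h (coords d)
  rw [sub_mulVec, dotProduct_sub, quad_smul_one] at this
  linarith

/-- If second differences of `φ` dominate a quadratic form, so does its Hessian. -/
lemma quad_le_hess_of_secDiff {φ : E n × E n → ℝ} (hφ : ContDiff ℝ (⊤ : ℕ∞) φ) {p : E n × E n}
    {M : Matrix (Fin n ⊕ Fin n) (Fin n ⊕ Fin n) ℝ}
    (h : ∀ ξ, coords ξ ⬝ᵥ M *ᵥ coords ξ ≤ secDiff φ p ξ) (ξ : E n × E n) :
    coords ξ ⬝ᵥ M *ᵥ coords ξ ≤ coords ξ ⬝ᵥ Hess φ p *ᵥ coords ξ := by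
  obtain ⟨m, hm⟩ : ∃ m, m = coords ξ ⬝ᵥ M *ᵥ coords ξ := ⟨_, rfl⟩
  have h1 : ∀ s : ℝ, HasDerivAt
      (fun s : ℝ => φ (p + s • ξ) + φ (p + s • (-ξ)) - 2 * φ p - s ^ 2 * m)
      (fderiv ℝ φ (p + s • ξ) ξ + fderiv ℝ φ (p + s • (-ξ)) (-ξ) - 2 * s * m) s := fun s => by
    refine ((((hasDerivAt_comp_line hφ p ξ s).fun_add
      (hasDerivAt_comp_line hφ p (-ξ) s)).sub_const _).fun_sub
      (((hasDerivAt_id' s).fun_pow 2).mul_const m)).congr_deriv ?_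
    norm_num
  have h2 : HasDerivAt (fun s : ℝ => fderiv ℝ φ (p + s • ξ) ξ
      + fderiv ℝ φ (p + s • (-ξ)) (-ξ) - 2 * s * m)
      (2 * (coords ξ ⬝ᵥ Hess φ p *ᵥ coords ξ) - 2 * m) 0 := by
    refine (((hasDerivAt_fderiv_line hφ p ξ 0).fun_add
      (hasDerivAt_fderiv_line hφ p (-ξ) 0)).fun_sub
      (((hasDerivAt_id' (0 : ℝ)).const_mul 2).mul_const m)).congr_deriv ?_
    simp only [zero_smul, add_zero, coords_neg, mulVec_neg, neg_dotProduct_neg]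
    ring
  have h3 := second_deriv_nonneg_of_isLocalMin h1 h2 (Filter.Eventually.of_forall fun s => by
    have := h (s • ξ)
    rw [coords_smul, mulVec_smul, smul_dotProduct, dotProduct_smul, ← hm] at this
    simp only [smul_eq_mul, secDiff, sub_eq_add_neg p, ← smul_neg] at this
    simp only [zero_smul, add_zero, smul_neg, neg_zero] at this ⊢
    linarith)
  linarith

lemma pd_sub_half {f g : E n × E n → ℝ} (hf : ContDiff ℝ (⊤ : ℕ∞) f) (hg : ContDiff ℝ (⊤ : ℕ∞) g)
    (j : Fin n ⊕ Fin n) : pd (fun q => f q - g q / 2) j = fun q => pd f j q - pd g j q / 2 := by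
  funext q
  have h1 := (hasDerivAt_comp_line hf q (_root_.stdBasis n j) 0).fun_sub
    ((hasDerivAt_comp_line hg q (_root_.stdBasis n j) 0).div_const 2)
  have h2 := hasDerivAt_comp_line (hf.sub (hg.div_const 2)) q (_root_.stdBasis n j) 0
  have h3 := h2.unique h1
  simp only [zero_smul, add_zero] at h3
  exact h3

lemma hess_sub_half {f g : E n × E n → ℝ} (hf : ContDiff ℝ (⊤ : ℕ∞) f)
    (hg : ContDiff ℝ (⊤ : ℕ∞) g) (p : E n × E n) :
    Hess (fun q => f q - g q / 2) p = Hess f p - (1 / 2 : ℝ) • Hess g p := by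
  ext i j
  simp only [Hess, pd_sub_half hf hg, pd_sub_half (contDiff_pd hf _) (contDiff_pd hg _), of_apply,
    Matrix.sub_apply, Matrix.smul_apply, smul_eq_mul]
  ring

end Limits

section Comparison

variable {n : ℕ} {T : ℝ} {U : E n × E n → ℝ} {ρ : ℝ → E n × E n → ℝ} {a₀ a₁ : ℝ}
  {K : Matrix (Fin n ⊕ Fin n) (Fin n ⊕ Fin n) ℝ}
  {N : ℝ → Matrix (Fin n ⊕ Fin n) (Fin n ⊕ Fin n) ℝ}

/-- The Harnack inequality for second differences of the regularised logarithm, with the Riccati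
solution started at time `τ`. -/
lemma quad_le_secDiff_logSol (hn : 1 ≤ n) {T' τ ε : ℝ} (hτ : 0 < τ) (hτT' : τ < T') (hT' : T' < T)
    (hε : 0 < ε) (hU : ContDiff ℝ (⊤ : ℕ∞) U)
    (hρ : ContDiffOn ℝ (⊤ : ℕ∞) (fun q : ℝ × (E n × E n) => ρ q.1 q.2) (Ioo 0 T ×ˢ univ))
    (hpos : ∀ t ∈ Ioo 0 T, ∀ p : E n × E n, 0 < ρ t p)
    (hpde : ∀ t ∈ Ioo 0 T, ∀ p : E n × E n,
      deriv (fun τ => ρ τ p) t =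
        lapV (ρ t) p - (∑ i : Fin n, pd U (Sum.inr i) p * pd (ρ t) (Sum.inr i) p)
          - ∑ i : Fin n, p.2 i * pd (ρ t) (Sum.inl i) p)
    (ha₀ : 0 < a₀) (ha₁ : 0 < a₁)
    (hgrow1 : ∀ t ∈ Ioo 0 T, ∀ p : E n × E n,
      Real.sqrt (gradNormSq (ρ t) p) ≤ a₀ * Real.exp (-U p / 2) * (‖p.1‖ + ‖p.2‖))
    (hgrow2 : ∀ t ∈ Ioo 0 T, ∀ p : E n × E n,
      (Hess (ρ t) p + (a₀ * Real.exp (a₁ * (‖p.1‖ ^ 2 + ‖p.2‖ ^ 2))) •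
        (1 : Matrix (Fin n ⊕ Fin n) (Fin n ⊕ Fin n) ℝ)).PosSemidef)
    (hgrow3 : ∀ p : E n × E n,
      ((a₀ * Real.exp (a₁ * (‖p.1‖ ^ 2 + ‖p.2‖ ^ 2))) •
        (1 : Matrix (Fin n ⊕ Fin n) (Fin n ⊕ Fin n) ℝ) - Hess U p).PosSemidef)
    (hK : K.PosSemidef) (hh : ∀ p : E n × E n, (Hess (hfun U) p + K).PosSemidef)
    (hNsymm : ∀ t ∈ Ioo 0 T, (N t).IsSymm) (hNinv : ∀ t ∈ Ioo 0 T, IsUnit (N t))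
    (hNode : ∀ t ∈ Ioo 0 T, ∀ i j, HasDerivAt (fun τ => N τ i j)
      ((N t * Cmat n + (Cmat n)ᵀ * N t + N t * Dmat n * N t - K) i j) t)
    (hNlim : ∀ i j, Filter.Tendsto (fun t => (N t)⁻¹ i j) (nhdsWithin 0 (Ioi 0)) (nhds 0))
    (hNneg : ∀ t ∈ Ioo 0 T, (-(N t)).PosSemidef)
    (hNmono : ∀ t ∈ Ioo 0 T,
      (N t * Cmat n + (Cmat n)ᵀ * N t + N t * Dmat n * N t - K).PosSemidef) (p ξ : E n × E n) :
    coords ξ ⬝ᵥ N (T' - τ) *ᵥ coords ξ ≤ secDiff (logSol U ρ ε T') p ξ := by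
  have hHρ : ∀ t ∈ Ioo 0 T, ∀ q d : E n × E n, -(a₀ * Real.exp (a₁ * normSq q) * normSq d)
      ≤ coords d ⬝ᵥ Hess (ρ t) q *ᵥ coords d := fun t ht q d => quad_hess_ge (hgrow2 t ht q) d
  have hHU : ∀ q d : E n × E n, -(a₀ * Real.exp (a₁ * normSq q) * normSq d)
      ≤ coords d ⬝ᵥ Hess (fun p => -(U p) / 2) q *ᵥ coords d := fun q d => by
    have h1 : coords d ⬝ᵥ Hess U q *ᵥ coords d ≤ a₀ * Real.exp (a₁ * normSq q) * normSq d :=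
      quad_hess_le (hgrow3 q) d
    have h2 : 0 ≤ a₀ * Real.exp (a₁ * normSq q) * normSq d :=
      mul_nonneg (by positivity) (normSq_nonneg d)
    rw [hess_neg_half hU, smul_mulVec, dotProduct_smul, smul_eq_mul]
    linarith
  have hsm := contDiff_hfun hU
  have hw : ContDiff ℝ (⊤ : ℕ∞) fun p => -(U p) / 2 := hU.neg.div_const 2
  have hst := isStationarySol_neg_half hU
  obtain ⟨C₀, hC₀, hlow⟩ := quadratic_lower_of_hess hsm hh
  obtain ⟨C_U, hC_U, hUb⟩ := hst.abs_le hn hw hC₀ hlow ha₀.le ha₁.le hHU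
  obtain ⟨Ch, hCh, hhb⟩ := hst.source_le hw hsm hh hC_U hUb
  obtain ⟨Cg, hCg, hg⟩ := exists_fderiv_le ha₀ hUb hgrow1
  obtain ⟨Cρ, -, hρb⟩ := exists_sol_le hτ hT' hρ hCg hg
  have hposI : ∀ t ∈ Icc τ T', ∀ p, 0 < ρ t p := fun t ht =>
    hpos t ⟨hτ.trans_le ht.1, ht.2.trans_lt hT'⟩
  obtain ⟨Cw, hCw, hwb⟩ := exists_logSol_le hε hC_U hUb hposI hρb
  obtain ⟨C₂, hC₂, hlarge⟩ := exists_secDiff_ge_of_large hε hC_U hCw hUb hposI hwb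
  obtain ⟨C₃, -, hsmall⟩ := exists_secDiff_ge_of_small hτ hT' hε hU hρ hpos ha₀.le ha₁.le hCg hg
    hρb hHU hHρ
  have hmem : ∀ t ∈ Ioc τ T', t - τ ∈ Ioo 0 T := fun t ht =>
    ⟨sub_pos.2 ht.1, by linarith [ht.2]⟩
  have hT'mem : T' ∈ Ioc τ T' := ⟨hτT', le_rfl⟩
  obtain ⟨c, hc, hNc⟩ := exists_quad_le (hNneg _ (hmem T' hT'mem)) (hNsymm _ (hmem T' hT'mem))
    (hNinv _ (hmem T' hT'mem))
  have H : HasWindowBounds τ T' (logSol U ρ ε) (fun t ξ => coords ξ ⬝ᵥ N (t - τ) *ᵥ coords ξ)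
      (hfun U) (fun ξ => coords ξ ⬝ᵥ K *ᵥ coords ξ) c (max C₂ C₃) Cw Ch :=
    { pos_c := hc
      nonneg_C₁ := hC₂.trans (le_max_left _ _)
      nonneg_Cw := hCw
      nonneg_Ch := hCh
      sol_le := fun t ht => hwb t (Ioc_subset_Icc_self ht)
      le_secDiff := fun t ht p ξ => by
        have h1 := normSq_nonneg ξ
        have h2 := normSq_nonneg p
        have hmono : ∀ C ≤ max C₂ C₃, -(Real.exp (max C₂ C₃ * (1 + normSq p)) * normSq ξ)
            ≤ -(Real.exp (C * (1 + normSq p)) * normSq ξ) := fun C hC => by gcongr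
        rcases le_total 1 (normSq ξ) with h | h
        · exact (hmono _ (le_max_left _ _)).trans (hlarge t (Ioc_subset_Icc_self ht) p ξ h)
        · exact (hmono _ (le_max_right _ _)).trans (hsmall t (Ioc_subset_Icc_self ht) p ξ h)
      form_le := fun t ht ξ => (quad_mono hNode hNmono (coords ξ) (hmem t ht) (hmem T' hT'mem)
        (sub_le_sub_right ht.2 τ)).trans (hNc ξ)
      blowup := fun L => by
        have hshift : Filter.Tendsto (fun t => t - τ) (nhdsWithin τ (Ioi τ))
            (nhdsWithin 0 (Ioi 0)) := by
          refine tendsto_nhdsWithin_iff.2 ⟨?_, ?_⟩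
          · have : ContinuousAt (fun t => t - τ) τ := by fun_prop
            simpa using this.tendsto.mono_left nhdsWithin_le_nhds
          · filter_upwards [self_mem_nhdsWithin] with t ht using sub_pos.2 (mem_Ioi.1 ht)
        exact hshift.eventually (eventually_quad_le (hτ.trans (hτT'.trans hT')) hNsymm hNinv hNlim
          hNneg L)
      nonneg_k := fun ξ => quad_nonneg hK _
      source_secDiff := secDiff_ge_of_hess hsm hh
      source_le := hhb }
  exact H.form_le_secDiff (isFlowSol_logSol hτ.le hT' hε.le hU hρ hpos hpde)
    (isRiccatiForm_quad hτ.le hT' hNsymm hNode) T' hT'mem p ξ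

end Comparison

/-- **Matrix differential Harnack inequality from a Riccati solution** (Theorem 4.1):
if `∇²h ≥ −K` and `N` solves `N' = NC + CᵀN + NDN − K` with `N⁻¹ → 0` as `t → 0⁺`, `N ≤ 0`
and `N' ≥ 0`, then `∇² log ρ − ½∇²U ≥ N(t)`. -/
theorem matrix_harnack_of_riccati
    (n : ℕ) (hn : 1 ≤ n) (T : ℝ) (hT : 0 < T)
    (U : E n × E n → ℝ) (hU : ContDiff ℝ (⊤ : ℕ∞) U)
    (ρ : ℝ → E n × E n → ℝ)
    (hρ : ContDiffOn ℝ (⊤ : ℕ∞) (fun q : ℝ × (E n × E n) => ρ q.1 q.2) (Ioo 0 T ×ˢ univ))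
    (hpos : ∀ t ∈ Ioo 0 T, ∀ p : E n × E n, 0 < ρ t p)
    (hpde : ∀ t ∈ Ioo 0 T, ∀ p : E n × E n,
      deriv (fun τ => ρ τ p) t =
        lapV (ρ t) p - (∑ i : Fin n, pd U (Sum.inr i) p * pd (ρ t) (Sum.inr i) p)
          - ∑ i : Fin n, p.2 i * pd (ρ t) (Sum.inl i) p)
    (a₀ a₁ : ℝ) (ha₀ : 0 < a₀) (ha₁ : 0 < a₁)
    (hgrow1 : ∀ t ∈ Ioo 0 T, ∀ p : E n × E n,
      Real.sqrt (gradNormSq (ρ t) p) ≤ a₀ * Real.exp (-U p / 2) * (‖p.1‖ + ‖p.2‖))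
    (hgrow2 : ∀ t ∈ Ioo 0 T, ∀ p : E n × E n,
      (Hess (ρ t) p + (a₀ * Real.exp (a₁ * (‖p.1‖ ^ 2 + ‖p.2‖ ^ 2))) •
        (1 : Matrix (Fin n ⊕ Fin n) (Fin n ⊕ Fin n) ℝ)).PosSemidef)
    (hgrow3 : ∀ p : E n × E n,
      ((a₀ * Real.exp (a₁ * (‖p.1‖ ^ 2 + ‖p.2‖ ^ 2))) •
        (1 : Matrix (Fin n ⊕ Fin n) (Fin n ⊕ Fin n) ℝ) - Hess U p).PosSemidef)
    (K : Matrix (Fin n ⊕ Fin n) (Fin n ⊕ Fin n) ℝ) (hK : K.PosSemidef)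
    (hh : ∀ p : E n × E n, (Hess (hfun U) p + K).PosSemidef)
    (N : ℝ → Matrix (Fin n ⊕ Fin n) (Fin n ⊕ Fin n) ℝ)
    (hNsymm : ∀ t ∈ Ioo 0 T, (N t).IsSymm)
    (hNinv : ∀ t ∈ Ioo 0 T, IsUnit (N t))
    (hNode : ∀ t ∈ Ioo 0 T, ∀ i j, HasDerivAt (fun τ => N τ i j)
      ((N t * Cmat n + (Cmat n)ᵀ * N t + N t * Dmat n * N t - K) i j) t)
    (hNlim : ∀ i j, Filter.Tendsto (fun t => (N t)⁻¹ i j) (nhdsWithin 0 (Ioi 0)) (nhds 0))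
    (hNneg : ∀ t ∈ Ioo 0 T, (-(N t)).PosSemidef)
    (hNmono : ∀ t ∈ Ioo 0 T,
      (N t * Cmat n + (Cmat n)ᵀ * N t + N t * Dmat n * N t - K).PosSemidef) :
    ∀ t ∈ Ioo 0 T, ∀ p : E n × E n,
      (Hess (fun q => Real.log (ρ t q)) p - (1/2 : ℝ) • Hess U p - N t).PosSemidef := by
  intro t ht p
  have hs := contDiff_slice hρ ht
  have hlog : ContDiff ℝ (⊤ : ℕ∞) fun q => Real.log (ρ t q) := hs.log fun q => (hpos t ht q).ne'
  have hcont : ∀ y : Fin n ⊕ Fin n → ℝ, ContinuousAt (fun s => y ⬝ᵥ N s *ᵥ y) t := fun y =>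
    (hasDerivAt_quad (hNode t ht) (y := fun _ => y) (y' := 0)
      fun i => hasDerivAt_const _ _).continuousAt
  have hsec : ∀ ξ : E n × E n, coords ξ ⬝ᵥ N t *ᵥ coords ξ ≤ secDiff (logSol U ρ 0 t) p ξ := by
    intro ξ
    have hτlim : Filter.Tendsto (fun τ => coords ξ ⬝ᵥ N (t - τ) *ᵥ coords ξ)
        (nhdsWithin 0 (Ioi 0)) (nhds (coords ξ ⬝ᵥ N t *ᵥ coords ξ)) := by
      have hsub : Filter.Tendsto (fun τ => t - τ) (nhdsWithin 0 (Ioi 0)) (nhds t) := by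
        have : ContinuousAt (fun τ => t - τ) 0 := by fun_prop
        simpa using this.tendsto.mono_left nhdsWithin_le_nhds
      exact (hcont _).tendsto.comp hsub
    refine le_of_tendsto hτlim ?_
    filter_upwards [Ioo_mem_nhdsGT ht.1] with τ hτ
    refine ge_of_tendsto (tendsto_secDiff_logSol (hpos t ht) p ξ) ?_
    filter_upwards [self_mem_nhdsWithin] with ε hε
    exact quad_le_secDiff_logSol hn hτ.1 hτ.2 ht.2 hε hU hρ hpos hpde ha₀ ha₁ hgrow1 hgrow2 hgrow3
      hK hh hNsymm hNinv hNode hNlim hNneg hNmono p ξ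
  have hlogSol : logSol U ρ 0 t = fun q => Real.log (ρ t q) - U q / 2 := by
    funext q
    simp only [logSol, add_zero]
  rw [hlogSol] at hsec
  have hquad := quad_le_hess_of_secDiff (hlog.sub (hU.div_const 2)) hsec
  rw [← hess_sub_half hlog hU]
  have hsymm := (hess_isSymm (hlog.sub (hU.div_const 2)) p).sub (hNsymm t ht)
  refine PosSemidef.of_dotProduct_mulVec_nonneg ?_ fun y => ?_
  · rw [IsHermitian, conjTranspose_eq_transpose_of_trivial]
    exact hsymm
  · obtain ⟨ξ, rfl⟩ := exists_coords_eq y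
    rw [star_trivial, sub_mulVec, dotProduct_sub]
    exact sub_nonneg.2 (hquad ξ)
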